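/- Let G = G_1 * G_2 * ... * G_n * F, where each factor G_i is not infinite cyclic and F is a free group of finite rank. If φ: G → G is a symmetric monomorphism of G, then the fixed subgroup Fix(φ) = {g ∈ G : φ(g) = g} has Kurosh rank at most n + rank(F) with respect to this free product decomposition of G. -/

import Mathlib

universe u

open Monoid

instance sumElimGroup {α β : Type*} (A : α → Type u) (B : β → Type u)
    [∀ a, Group (A a)] [∀ b, Group (B b)] (x : α ⊕ β) : Group (Sum.elim A B x) :=
  match x with
  | .inl a => inferInstanceAs (Group (A a))
  | .inr b => inferInstanceAs (Group (B b))

/-- The free factor `G_i` of a free product, viewed as a subgroup. -/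
def factorSubgroup {ι : Type*} {M : ι → Type*} [∀ i, Group (M i)] (i : ι) :
    Subgroup (CoprodI M) := (CoprodI.of (i := i)).range

/-- The conjugate `g S g⁻¹` of a subgroup `S`. -/
def conjSubgroup {G : Type*} [Group G] (g : G) (S : Subgroup G) : Subgroup G :=
  S.map (MulAut.conj g).toMonoidHom

/-- The `n`-th iterate of an endomorphism. -/
def iterHom {G : Type*} [Group G] (φ : G →* G) : ℕ → (G →* G)
  | 0 => MonoidHom.id G
  | n + 1 => φ.comp (iterHom φ n)

/-- The stable image `φ^∞(G) = ⋂ₙ φⁿ(G)`. -/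
def stableImage {G : Type*} [Group G] (φ : G →* G) : Subgroup G :=
  ⨅ n : ℕ, (iterHom φ (n + 1)).range

/-- The fixed subgroup of an endomorphism. -/
def fixedSubgroup {G : Type*} [Group G] (φ : G →* G) : Subgroup G where
  carrier := {g | φ g = g}
  one_mem' := by simp
  mul_mem' := by intro a b ha hb; simp only [Set.mem_setOf_eq, map_mul] at *; rw [ha, hb]
  inv_mem' := by intro a ha; simp only [Set.mem_setOf_eq, map_inv] at *; rw [ha]

/-- `H` has Kurosh rank at most `k` with respect to the given splitting. -/
def HasKuroshRankLE {ι : Type} {M : ι → Type} [∀ i, Group (M i)]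
    (H : Subgroup (CoprodI M)) (k : ℕ) : Prop :=
  ∃ (m r : ℕ) (J : Fin m → ι) (g : Fin m → CoprodI M)
    (e : H ≃* CoprodI (Sum.elim
      (fun i : Fin m => ↥(conjSubgroup (g i) (factorSubgroup (J i)) ⊓ H))
      (fun _ : Fin r => Multiplicative ℤ))),
    m + r ≤ k ∧
    (∀ i : Fin m, Nontrivial ↥(conjSubgroup (g i) (factorSubgroup (J i)) ⊓ H)) ∧
    ∀ (i : Fin m) (x : ↥(conjSubgroup (g i) (factorSubgroup (J i)) ⊓ H)),
      ((e.symm (CoprodI.of (i := Sum.inl i) x) : H) : CoprodI M) = (x : CoprodI M)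

/-- A homomorphism between free products is *symmetric* if each non-infinite-cyclic free
factor of the domain is mapped into a conjugate of some non-infinite-cyclic free factor of
the codomain. -/
def IsSymmetric {ι κ : Type} {M : ι → Type} {N : κ → Type}
    [∀ i, Group (M i)] [∀ j, Group (N j)]
    (φ : Monoid.CoprodI M →* Monoid.CoprodI N) : Prop :=
  ∀ i : ι, ¬ Nonempty (M i ≃* Multiplicative ℤ) →
    ∃ (j : κ) (g : Monoid.CoprodI N), ¬ Nonempty (N j ≃* Multiplicative ℤ) ∧
      (factorSubgroup i).map φ ≤ conjSubgroup g (factorSubgroup j)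

/-- A group split as a free product of subgroups `A i` and infinite cyclic groups generated by
`a j`, encoded by generation and by the existence of potentials for arbitrary edge labels on the
associated Bass-Serre graph. -/
structure StarSplit (G : Type) [Group G] (n p : ℕ) where
  A : Fin n → Subgroup G
  a : Fin p → G
  gen : Subgroup.closure ((⋃ i, (A i : Set G)) ∪ Set.range a) = ⊤
  pot : ∀ (W : Type) [Group W] (l : Fin n → G → W) (m : Fin p → G → W), ∃ Λ : G → W,
    Λ 1 = 1 ∧ (∀ i, ∀ g, ∀ b ∈ A i, Λ (g * b) * l i (g * b) = Λ g * l i g) ∧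
    ∀ j g, Λ (g * a j) = Λ g * m j g

namespace StarSplit

variable {G : Type} [Group G] {n p : ℕ} (S : StarSplit G n p)

/-- Vertices of the Bass-Serre tree. -/
abbrev V := G ⊕ Σ i, G ⧸ S.A i

/-- The base vertex. -/
abbrev base (g : G) : S.V := Sum.inl g

/-- The vertex stabilised by a conjugate of a factor. -/
abbrev star (i : Fin n) (g : G) : S.V := Sum.inr ⟨i, (g : G ⧸ S.A i)⟩

/-- The endpoint of the edge of type `t` issuing from `base g`. -/
def tgt (g : G) : Fin n ⊕ Fin p → S.V
  | .inl i => S.star i g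
  | .inr j => S.base (g * S.a j)

lemma smul_base (g h : G) : g • S.base h = S.base (g * h) := rfl

lemma smul_star (g h : G) (i : Fin n) : g • S.star i h = S.star i (g * h) := rfl

lemma smul_tgt (g h : G) (t : Fin n ⊕ Fin p) : g • S.tgt h t = S.tgt (g * h) t := by
  cases t with
  | inl i => rfl
  | inr j => simp [tgt, mul_assoc]

lemma star_eq_iff {i : Fin n} {g h : G} : S.star i g = S.star i h ↔ g⁻¹ * h ∈ S.A i := by
  simp [star, QuotientGroup.eq]

@[elab_as_elim]
lemma gen_induction {Q : G → Prop} (one : Q 1) (hA : ∀ i g, ∀ b ∈ S.A i, Q g → Q (g * b))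
    (ha : ∀ j g, Q (g * S.a j) ↔ Q g) (g : G) : Q g := by
  have hg : g ∈ Subgroup.closure ((⋃ i, (S.A i : Set G)) ∪ Set.range S.a) := by
    rw [S.gen]; trivial
  induction hg using Subgroup.closure_induction_right with
  | one => exact one
  | mul_right x hx y hy ih =>
    rcases hy with hy | ⟨j, rfl⟩
    · obtain ⟨i, hi⟩ := Set.mem_iUnion.1 hy
      exact hA i _ _ hi ih
    · exact (ha _ _).2 ih
  | mul_inv_cancel x hx y hy ih =>
    rcases hy with hy | ⟨j, rfl⟩
    · obtain ⟨i, hi⟩ := Set.mem_iUnion.1 hy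
      exact hA i _ _ ((S.A i).inv_mem hi) ih
    · rw [← ha j]; simpa using ih

lemma exists_vpot {k : Type} [AddCommGroup k] (w : G → Fin n ⊕ Fin p → k) :
    ∃ h : S.V → k, h (S.base 1) = 0 ∧ ∀ g t, h (S.tgt g t) - h (S.base g) = w g t := by
  obtain ⟨Λ, h1, hA, ha⟩ := S.pot (Multiplicative k)
    (fun i g => Multiplicative.ofAdd (w g (.inl i)))
    (fun j g => Multiplicative.ofAdd (w g (.inr j)))
  refine ⟨Sum.elim (fun g => (Λ g).toAdd) (fun s => Quotient.liftOn' s.2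
    (fun g => (Λ g).toAdd + w g (.inl s.1)) ?_), ?_, ?_⟩
  · intro g g' hgg'
    have := hA s.1 g _ (QuotientGroup.leftRel_apply.1 hgg')
    simp only [mul_inv_cancel_left] at this
    have := congrArg Multiplicative.toAdd this
    simpa using this.symm
  · simp [h1]
  · rintro g (i | j)
    · change (Λ g).toAdd + w g (.inl i) - (Λ g).toAdd = _
      abel
    · change (Λ (g * S.a j)).toAdd - (Λ g).toAdd = _
      simp [ha]

lemma V_induction {Q : S.V → Prop} (one : Q (S.base 1))
    (hQ : ∀ g t, Q (S.tgt g t) ↔ Q (S.base g)) (v : S.V) : Q v := by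
  have key : ∀ g, Q (S.base g) := by
    intro g
    induction g using S.gen_induction with
    | one => exact one
    | hA i g b hb ih =>
      rw [← hQ _ (.inl i)] at ih ⊢
      convert ih using 1
      exact (S.star_eq_iff.2 (by simpa using hb)).symm
    | ha j g => exact hQ g (.inr j)
  rcases v with g | ⟨i, c⟩
  · exact key g
  · induction c using Quotient.inductionOn' with
    | h g => exact (hQ g (.inl i)).2 (key g)

lemma vpot_unique {k : Type} [AddCommGroup k] {h h' : S.V → k} (h1 : h (S.base 1) = h' (S.base 1))
    (hh : ∀ g t, h (S.tgt g t) - h (S.base g) = h' (S.tgt g t) - h' (S.base g)) : h = h' := by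
  funext v
  induction v using S.V_induction with
  | one => exact h1
  | hQ g t =>
    have := hh g t
    constructor <;> intro h0 <;> rw [h0] at this
    · simpa using this
    · simpa using this

open Classical in
/-- The half-space function of the edge of type `t` at the base vertex. -/
noncomputable def hs (k : Type) [Ring k] (t : Fin n ⊕ Fin p) : S.V → k :=
  (S.exists_vpot (fun g' t' => if g' = 1 ∧ t' = t then (1 : k) else 0)).choose

open Classical in
lemma hs_spec (k : Type) [Ring k] (t : Fin n ⊕ Fin p) (g : G) (t' : Fin n ⊕ Fin p) :
    S.hs k t (S.tgt g t') - S.hs k t (S.base g) = if g = 1 ∧ t' = t then (1 : k) else 0 :=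
  (S.exists_vpot (fun g' t' => if g' = 1 ∧ t' = t then (1 : k) else 0)).choose_spec.2 g t'

open Classical in
lemma hs_smul_spec (k : Type) [Ring k] (t : Fin n ⊕ Fin p) (x g : G) (t' : Fin n ⊕ Fin p) :
    S.hs k t (x⁻¹ • S.tgt g t') - S.hs k t (x⁻¹ • S.base g) =
      if g = x ∧ t' = t then (1 : k) else 0 := by
  rw [S.smul_tgt, S.smul_base, hs_spec]
  simp [inv_mul_eq_one, eq_comm]

lemma tgt_ne (g : G) (t : Fin n ⊕ Fin p) : S.tgt g t ≠ S.base g := by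
  intro h
  have := S.hs_smul_spec ℤ t g g t
  simp [h] at this

lemma a_mul_a_ne_one (i j : Fin p) : S.a i * S.a j ≠ 1 := by
  intro h
  obtain ⟨f, -, hf⟩ := S.exists_vpot (k := ℤ) (fun _ _ => 1)
  have h1 := hf 1 (.inr i)
  have h2 := hf (S.a i) (.inr j)
  simp only [tgt, one_mul, h] at h1 h2
  omega

/-- The Bass-Serre tree. -/
def tree : SimpleGraph S.V where
  Adj x y := ∃ g t, (x = S.base g ∧ y = S.tgt g t) ∨ (y = S.base g ∧ x = S.tgt g t)
  symm := ⟨by rintro x y ⟨g, t, h⟩; exact ⟨g, t, h.symm⟩⟩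
  loopless := ⟨by
    rintro x ⟨g, t, ⟨h, h'⟩ | ⟨h, h'⟩⟩
    · exact S.tgt_ne g t (h'.symm.trans h)
    · exact S.tgt_ne g t (h'.symm.trans h)⟩

lemma adj_tgt (g : G) (t : Fin n ⊕ Fin p) : S.tree.Adj (S.base g) (S.tgt g t) :=
  ⟨g, t, Or.inl ⟨rfl, rfl⟩⟩

lemma adj_smul {x y : S.V} (g : G) (h : S.tree.Adj x y) : S.tree.Adj (g • x) (g • y) := by
  obtain ⟨c, t, ⟨rfl, rfl⟩ | ⟨rfl, rfl⟩⟩ := h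
  · rw [S.smul_tgt]; exact S.adj_tgt _ _
  · rw [S.smul_tgt]; exact (S.adj_tgt _ _).symm

lemma tree_isTree : S.tree.IsTree := by
  refine ⟨⟨fun x y => ?_⟩, ?_⟩
  · have key : ∀ v, S.tree.Reachable (S.base 1) v := fun v => by
      induction v using S.V_induction with
      | one => rfl
      | hQ g t =>
        exact ⟨fun h => h.trans (S.adj_tgt g t).symm.reachable,
          fun h => h.trans (S.adj_tgt g t).reachable⟩
    exact (key x).symm.trans (key y)
  · rw [SimpleGraph.isAcyclic_iff_forall_adj_isBridge]
    have main : ∀ g t, S.tree.IsBridge s(S.base g, S.tgt g t) := by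
      intro g t
      rw [SimpleGraph.isBridge_iff]
      intro hr
      have hc : ∀ x y, (S.tree.deleteEdges {s(S.base g, S.tgt g t)}).Reachable x y →
          S.hs ℤ t (g⁻¹ • x) = S.hs ℤ t (g⁻¹ • y) := by
        rintro x y ⟨w⟩
        induction w with
        | nil => rfl
        | cons hadj _ ih =>
          rw [← ih]
          rw [SimpleGraph.deleteEdges_adj] at hadj
          obtain ⟨⟨c, t', ⟨rfl, rfl⟩ | ⟨rfl, rfl⟩⟩, hne⟩ := hadj
          · have := S.hs_smul_spec ℤ t g c t'
            rw [if_neg] at this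
            · linarith
            · rintro ⟨rfl, rfl⟩; exact hne rfl
          · have := S.hs_smul_spec ℤ t g c t'
            rw [if_neg] at this
            · linarith
            · rintro ⟨rfl, rfl⟩; exact hne Sym2.eq_swap
      have := S.hs_smul_spec ℤ t g g t
      rw [hc _ _ hr] at this
      simp at this
    rintro x y ⟨g, t, ⟨rfl, rfl⟩ | ⟨rfl, rfl⟩⟩
    · exact main g t
    · rw [Sym2.eq_swap]; exact main g t

end StarSplit

namespace SimpleGraph

variable {V : Type*} (T : SimpleGraph V)

open Classical in
/-- The first vertex after `y` on the geodesic from `y` to `z` in a tree. -/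
noncomputable def nxt (y z : V) : V :=
  if h : ∃ w, T.Adj y w ∧ T.dist w z + 1 = T.dist y z then h.choose else y

variable {T}

lemma nxt_self (y : V) : T.nxt y y = y := by
  rw [nxt, dif_neg]
  rintro ⟨w, -, h⟩
  simp at h

namespace IsTree

lemma exists_closer (hT : T.IsTree) {y z : V} (h : y ≠ z) :
    ∃ w, T.Adj y w ∧ T.dist w z + 1 = T.dist y z := by
  obtain ⟨p, hp⟩ := hT.connected.exists_walk_length_eq_dist y z
  cases p with
  | nil => exact absurd rfl h
  | @cons _ w _ hadj q =>
    refine ⟨w, hadj, ?_⟩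
    have h1 : T.dist w z ≤ q.length := SimpleGraph.dist_le q
    simp only [Walk.length_cons] at hp
    have h2 := hT.dist_eq_dist_add_one_of_adj z hadj
    rw [dist_comm (u := z), dist_comm (u := z)] at h2
    omega

lemma closer_unique (hT : T.IsTree) {y z w w' : V} (hw : T.Adj y w)
    (hd : T.dist w z + 1 = T.dist y z)
    (hw' : T.Adj y w') (hd' : T.dist w' z + 1 = T.dist y z) : w = w' := by
  obtain ⟨q, hq⟩ := hT.connected.exists_walk_length_eq_dist w z
  obtain ⟨q', hq'⟩ := hT.connected.exists_walk_length_eq_dist w' z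
  have h1 : (Walk.cons hw q).IsPath := Walk.isPath_of_length_eq_dist _ (by simp [hq, hd])
  have h2 : (Walk.cons hw' q').IsPath := Walk.isPath_of_length_eq_dist _ (by simp [hq', hd'])
  have := (hT.existsUnique_path y z).unique h1 h2
  have := congrArg Walk.snd this
  simpa using this

lemma nxt_spec (hT : T.IsTree) {y z : V} (h : y ≠ z) :
    T.Adj y (T.nxt y z) ∧ T.dist (T.nxt y z) z + 1 = T.dist y z := by
  have := hT.exists_closer h
  rw [nxt, dif_pos this]
  exact this.choose_spec

lemma adj_nxt (hT : T.IsTree) {y z : V} (h : y ≠ z) : T.Adj y (T.nxt y z) := (hT.nxt_spec h).1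

lemma dist_nxt (hT : T.IsTree) {y z : V} (h : y ≠ z) :
    T.dist (T.nxt y z) z + 1 = T.dist y z := (hT.nxt_spec h).2

lemma nxt_eq (hT : T.IsTree) {y z w : V} (hw : T.Adj y w) (hd : T.dist w z < T.dist y z) :
    T.nxt y z = w := by
  have h : y ≠ z := by rintro rfl; simp at hd
  have h2 := hT.dist_eq_dist_add_one_of_adj z hw
  rw [dist_comm (u := z), dist_comm (u := z)] at h2
  exact hT.closer_unique (hT.adj_nxt h) (hT.dist_nxt h) hw (by omega)

lemma nxt_of_adj (hT : T.IsTree) {y z : V} (h : T.Adj y z) : T.nxt y z = z :=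
  hT.nxt_eq h (by simpa using hT.connected.pos_dist_of_ne h.ne)

lemma dist_of_adj_ne_nxt (hT : T.IsTree) {y z w : V} (hw : T.Adj y w) (h : T.nxt y z ≠ w) :
    T.dist w z = T.dist y z + 1 := by
  have h2 := hT.dist_eq_dist_add_one_of_adj z hw
  rw [dist_comm (u := z), dist_comm (u := z)] at h2
  rcases h2 with h2 | h2
  · exact absurd (hT.nxt_eq hw (by omega)) h
  · exact h2

lemma nxt_congr_of_adj (hT : T.IsTree) {m x x' : V} (h : T.Adj x x') (hx : m ≠ x) (hx' : m ≠ x') :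
    T.nxt m x = T.nxt m x' := by
  have main : ∀ {a b : V}, T.Adj a b → m ≠ a → m ≠ b → T.dist m b < T.dist m a →
      T.nxt m a = T.nxt m b := by
    intro a b hab ha hb hd
    refine hT.nxt_eq (hT.adj_nxt hb) ?_
    have h1 := hT.dist_nxt hb
    have h2 := hT.dist_eq_dist_add_one_of_adj (T.nxt m b) hab
    omega
  rcases hT.dist_eq_dist_add_one_of_adj m h with h2 | h2
  · exact main h hx hx' (by omega)
  · exact (main h.symm hx' hx (by omega)).symm

lemma dist_add_of_nxt_ne (hT : T.IsTree) {y z : V} : ∀ {x : V}, x = y ∨ T.nxt y x ≠ T.nxt y z →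
    T.dist x z = T.dist x y + T.dist y z := by
  intro x
  induction hd : T.dist x y using Nat.strong_induction_on generalizing x with
  | _ d ih =>
    intro h
    rcases eq_or_ne x y with rfl | hxy
    · simp at hd; omega
    have h := h.resolve_left hxy
    have hadj := hT.adj_nxt hxy
    have hdn := hT.dist_nxt hxy
    set x' := T.nxt x y with hx'
    rcases eq_or_ne x' y with hxy' | hxy'
    · rw [hxy'] at hadj hdn
      simp only [dist_self, zero_add] at hdn
      rw [hT.nxt_of_adj hadj.symm] at h
      have := hT.dist_of_adj_ne_nxt hadj.symm h.symm
      omega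
    · have e1 := ih (T.dist x' y) (by omega) rfl
        (Or.inr (by rwa [← hT.nxt_congr_of_adj hadj hxy.symm hxy'.symm]))
      have h2 := hT.dist_eq_dist_add_one_of_adj z hadj
      rw [dist_comm (u := z), dist_comm (u := z)] at h2
      rcases h2 with h2 | h2
      · omega
      · exfalso
        have a1 : T.nxt x' z = x := hT.nxt_eq hadj.symm (by omega)
        have a2 : T.nxt x' z = T.nxt x' y := by
          refine hT.nxt_eq (hT.adj_nxt hxy') ?_
          have := hT.connected.dist_triangle (u := T.nxt x' y) (v := y) (w := z)
          have := hT.dist_nxt hxy'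
          omega
        have := hT.dist_nxt hxy'
        rw [← a2, a1] at this
        omega

lemma nxt_eq_of_nxt_ne (hT : T.IsTree) {x y z : V} (hxy : x ≠ y) (h : T.nxt y x ≠ T.nxt y z) :
    T.nxt x y = T.nxt x z := by
  refine (hT.nxt_eq (hT.adj_nxt hxy) ?_).symm
  have h1 := hT.dist_add_of_nxt_ne (Or.inr h)
  have h2 := hT.connected.dist_triangle (u := T.nxt x y) (v := y) (w := z)
  have h3 := hT.dist_nxt hxy
  omega

end IsTree

end SimpleGraph

/-- `m` lies between `x` and `y` with respect to a first-step function. -/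
def NxtBtw {T : Type*} (nxt : T → T → T) (x m y : T) : Prop := m = x ∨ m = y ∨ nxt m x ≠ nxt m y

lemma SimpleGraph.IsTree.exists_median {V : Type*} {T : SimpleGraph V} (hT : T.IsTree)
    (x y z : V) : ∃ m, NxtBtw T.nxt x m y ∧ NxtBtw T.nxt y m z ∧ NxtBtw T.nxt x m z := by
  induction hd : T.dist x y using Nat.strong_induction_on generalizing x with
  | _ d ih =>
    by_cases hxz : x = z
    · exact ⟨x, .inl rfl, .inr (.inl hxz), .inl rfl⟩
    by_cases hxy : x = y
    · exact ⟨x, .inl rfl, .inl hxy, .inl rfl⟩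
    by_cases hn : T.nxt x y = T.nxt x z
    · have hadj := hT.adj_nxt hxy
      have hdn := hT.dist_nxt hxy
      have hdz := hT.dist_nxt hxz
      rw [← hn] at hdz
      set x' := T.nxt x y with hx'
      obtain ⟨m, h1, h2, h3⟩ := ih _ (by omega) x' rfl
      have key : ∀ w, T.dist x' w + 1 = T.dist x w → NxtBtw T.nxt x' m w → NxtBtw T.nxt x m w := by
        intro w hw hb
        by_cases hmx : m = x
        · exact .inl hmx
        by_cases hmw : m = w
        · exact .inr (.inl hmw)
        by_cases hmx' : m = x'
        · subst hmx'
          refine .inr (.inr fun he => ?_)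
          rw [hT.nxt_of_adj hadj.symm] at he
          have := hT.dist_nxt hmw
          rw [← he] at this
          omega
        · have := (hb.resolve_left hmx').resolve_left hmw
          rw [← hT.nxt_congr_of_adj hadj hmx hmx'] at this
          exact .inr (.inr this)
      exact ⟨m, key _ hdn h1, h2, key _ hdz h3⟩
    · exact ⟨x, .inl rfl, .inr (.inr hn), .inl rfl⟩

namespace StarSplit

variable {G : Type} [Group G] {n p : ℕ} (S : StarSplit G n p)

lemma dist_smul (g : G) (x y : S.V) : S.tree.dist (g • x) (g • y) = S.tree.dist x y := by
  have main : ∀ (g : G) (x y : S.V), S.tree.dist (g • x) (g • y) ≤ S.tree.dist x y := by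
    intro g x y
    obtain ⟨w, hw⟩ := S.tree_isTree.connected.exists_walk_length_eq_dist x y
    let f : S.tree →g S.tree := ⟨fun x => g • x, fun h => S.adj_smul g h⟩
    rw [← hw, ← SimpleGraph.Walk.length_map f w]
    exact SimpleGraph.dist_le _
  refine le_antisymm (main g x y) ?_
  simpa using main g⁻¹ (g • x) (g • y)

lemma nxt_smul (g : G) (x y : S.V) : S.tree.nxt (g • x) (g • y) = g • S.tree.nxt x y := by
  rcases eq_or_ne x y with rfl | h
  · simp [SimpleGraph.nxt_self]
  · refine S.tree_isTree.nxt_eq (S.adj_smul g (S.tree_isTree.adj_nxt h)) ?_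
    rw [S.dist_smul, S.dist_smul]
    have := S.tree_isTree.dist_nxt h
    omega

lemma eq_one_of_smul_base {g h : G} (hg : g • S.base h = S.base h) : g = 1 := by
  have := Sum.inl_injective hg
  simpa using this

lemma eq_one_of_adj {g : G} {x y : S.V} (hxy : S.tree.Adj x y) (hx : g • x = x)
    (hy : g • y = y) : g = 1 := by
  obtain ⟨c, t, ⟨rfl, rfl⟩ | ⟨rfl, rfl⟩⟩ := hxy
  · exact S.eq_one_of_smul_base hx
  · exact S.eq_one_of_smul_base hy

lemma eq_one_of_nxt {g : G} {x y : S.V} (hxy : x ≠ y) (hx : g • x = x)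
    (hy : g • S.tree.nxt x y = S.tree.nxt x y) : g = 1 :=
  S.eq_one_of_adj (S.tree_isTree.adj_nxt hxy) hx hy

lemma eq_one_of_fix {g : G} {x y : S.V} (hxy : x ≠ y) (hx : g • x = x) (hy : g • y = y) :
    g = 1 := by
  refine S.eq_one_of_nxt hxy hx ?_
  rw [← S.nxt_smul, hx, hy]

end StarSplit

/-- A set with a group action and an abstract tree-like first-step function `nxt`. -/
structure NxtSpace (G T : Type*) [Group G] [MulAction G T] where
  nxt : T → T → T
  smul_nxt : ∀ (g : G) x y, nxt (g • x) (g • y) = g • nxt x y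
  turn : ∀ x y z, x ≠ y → nxt y x ≠ nxt y z → nxt x y = nxt x z
  median : ∀ x y z, ∃ m, NxtBtw nxt x m y ∧ NxtBtw nxt y m z ∧ NxtBtw nxt x m z
  free : ∀ (g : G) y z, y ≠ z → g • y = y → g • nxt y z = nxt y z → g = 1

namespace NxtSpace

variable {G T : Type*} [Group G] [MulAction G T] (N : NxtSpace G T)

/-- `y` lies strictly before `z` as seen from the root `r`. -/
def Anc (r y z : T) : Prop := y ≠ z ∧ (y = r ∨ N.nxt y z ≠ N.nxt y r)

variable {N}

lemma Anc.ne_root {r y z : T} (h : N.Anc r y z) : z ≠ r := by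
  rintro rfl
  exact h.2.elim h.1 (fun h' => h' rfl)

lemma Anc.nxt_root {r y z : T} (h : N.Anc r y z) : N.nxt z y = N.nxt z r := by
  rcases h.2 with h' | h'
  · rw [h']
  · exact N.turn z y r h.1.symm h'

lemma Anc.nxt_eq {r y x z : T} (h : N.Anc r y x) (h' : N.Anc r x z) : N.nxt y x = N.nxt y z := by
  refine N.turn y x z h.1 ?_
  rw [h.nxt_root]
  exact (h'.2.resolve_left h.ne_root).symm

lemma Anc.trans {r y x z : T} (h : N.Anc r y x) (h' : N.Anc r x z) : N.Anc r y z := by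
  refine ⟨?_, ?_⟩
  · rintro rfl
    exact (h.2.resolve_left h'.ne_root) h'.nxt_root
  · rw [← h.nxt_eq h']
    exact h.2

lemma Anc.chain {r x y z : T} (h : N.Anc r x z) (h' : N.Anc r y z) (hxy : x ≠ y) :
    N.Anc r x y ∨ N.Anc r y x := by
  by_contra! hc
  unfold Anc at hc
  obtain ⟨h1, h2⟩ := hc
  push Not at h1 h2
  obtain ⟨a1, a2⟩ := h1 hxy
  obtain ⟨b1, b2⟩ := h2 hxy.symm
  have := N.turn y x z hxy.symm (by rw [a2]; exact (h.2.resolve_left a1).symm)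
  rw [b2] at this
  exact (h'.2.resolve_left b1) this.symm

lemma Anc.root {r z : T} (h : z ≠ r) : N.Anc r r z := ⟨h.symm, Or.inl rfl⟩

lemma Anc.nxt_of_root {r y z : T} (h : N.Anc r y z) (hy : y ≠ r) : N.nxt r y = N.nxt r z :=
  N.turn r y z hy.symm (h.2.resolve_left hy).symm

lemma Anc.smul {r y z : T} (h : N.Anc r y z) {g : G} (hg : g • r = r) :
    N.Anc r (g • y) (g • z) := by
  refine ⟨fun h' => h.1 (smul_left_cancel g h'), ?_⟩
  rcases h.2 with h' | h'
  · left; rw [h', hg]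
  · right
    intro he
    have e := N.smul_nxt g y r
    rw [hg] at e
    rw [N.smul_nxt, e] at he
    exact h' (smul_left_cancel g he)

lemma eq_one_of_fix (N : NxtSpace G T) {g : G} {x y : T} (hxy : x ≠ y) (hx : g • x = x)
    (hy : g • y = y) :
    g = 1 := by
  refine N.free g x y hxy hx ?_
  rw [← N.smul_nxt, hx, hy]

lemma Anc.orbit_inj {r y z : T} {g : G} (hg : g • r = r) (hy : y ≠ r) (h : N.Anc r y z)
    (h' : N.Anc r (g • y) z) : g = 1 := by
  refine N.free g r y hy.symm hg ?_
  have hgy : g • y ≠ r := by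
    intro he
    rw [← hg] at he
    exact hy (smul_left_cancel g he)
  have := h'.nxt_of_root hgy
  rw [← h.nxt_of_root hy] at this
  nth_rw 1 [← hg] at this
  rwa [N.smul_nxt] at this

variable (N)

lemma anc_isStrictOrder (r : T) : IsStrictOrder T (N.Anc r) where
  irrefl _ h := h.1 rfl
  trans _ _ _ h h' := h.trans h'

/-- The finite set of `A`-orbits meeting a finite set. -/
noncomputable def _root_.orbitFinset {X : Type*} [MulAction G X] (A : Subgroup G) (Y : Finset X) :
    Finset (MulAction.orbitRel.Quotient A X) := by
  classical exact Y.image (Quotient.mk _)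

lemma _root_.orbit_eq_iff {X : Type*} [MulAction G X] {A : Subgroup G} {x y : X} :
    (Quotient.mk (MulAction.orbitRel A X) x) = Quotient.mk _ y ↔ ∃ b ∈ A, b • y = x := by
  rw [Quotient.eq, MulAction.orbitRel_apply, MulAction.mem_orbit_iff]
  simp [Subgroup.smul_def]

lemma _root_.mem_orbitFinset {X : Type*} [MulAction G X] {A : Subgroup G} {Y : Finset X}
    {c : MulAction.orbitRel.Quotient A X} :
    c ∈ orbitFinset A Y ↔ ∃ y ∈ Y, Quotient.mk _ y = c := by
  simp [orbitFinset]

lemma _root_.card_orbitFinset_bot {X : Type*} [MulAction G X] (Y : Finset X) :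
    (orbitFinset (⊥ : Subgroup G) Y).card = Y.card := by
  classical
  unfold orbitFinset
  refine Finset.card_image_of_injective _ ?_
  intro x y h
  rw [orbit_eq_iff] at h
  obtain ⟨b, hb, h⟩ := h
  rw [Subgroup.mem_bot.1 hb] at h
  simpa using h.symm

lemma exists_min_desc {A : Subgroup G} {r : T} (hr : ∀ b ∈ A, b • r = r) {Y : Finset T}
    {y z : T} (hz : z ∈ Y) (h : N.Anc r y z) :
    ∃ x, (∃ b ∈ A, ∃ w ∈ Y, x = b • w) ∧ N.Anc r y x ∧ N.nxt y x = N.nxt y z ∧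
      ∀ x', (∃ b ∈ A, ∃ w ∈ Y, x' = b • w) → N.Anc r y x' → ¬ N.Anc r x' x := by
  set D : Set T := {x | (∃ b ∈ A, ∃ w ∈ Y, x = b • w) ∧ N.Anc r y x ∧ N.Anc r x z} with hD
  have hfin : D.Finite := by
    refine Set.Finite.of_finite_image (f := fun x => (Quotient.mk (MulAction.orbitRel A T) x))
      ((orbitFinset A Y).finite_toSet.subset ?_) ?_
    · rintro _ ⟨x, ⟨⟨b, hb, w, hw, rfl⟩, -⟩, rfl⟩
      exact mem_orbitFinset.2 ⟨w, hw, orbit_eq_iff.2 ⟨b⁻¹, A.inv_mem hb, by simp⟩⟩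
    · intro x hx x' hx' he
      obtain ⟨b, hb, rfl⟩ := orbit_eq_iff.1 he
      have := Anc.orbit_inj (hr b hb) hx'.2.1.ne_root hx'.2.2 hx.2.2
      simp [this]
  rcases D.eq_empty_or_nonempty with h0 | hne
  · refine ⟨z, ⟨1, A.one_mem, z, hz, by simp⟩, h, rfl, fun x' hx' h1 h2 => ?_⟩
    have : x' ∈ D := ⟨hx', h1, h2⟩
    simp [h0] at this
  · have := N.anc_isStrictOrder r
    have hwf : D.WellFoundedOn (N.Anc r) := hfin.wellFoundedOn
    obtain ⟨⟨x, hx⟩, -, hmin⟩ := WellFounded.has_min hwf (Set.univ) ⟨⟨_, hne.some_mem⟩, trivial⟩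
    refine ⟨x, hx.1, hx.2.1, hx.2.1.nxt_eq hx.2.2, fun x' hx' h1 h2 => ?_⟩
    exact hmin ⟨x', hx', h1, h2.trans hx.2.2⟩ trivial h2

variable [DecidableEq T]

/-- Directions at points of `A` towards other points of `Y`. -/
def germs (A Y : Finset T) : Finset (T × T) :=
  ((A ×ˢ Y).filter fun q => q.1 ≠ q.2).image fun q => (q.1, N.nxt q.1 q.2)

lemma mem_germs {A Y : Finset T} {θ : T × T} :
    θ ∈ N.germs A Y ↔ ∃ y ∈ A, ∃ z ∈ Y, y ≠ z ∧ θ = (y, N.nxt y z) := by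
  simp only [germs, Finset.mem_image, Finset.mem_filter, Finset.mem_product, Prod.exists]
  constructor
  · rintro ⟨y, z, ⟨⟨hy, hz⟩, h⟩, rfl⟩; exact ⟨y, hy, z, hz, h, rfl⟩
  · rintro ⟨y, hy, z, hz, h, rfl⟩; exact ⟨y, z, ⟨⟨hy, hz⟩, h⟩, rfl⟩

lemma card_orbit_germs_le (A : Subgroup G) {r : T} (hr : ∀ b ∈ A, b • r = r) {Y : Finset T}
    (hrY : r ∈ Y) :
    (orbitFinset A (N.germs Y Y)).card + 2 ≤ 2 * (orbitFinset A Y).card := by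
  classical
  set O := (orbitFinset A Y).erase (Quotient.mk _ r) with hO
  have hOc : O.card + 1 = (orbitFinset A Y).card :=
    Finset.card_erase_add_one (mem_orbitFinset.2 ⟨r, hrY, rfl⟩)
  have hor : ∀ x : T, x ≠ r →
      (Quotient.mk (MulAction.orbitRel A T) x) ≠ Quotient.mk _ r := by
    intro x hx he
    obtain ⟨b, hb, rfl⟩ := orbit_eq_iff.1 he
    exact hx (hr b hb)
  set up := O.image (fun c => (Quotient.mk (MulAction.orbitRel A (T × T))
    (c.out, N.nxt c.out r))) with hup
  set down := ((N.germs Y Y).filter fun θ => θ.1 = r ∨ θ.2 ≠ N.nxt θ.1 r) with hdown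
  have hsub : orbitFinset A (N.germs Y Y) ⊆ up ∪ orbitFinset A down := by
    intro c hc
    obtain ⟨θ, hθ, rfl⟩ := mem_orbitFinset.1 hc
    by_cases hd : θ.1 = r ∨ θ.2 ≠ N.nxt θ.1 r
    · exact Finset.mem_union_right _ (mem_orbitFinset.2 ⟨θ, Finset.mem_filter.2 ⟨hθ, hd⟩, rfl⟩)
    · push Not at hd
      refine Finset.mem_union_left _ (Finset.mem_image.2 ⟨Quotient.mk _ θ.1, ?_, ?_⟩)
      · refine Finset.mem_erase.2 ⟨hor _ hd.1, mem_orbitFinset.2 ⟨θ.1, ?_, rfl⟩⟩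
        obtain ⟨y, hy, z, hz, -, rfl⟩ := (N.mem_germs).1 hθ
        exact hy
      · obtain ⟨b, hb, h⟩ := orbit_eq_iff.1
          (Quotient.out_eq (Quotient.mk (MulAction.orbitRel A T) θ.1))
        refine orbit_eq_iff.2 ⟨b, hb, ?_⟩
        rw [← h, Prod.ext_iff]
        refine ⟨rfl, ?_⟩
        nth_rw 1 [← hr b hb]
        rw [N.smul_nxt, ← hd.2]
        rfl
  have hupc : up.card ≤ O.card := Finset.card_image_le
  have hdc : (orbitFinset A down).card ≤ O.card := by
    have hex : ∀ c ∈ orbitFinset A down, ∃ y x : T, c = Quotient.mk _ (y, N.nxt y x) ∧ y ∈ Y ∧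
        (∃ b ∈ A, ∃ w ∈ Y, x = b • w) ∧ N.Anc r y x ∧
        ∀ x', (∃ b ∈ A, ∃ w ∈ Y, x' = b • w) → N.Anc r y x' → ¬ N.Anc r x' x := by
      intro c hc
      obtain ⟨θ, hθ, rfl⟩ := mem_orbitFinset.1 hc
      obtain ⟨hθ, hd⟩ := Finset.mem_filter.1 hθ
      obtain ⟨y, hy, z, hz, hyz, rfl⟩ := (N.mem_germs).1 hθ
      obtain ⟨x, h1, h2, h3, h4⟩ := N.exists_min_desc (A := A) hr hz (⟨hyz, hd⟩ : N.Anc r y z)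
      exact ⟨y, x, by rw [h3], hy, h1, h2, h4⟩
    have : Nonempty T := ⟨r⟩
    choose! yy xx h1 h2 h3 h4 h5 using hex
    refine Finset.card_le_card_of_injOn (fun c => Quotient.mk _ (xx c)) ?_ ?_
    · intro c hc
      refine Finset.mem_coe.2 (Finset.mem_erase.2 ⟨hor _ (h4 c hc).ne_root, ?_⟩)
      obtain ⟨b, hb, w, hw, he⟩ := h3 c hc
      exact mem_orbitFinset.2 ⟨w, hw, orbit_eq_iff.2 ⟨b⁻¹, A.inv_mem hb, by simp [he]⟩⟩
    · intro c hc c' hc' he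
      obtain ⟨b, hb, hbx⟩ := orbit_eq_iff.1 he
      have k1 := (h4 c' hc').smul (hr b hb)
      rw [hbx] at k1
      have key : b • yy c' = yy c := by
        by_contra hne
        rcases k1.chain (h4 c hc) hne with h | h
        · have h' := h.smul (hr _ (A.inv_mem hb))
          rw [inv_smul_smul] at h'
          refine h5 c' hc' (b⁻¹ • yy c) ⟨b⁻¹, A.inv_mem hb, _, h2 c hc, rfl⟩ h' ?_
          have := (h4 c hc).smul (hr _ (A.inv_mem hb))
          rwa [← hbx, inv_smul_smul] at this
        · exact h5 c hc _ ⟨b, hb, _, h2 c' hc', rfl⟩ h k1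
      rw [h1 c hc, h1 c' hc']
      refine orbit_eq_iff.2 ⟨b, hb, ?_⟩
      rw [← hbx, ← key, N.smul_nxt]
      rfl
  have := (Finset.card_le_card hsub).trans (Finset.card_union_le _ _)
  omega

lemma card_germs_le {r : T} {Y : Finset T} (hrY : r ∈ Y) :
    (N.germs Y Y).card + 2 ≤ 2 * Y.card := by
  have := N.card_orbit_germs_le (⊥ : Subgroup G) (r := r) (by simp) hrY
  rwa [card_orbitFinset_bot, card_orbitFinset_bot] at this

/-- `m` is a median of the three points. -/
def IsMed (m x y z : T) : Prop :=
  NxtBtw N.nxt x m y ∧ NxtBtw N.nxt y m z ∧ NxtBtw N.nxt x m z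

lemma le_card_germs {Y : Finset T}
    (hY : ∀ x ∈ Y, ∀ y ∈ Y, ∀ z ∈ Y, ∀ m, N.IsMed m x y z → m ∈ Y) :
    2 * Y.card ≤ (N.germs Y Y).card + 2 := by
  rcases Y.eq_empty_or_nonempty with rfl | ⟨r, hr⟩
  · simp
  have hpar : ∀ z ∈ Y.erase r, ∃ y ∈ Y, N.Anc r y z ∧ ∀ x ∈ Y, N.Anc r x z → ¬ N.Anc r y x := by
    intro z hz
    have := N.anc_isStrictOrder r
    have : IsStrictOrder T (Function.swap (N.Anc r)) :=
      { irrefl := fun _ h => h.1 rfl, trans := fun _ _ _ h h' => h'.trans h }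
    have hwf : {y : T | y ∈ Y ∧ N.Anc r y z}.WellFoundedOn (Function.swap (N.Anc r)) :=
      (Y.finite_toSet.subset fun x hx => hx.1).wellFoundedOn
    obtain ⟨⟨y, hy⟩, -, hmin⟩ := WellFounded.has_min hwf (Set.univ)
      ⟨⟨r, hr, Anc.root (Finset.ne_of_mem_erase hz)⟩, trivial⟩
    exact ⟨y, hy.1, hy.2, fun x hx hxz hyx => hmin ⟨x, hx, hxz⟩ trivial hyx⟩
  choose! par h1 h2 h3 using hpar
  set up := (Y.erase r).image (fun y => (y, N.nxt y r))
  set down := (Y.erase r).image (fun z => (par z, N.nxt (par z) z))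
  have hupc : up.card = (Y.erase r).card :=
    Finset.card_image_of_injective _ fun a b h => (Prod.ext_iff.1 h).1
  have hdc : down.card = (Y.erase r).card := by
    refine Finset.card_image_of_injOn fun z hz z' hz' he => ?_
    obtain ⟨e1, e2⟩ := Prod.ext_iff.1 he
    simp only at e1 e2
    by_contra hne
    obtain ⟨m, k1, k2, k3⟩ := N.median (par z) z z'
    have hm := hY _ (h1 z hz) _ (Finset.mem_of_mem_erase hz) _ (Finset.mem_of_mem_erase hz') m
      ⟨k1, k2, k3⟩
    have hmy : m ≠ par z := by
      rintro rfl
      rcases k2 with h | h | h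
      · exact (h2 z hz).1 h
      · rw [e1] at h; exact (h2 z' hz').1 h
      · rw [← e1] at e2; exact h e2
    have key : ∀ w ∈ Y.erase r, par w = par z → m ≠ w → NxtBtw N.nxt (par z) m w → False := by
      intro w hw hpw hmw hb
      have hb := (hb.resolve_left hmy).resolve_left hmw
      have hanc := h2 w hw
      rw [hpw] at hanc
      have t := N.turn _ _ _ hmy.symm hb
      have a1 : N.Anc r (par z) m := ⟨hmy.symm, by rw [t]; exact hanc.2⟩
      have a2 : N.Anc r m w := ⟨hmw, Or.inr (by rw [← a1.nxt_root]; exact hb.symm)⟩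
      exact h3 w hw m hm a2 (by rw [hpw]; exact a1)
    by_cases hmz : m = z
    · exact key z' hz' e1.symm (fun h => hne (hmz.symm.trans h)) k3
    · exact key z hz rfl hmz k1
  have hdisj : Disjoint up down := by
    rw [Finset.disjoint_left]
    intro θ hθ hθ'
    obtain ⟨y, hy, rfl⟩ := Finset.mem_image.1 hθ
    obtain ⟨z, hz, he⟩ := Finset.mem_image.1 hθ'
    obtain ⟨e1, e2⟩ := Prod.ext_iff.1 he
    simp only at e1 e2
    have := (h2 z hz).2
    rw [e1] at this e2
    exact (this.resolve_left (Finset.ne_of_mem_erase hy)) e2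
  have hsub : up ∪ down ⊆ N.germs Y Y := by
    refine Finset.union_subset ?_ ?_ <;> intro θ hθ <;> obtain ⟨y, hy, rfl⟩ := Finset.mem_image.1 hθ
    · exact (N.mem_germs).2 ⟨y, Finset.mem_of_mem_erase hy, r, hr, Finset.ne_of_mem_erase hy, rfl⟩
    · exact (N.mem_germs).2 ⟨_, h1 y hy, y, Finset.mem_of_mem_erase hy, (h2 y hy).1, rfl⟩
  have := Finset.card_le_card hsub
  rw [Finset.card_union_of_disjoint hdisj, hupc, hdc] at this
  have := Finset.card_erase_add_one hr
  omega

lemma isMed_unique {m m' x y z : T} (h : N.IsMed m x y z) (h' : N.IsMed m' x y z) : m = m' := by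
  by_contra hne
  have hgood : ∀ w, (w = m' ∨ N.nxt m' w ≠ N.nxt m' m) → w ≠ m ∧ N.nxt m w = N.nxt m m' := by
    rintro w (rfl | hw)
    · exact ⟨fun h => hne h.symm, rfl⟩
    · exact ⟨fun h => hw (by rw [h]), (N.turn m m' w hne hw.symm).symm⟩
  have hpair : ∀ v w, NxtBtw N.nxt v m' w →
      (v ≠ m ∧ N.nxt m v = N.nxt m m') ∨ (w ≠ m ∧ N.nxt m w = N.nxt m m') := by
    rintro v w (h | h | h)
    · exact Or.inl (hgood v (Or.inl h.symm))
    · exact Or.inr (hgood w (Or.inl h.symm))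
    · by_cases hv : N.nxt m' v = N.nxt m' m
      · exact Or.inr (hgood w (Or.inr (by rw [← hv]; exact h.symm)))
      · exact Or.inl (hgood v (Or.inr hv))
  have hno : ∀ v w, NxtBtw N.nxt v m w → (v ≠ m ∧ N.nxt m v = N.nxt m m') →
      (w ≠ m ∧ N.nxt m w = N.nxt m m') → False := by
    rintro v w (h | h | h) hv hw
    · exact hv.1 h.symm
    · exact hw.1 h.symm
    · exact h (hv.2.trans hw.2.symm)
  have a1 := hpair _ _ h'.1
  have a2 := hpair _ _ h'.2.1
  have a3 := hpair _ _ h'.2.2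
  have b1 := hno _ _ h.1
  have b2 := hno _ _ h.2.1
  have b3 := hno _ _ h.2.2
  tauto

lemma exists_median_closure (Y₀ : Finset T) : ∃ Y : Finset T, Y₀ ⊆ Y ∧
    (∀ x ∈ Y, ∀ y ∈ Y, ∀ z ∈ Y, ∀ m, N.IsMed m x y z → m ∈ Y) ∧
    ∀ y ∈ Y, y ∉ Y₀ → ∃ u ∈ Y₀, ∃ v ∈ Y₀, u ≠ y ∧ v ≠ y ∧ N.nxt y u ≠ N.nxt y v := by
  choose med hmed using N.median
  set Y := (Y₀ ×ˢ Y₀ ×ˢ Y₀).image (fun q => med q.1 q.2.1 q.2.2) with hYd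
  have hmem : ∀ m, m ∈ Y ↔ ∃ x ∈ Y₀, ∃ y ∈ Y₀, ∃ z ∈ Y₀, N.IsMed m x y z := by
    intro m
    simp only [hYd, Finset.mem_image, Finset.mem_product, Prod.exists]
    constructor
    · rintro ⟨x, y, z, ⟨hx, hy, hz⟩, rfl⟩; exact ⟨x, hx, y, hy, z, hz, hmed x y z⟩
    · rintro ⟨x, hx, y, hy, z, hz, h⟩
      exact ⟨x, y, z, ⟨hx, hy, hz⟩, N.isMed_unique (hmed x y z) h⟩
  have hsub : Y₀ ⊆ Y := fun x hx => (hmem x).2 ⟨x, hx, x, hx, x, hx, .inl rfl, .inl rfl, .inl rfl⟩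
  have hdir : ∀ y ∈ Y, ∀ m, m ≠ y → ∃ u ∈ Y₀, N.nxt m u = N.nxt m y := by
    intro y hy m hm
    obtain ⟨a, ha, b, hb, c, -, h, -⟩ := (hmem y).1 hy
    rcases h with rfl | rfl | h
    · exact ⟨_, ha, rfl⟩
    · exact ⟨_, hb, rfl⟩
    · by_cases h' : N.nxt y m = N.nxt y a
      · exact ⟨b, hb, (N.turn m y b hm (by rwa [h'])).symm⟩
      · exact ⟨a, ha, (N.turn m y a hm h').symm⟩
  refine ⟨Y, hsub, ?_, ?_⟩
  · intro x hx y hy z hz m hm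
    by_cases h1 : m = x
    · rwa [h1]
    by_cases h2 : m = y
    · rwa [h2]
    by_cases h3 : m = z
    · rwa [h3]
    obtain ⟨u, hu, eu⟩ := hdir x hx m h1
    obtain ⟨v, hv, ev⟩ := hdir y hy m h2
    obtain ⟨w, hw, ew⟩ := hdir z hz m h3
    refine (hmem m).2 ⟨u, hu, v, hv, w, hw, .inr (.inr ?_), .inr (.inr ?_), .inr (.inr ?_)⟩
    · rw [eu, ev]; exact (hm.1.resolve_left h1).resolve_left h2
    · rw [ev, ew]; exact (hm.2.1.resolve_left h2).resolve_left h3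
    · rw [eu, ew]; exact (hm.2.2.resolve_left h1).resolve_left h3
  · intro y hy hy0
    obtain ⟨a, ha, b, hb, c, -, h, -⟩ := (hmem y).1 hy
    have h1 : a ≠ y := fun h => hy0 (h ▸ ha)
    have h2 : b ≠ y := fun h => hy0 (h ▸ hb)
    exact ⟨a, ha, b, hb, h1, h2, (h.resolve_left h1.symm).resolve_left h2.symm⟩

end NxtSpace

section FiniteGraph

variable {V E : Type*} [Fintype V] [Fintype E]

lemma card_add_card_le_of_cob_surjective {Q : Type*} [Fintype Q] (s t : E → V) (q : Q → V)
    (h : ∀ (w : E → ℚ) (c : Q → ℚ), ∃ f : V → ℚ, (∀ e, f (t e) - f (s e) = w e) ∧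
      ∀ x, f (q x) = c x) : Fintype.card E + Fintype.card Q ≤ Fintype.card V := by
  let L : (V → ℚ) →ₗ[ℚ] (E → ℚ) × (Q → ℚ) :=
    { toFun := fun f => (fun e => f (t e) - f (s e), fun x => f (q x))
      map_add' := fun f g => by ext <;> simp; ring
      map_smul' := fun c f => by ext <;> simp; ring }
  have hL : Function.Surjective L := by
    rintro ⟨w, c⟩
    obtain ⟨f, h1, h2⟩ := h w c
    exact ⟨f, Prod.ext (funext h1) (funext h2)⟩
  have := LinearMap.finrank_le_finrank_of_surjective hL
  simpa using this

lemma card_le_of_cob_injective {Q : Type*} [Fintype Q] (s t : E → V) (q : Q → V)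
    (h : ∀ f : V → ℚ, (∀ e, f (t e) = f (s e)) → (∀ x, f (q x) = 0) → f = 0) :
    Fintype.card V ≤ Fintype.card E + Fintype.card Q := by
  let L : (V → ℚ) →ₗ[ℚ] (E → ℚ) × (Q → ℚ) :=
    { toFun := fun f => (fun e => f (t e) - f (s e), fun x => f (q x))
      map_add' := fun f g => by ext <;> simp; ring
      map_smul' := fun c f => by ext <;> simp; ring }
  have hL : Function.Injective L := by
    rw [injective_iff_map_eq_zero]
    intro f hf
    obtain ⟨h1, h2⟩ := Prod.ext_iff.1 hf
    exact h f (fun e => sub_eq_zero.1 (congrFun h1 e)) (fun x => congrFun h2 x)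
  have := LinearMap.finrank_le_finrank_of_injective hL
  simpa using this

lemma sum_weights_connected (s t : E → V) (vD : V → ℕ) (eD : E → ℕ) (h2 : ∀ v, 2 ≤ vD v)
    (hs : ∀ e, eD e ≤ vD (s e)) (ht : ∀ e, eD e ≤ vD (t e))
    (hconn : ∀ f : V → ℚ, (∀ e, f (t e) = f (s e)) → ∀ v w, f v = f w)
    (htot : ∑ e, eD e ≤ ∑ v, vD v) :
    ∑ e, eD e + 2 * Fintype.card V ≤ ∑ v, vD v + 2 * Fintype.card E := by
  classical
  rcases le_or_gt (Fintype.card V) (Fintype.card E) with hle | hlt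
  · omega
  have hne : Nonempty V := Fintype.card_pos_iff.1 (by omega)
  obtain ⟨v₀⟩ := hne
  let L : (V → ℚ) →ₗ[ℚ] (E → ℚ) :=
    { toFun := fun f => fun e => f (t e) - f (s e)
      map_add' := fun f g => by ext; simp; ring
      map_smul' := fun c f => by ext; simp; ring }
  have hker : Module.finrank ℚ (LinearMap.ker L) ≤ 1 := by
    have : LinearMap.ker L ≤ Submodule.span ℚ {fun _ => (1 : ℚ)} := by
      intro f hf
      rw [LinearMap.mem_ker] at hf
      rw [Submodule.mem_span_singleton]
      refine ⟨f v₀, funext fun v => ?_⟩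
      have := hconn f (fun e => sub_eq_zero.1 (congrFun hf e)) v₀ v
      simpa using this
    exact (Submodule.finrank_mono this).trans
      (by simpa using finrank_span_le_card (R := ℚ) {fun _ : V => (1 : ℚ)})
  have hrn := L.finrank_range_add_finrank_ker
  have hsurj : Function.Surjective L := by
    rw [← LinearMap.range_eq_top]
    refine Submodule.eq_top_of_finrank_eq (le_antisymm (Submodule.finrank_le _) ?_)
    simp only [Module.finrank_fintype_fun_eq_card] at hrn ⊢
    omega
  have hlev : ∀ l, (Finset.univ.filter fun e => l ≤ eD e).card ≤
      (Finset.univ.filter fun v => l ≤ vD v).card := by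
    intro l
    have := card_add_card_le_of_cob_surjective (V := {v // l ≤ vD v}) (E := {e // l ≤ eD e})
      (Q := Empty) (fun e => ⟨s e, e.2.trans (hs e)⟩) (fun e => ⟨t e, e.2.trans (ht e)⟩)
      (fun x => x.elim) (fun w c => by
        obtain ⟨f, hf⟩ := hsurj (fun e => if h : l ≤ eD e then w ⟨e, h⟩ else 0)
        refine ⟨fun v => f v, fun e => ?_, fun x => x.elim⟩
        have := congrFun hf e
        simpa [L, e.2] using this)
    simpa [Fintype.card_subtype] using this
  set B := ∑ e, eD e + ∑ v, vD v with hB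
  have hcount : ∀ x ≤ B, x - 2 = ∑ l ∈ Finset.range B, if l + 3 ≤ x then 1 else 0 := by
    intro x hx
    rw [Finset.sum_boole]
    have : (Finset.range B).filter (fun l => l + 3 ≤ x) = Finset.range (x - 2) := by
      ext l; simp only [Finset.mem_filter, Finset.mem_range]; omega
    simp [this]
  have hE : ∀ e, eD e ≤ B := fun e =>
    (Finset.single_le_sum (f := eD) (fun _ _ => Nat.zero_le _) (Finset.mem_univ e)).trans
      (Nat.le_add_right _ _)
  have hV : ∀ v, vD v ≤ B := fun v =>
    (Finset.single_le_sum (f := vD) (fun _ _ => Nat.zero_le _) (Finset.mem_univ v)).trans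
      (Nat.le_add_left _ _)
  have key : ∑ e, (eD e - 2) ≤ ∑ v, (vD v - 2) := by
    rw [Finset.sum_congr rfl fun e _ => hcount _ (hE e),
      Finset.sum_congr rfl fun v _ => hcount _ (hV v), Finset.sum_comm,
      Finset.sum_comm (s := Finset.univ) (t := Finset.range B)]
    refine Finset.sum_le_sum fun l _ => ?_
    rw [Finset.sum_boole, Finset.sum_boole]
    exact_mod_cast hlev (l + 3)
  have k1 : ∑ e, eD e ≤ ∑ e, (eD e - 2) + 2 * Fintype.card E := by
    calc ∑ e, eD e ≤ ∑ e, (eD e - 2 + 2) := Finset.sum_le_sum fun e _ => by omega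
      _ = _ := by rw [Finset.sum_add_distrib]; simp [mul_comm]
  have k2 : ∑ v, vD v = ∑ v, (vD v - 2) + 2 * Fintype.card V := by
    calc ∑ v, vD v = ∑ v, (vD v - 2 + 2) :=
          Finset.sum_congr rfl fun v _ => by have := h2 v; omega
      _ = _ := by rw [Finset.sum_add_distrib]; simp [mul_comm]
  omega

end FiniteGraph

namespace StarSplit

variable {G : Type} [Group G] {n p : ℕ} (S : StarSplit G n p) {X : Type*} [MulAction G X]

/-- Vertices of the finite graph spanned by `M` in a `G`-set. -/
abbrev GV (M : Finset X) := M ⊕ Σ i, orbitFinset (S.A i) M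

/-- Edges of the finite graph spanned by `M`, with chosen sets `K j` of edges of type `j`. -/
abbrev GE (_ : StarSplit G n p) {X : Type*} (M : Finset X) (K : Fin p → Finset X) :=
  (M × Fin n) ⊕ Σ j, K j

/-- Endpoints of edges exist. -/
def EdgeOK (M : Finset X) (K : Fin p → Finset X) : Prop :=
  ∀ j, ∀ x ∈ K j, x ∈ M ∧ (S.a j)⁻¹ • x ∈ M

/-- The vertex of an orbit. -/
def gOrb {M : Finset X} (i : Fin n) (m : M) : S.GV M :=
  Sum.inr ⟨i, Quotient.mk _ m.1, mem_orbitFinset.2 ⟨m.1, m.2, rfl⟩⟩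

variable {S} in
/-- The source of an edge. -/
def EdgeOK.src {M : Finset X} {K : Fin p → Finset X} (h : S.EdgeOK M K) : S.GE M K → S.GV M
  | .inl q => .inl q.1
  | .inr x => .inl ⟨x.2.1, (h _ _ x.2.2).1⟩

variable {S} in
/-- The target of an edge. -/
def EdgeOK.tgt {M : Finset X} {K : Fin p → Finset X} (h : S.EdgeOK M K) : S.GE M K → S.GV M
  | .inl q => S.gOrb q.2 q.1
  | .inr x => .inl ⟨(S.a x.1)⁻¹ • x.2.1, (h _ _ x.2.2).2⟩

/-- Number of vertices. -/
noncomputable def vcount (M : Finset X) : ℕ := M.card + ∑ i, (orbitFinset (S.A i) M).card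

lemma card_GV (M : Finset X) : Fintype.card (S.GV M) = S.vcount M := by
  simp [vcount]

lemma card_GE {X : Type*} (M : Finset X) (K : Fin p → Finset X) :
    Fintype.card (S.GE M K) = n * M.card + ∑ j, (K j).card := by
  simp [mul_comm]

open Classical in
lemma exists_orbit_potential (Θ : Finset X) (hΘ : ∀ θ ∈ Θ, ∀ θ' ∈ Θ, ∀ g : G, g • θ = θ' → θ = θ')
    (w : X → Fin n ⊕ Fin p → ℚ) (c : X → ℚ) :
    ∃ (f : X → ℚ) (F : ∀ i, MulAction.orbitRel.Quotient (S.A i) X → ℚ),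
      (∀ m, (∀ g : G, g • m = m → g = 1) → (∀ i, F i (Quotient.mk _ m) - f m = w m (.inl i)) ∧
        (∀ j, f ((S.a j)⁻¹ • m) - f m = w m (.inr j))) ∧
      ∀ θ ∈ Θ, (∀ g : G, g • θ = θ → g = 1) → f θ = c θ := by
  let ρ : MulAction.orbitRel.Quotient G X → X := fun q =>
    if h : ∃ θ ∈ Θ, Quotient.mk _ θ = q then h.choose else q.out
  have hρ : ∀ q, Quotient.mk _ (ρ q) = q := by
    intro q
    by_cases h : ∃ θ ∈ Θ, Quotient.mk (MulAction.orbitRel G X) θ = q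
    · simp only [ρ, dif_pos h]; exact h.choose_spec.2
    · simp only [ρ, dif_neg h]; exact q.out_eq
  have horb : ∀ m : X, ∃ g : G, g • m = ρ (Quotient.mk _ m) := by
    intro m
    have := hρ (Quotient.mk _ m)
    rwa [Quotient.eq, MulAction.orbitRel_apply, MulAction.mem_orbit_iff] at this
  choose γ hγ using horb
  have hρΘ : ∀ θ ∈ Θ, ρ (Quotient.mk _ θ) = θ := by
    intro θ hθ
    have h : ∃ θ' ∈ Θ, Quotient.mk (MulAction.orbitRel G X) θ' = Quotient.mk _ θ := ⟨θ, hθ, rfl⟩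
    have h1 : ρ (Quotient.mk _ θ) = h.choose := by simp only [ρ, dif_pos h]
    rw [h1]
    exact (hΘ _ hθ _ h.choose_spec.1 (γ θ) (by rw [hγ, h1])).symm
  have hsame : ∀ (g : G) (m : X), ρ (Quotient.mk _ (g • m)) = ρ (Quotient.mk _ m) := by
    intro g m
    congr 1
    rw [Quotient.eq, MulAction.orbitRel_apply]
    exact ⟨g, rfl⟩
  have hγg : ∀ (g : G) (m : X), (∀ g : G, g • m = m → g = 1) → γ (g • m) * g = γ m := by
    intro g m hm
    have h1 := hγ (g • m)
    rw [hsame, ← hγ m] at h1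
    have := hm ((γ m)⁻¹ * (γ (g • m) * g)) (by rw [mul_smul, mul_smul, h1, inv_smul_smul])
    exact (inv_mul_eq_one.1 this).symm
  choose h h0 hh using fun x : X => S.exists_vpot (fun g t => w (g⁻¹ • x) t)
  refine ⟨fun m => h (ρ (Quotient.mk _ m)) (S.base (γ m)) + c (ρ (Quotient.mk _ m)),
    fun i q => h (ρ (Quotient.mk _ q.out)) (S.star i (γ q.out)) + c (ρ (Quotient.mk _ q.out)),
    fun m hm => ⟨fun i => ?_, fun j => ?_⟩, fun θ hθ hfree => ?_⟩
  · obtain ⟨b, hb, he⟩ := orbit_eq_iff.1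
      (Quotient.out_eq (Quotient.mk (MulAction.orbitRel (S.A i) X) m))
    have e1 : ρ (Quotient.mk _ (Quotient.mk (MulAction.orbitRel (S.A i) X) m).out) =
        ρ (Quotient.mk _ m) := by rw [← he]; exact hsame b m
    have e2 : S.star i (γ (Quotient.mk (MulAction.orbitRel (S.A i) X) m).out) = S.star i (γ m) := by
      rw [S.star_eq_iff, ← hγg b m hm, he]
      simpa using hb
    beta_reduce
    rw [e1, e2]
    have := hh (ρ (Quotient.mk _ m)) (γ m) (.inl i)
    rw [← hγ, inv_smul_smul] at this
    simp only [tgt] at this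
    rw [← this, hγ]
    ring
  · simp only [hsame]
    have e : γ ((S.a j)⁻¹ • m) = γ m * S.a j := by
      rw [← hγg (S.a j)⁻¹ m hm]; simp
    rw [e]
    have := hh (ρ (Quotient.mk _ m)) (γ m) (.inr j)
    rw [← hγ, inv_smul_smul] at this
    simp only [tgt] at this
    rw [← this, hγ]
    ring
  · have e : γ θ = 1 := hfree _ (by rw [hγ, hρΘ θ hθ])
    simp only [hρΘ θ hθ, e, h0, zero_add]

lemma card_GE_add_le {M : Finset X} {K : Fin p → Finset X} (hK : S.EdgeOK M K)
    (hfree : ∀ m ∈ M, ∀ g : G, g • m = m → g = 1) {Θ : Finset X} (hΘM : Θ ⊆ M)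
    (hΘ : ∀ θ ∈ Θ, ∀ θ' ∈ Θ, ∀ g : G, g • θ = θ' → θ = θ') :
    n * M.card + ∑ j, (K j).card + Θ.card ≤ S.vcount M := by
  classical
  have := card_add_card_le_of_cob_surjective (Q := Θ) hK.src hK.tgt
    (fun θ => Sum.inl ⟨θ.1, hΘM θ.2⟩) (fun w c => by
      let w' : X → Fin n ⊕ Fin p → ℚ := fun x t => match t with
        | .inl i => if h : x ∈ M then w (.inl (⟨x, h⟩, i)) else 0
        | .inr j => if h : x ∈ K j then w (.inr ⟨j, ⟨x, h⟩⟩) else 0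
      obtain ⟨f, F, h1, h2⟩ := S.exists_orbit_potential Θ hΘ w'
        (fun x => if h : x ∈ Θ then c ⟨x, h⟩ else 0)
      refine ⟨Sum.elim (fun m => f m) (fun x => F x.1 x.2), ?_, ?_⟩
      · rintro (⟨m, i⟩ | ⟨j, x⟩)
        · have := (h1 m (hfree m m.2)).1 i
          simpa [EdgeOK.src, EdgeOK.tgt, gOrb, w'] using this
        · have := (h1 x.1 (hfree x.1 (hK j _ x.2).1)).2 j
          simpa [EdgeOK.src, EdgeOK.tgt, gOrb, w'] using this
      · intro θ
        have := h2 θ θ.2 (hfree θ (hΘM θ.2))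
        simpa using this)
  rw [S.card_GV, S.card_GE] at this
  simpa using this

end StarSplit

namespace StarSplit

variable {G : Type} [Group G] {n p : ℕ} (S : StarSplit G n p) {T : Type*} [MulAction G T]
  [DecidableEq T]

/-- Points of `A` that `a j` carries back into `Y`. -/
def back (Y A : Finset T) (j : Fin p) : Finset T := A.filter fun y => (S.a j)⁻¹ • y ∈ Y

/-- Elementary moves inside `Y`. -/
def Step (Y : Finset T) (x y : T) : Prop :=
  x ∈ Y ∧ y ∈ Y ∧ ((∃ i, ∃ b ∈ S.A i, y = b • x) ∨ ∃ j, y = (S.a j)⁻¹ • x)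

/-- Subsets of `Y` closed under elementary moves. -/
def Sat (Y A : Finset T) : Prop := A ⊆ Y ∧ ∀ x y, S.Step Y x y → (x ∈ A ↔ y ∈ A)

variable {S}

lemma Sat.edgeOK {Y A : Finset T} (h : S.Sat Y A) : S.EdgeOK A (S.back Y A) := by
  intro j x hx
  obtain ⟨hx, hy⟩ := Finset.mem_filter.1 hx
  exact ⟨hx, (h.2 x _ ⟨h.1 hx, hy, Or.inr ⟨j, rfl⟩⟩).1 hx⟩

lemma Sat.eqvGen {Y A : Finset T} (h : S.Sat Y A) {x y : T} (hxy : Relation.EqvGen (S.Step Y) x y) :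
    x ∈ A ↔ y ∈ A := by
  induction hxy with
  | rel x y hxy => exact h.2 x y hxy
  | refl => rfl
  | symm _ _ _ ih => exact ih.symm
  | trans _ _ _ _ _ ih ih' => exact ih.trans ih'

/-- A function on the vertices of the finite graph that is constant along edges is constant on
linked points. -/
lemma Sat.const {Y A : Finset T} (h : S.Sat Y A) (f : S.GV A → ℚ)
    (hf : ∀ e, f (h.edgeOK.tgt e) = f (h.edgeOK.src e)) {x y : T}
    (hxy : Relation.EqvGen (S.Step Y) x y) (hx : x ∈ A) (hy : y ∈ A) :
    f (.inl ⟨x, hx⟩) = f (.inl ⟨y, hy⟩) := by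
  have main : ∀ x y, Relation.EqvGen (S.Step Y) x y →
      (if hx : x ∈ A then f (.inl ⟨x, hx⟩) else 0) =
        (if hy : y ∈ A then f (.inl ⟨y, hy⟩) else 0) := by
    intro x y hxy
    induction hxy with
    | rel x y hxy =>
      by_cases hx : x ∈ A
      · have hy := (h.2 x y hxy).1 hx
        rw [dif_pos hx, dif_pos hy]
        obtain ⟨-, hyY, ⟨i, b, hb, rfl⟩ | ⟨j, rfl⟩⟩ := hxy
        · have h1 := hf (.inl (⟨x, hx⟩, i))
          have h2 := hf (.inl (⟨_, hy⟩, i))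
          have e : S.gOrb i (⟨b • x, hy⟩ : A) = S.gOrb i ⟨x, hx⟩ := by
            unfold gOrb
            congr 2
            exact Subtype.ext (orbit_eq_iff.2 ⟨b, hb, rfl⟩)
          simp only [EdgeOK.tgt, EdgeOK.src, e] at h1 h2
          rw [← h1, h2]
        · have h1 := hf (.inr ⟨j, ⟨x, Finset.mem_filter.2 ⟨hx, hyY⟩⟩⟩)
          exact h1.symm
      · rw [dif_neg hx, dif_neg (fun hy => hx ((h.2 x y hxy).2 hy))]
    | refl => rfl
    | symm _ _ _ ih => exact ih.symm
    | trans _ _ _ _ _ ih ih' => exact ih.trans ih'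
  have := main x y hxy
  rwa [dif_pos hx, dif_pos hy] at this

lemma Sat.orbit_const {Y A : Finset T} (h : S.Sat Y A) (f : S.GV A → ℚ)
    (hf : ∀ e, f (h.edgeOK.tgt e) = f (h.edgeOK.src e)) (i : Fin n)
    (q : orbitFinset (S.A i) A) : ∃ x, ∃ hx : x ∈ A, f (.inr ⟨i, q⟩) = f (.inl ⟨x, hx⟩) := by
  obtain ⟨q, hq⟩ := q
  obtain ⟨x, hx, rfl⟩ := mem_orbitFinset.1 hq
  exact ⟨x, hx, hf (.inl (⟨x, hx⟩, i))⟩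

lemma Sat.vcount_le {Y A : Finset T} (h : S.Sat Y A) {Q : Finset T} (hQ : Q ⊆ A)
    (hlink : ∀ x ∈ A, ∃ q ∈ Q, Relation.EqvGen (S.Step Y) q x) :
    S.vcount A ≤ n * A.card + ∑ j, (S.back Y A j).card + Q.card := by
  have := card_le_of_cob_injective (Q := Q) h.edgeOK.src h.edgeOK.tgt
    (fun q => .inl ⟨q.1, hQ q.2⟩) (fun f hf h0 => by
      have key : ∀ x, ∀ hx : x ∈ A, f (.inl ⟨x, hx⟩) = 0 := by
        intro x hx
        obtain ⟨q, hq, hl⟩ := hlink x hx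
        rw [← h.const f hf hl (hQ hq) hx]
        exact h0 ⟨q, hq⟩
      funext v
      rcases v with x | ⟨i, q⟩
      · exact key x.1 x.2
      · obtain ⟨x, hx, he⟩ := h.orbit_const f hf i q
        rw [he]; exact key x hx)
  rw [S.card_GV, S.card_GE] at this
  simpa using this

variable (N : NxtSpace G T)

lemma germs_edgeOK {Y A : Finset T} (h : S.Sat Y A) :
    S.EdgeOK (N.germs A Y) (fun j => N.germs (S.back Y A j) (S.back Y Y j)) := by
  intro j θ hθ
  obtain ⟨y, hy, z, hz, hyz, rfl⟩ := (N.mem_germs).1 hθ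
  have hz' := Finset.mem_filter.1 hz
  refine ⟨(N.mem_germs).2 ⟨y, (h.edgeOK j y hy).1, z, hz'.1, hyz, rfl⟩,
    (N.mem_germs).2 ⟨_, (h.edgeOK j y hy).2, _, hz'.2, fun he => hyz (smul_left_cancel _ he), ?_⟩⟩
  rw [N.smul_nxt]; rfl

lemma germs_free {Y A : Finset T} : ∀ θ ∈ N.germs A Y, ∀ g : G, g • θ = θ → g = 1 := by
  intro θ hθ g hg
  obtain ⟨y, hy, z, hz, hyz, rfl⟩ := (N.mem_germs).1 hθ
  obtain ⟨h1, h2⟩ := Prod.ext_iff.1 hg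
  exact N.free g y z hyz h1 h2

lemma Sat.germ_count {Y A : Finset T} (h : S.Sat Y A) {Θ : Finset (T × T)} (hΘA : Θ ⊆ N.germs A Y)
    (hΘ : ∀ θ ∈ Θ, ∀ θ' ∈ Θ, ∀ g : G, g • θ = θ' → θ = θ') :
    n * (N.germs A Y).card + ∑ j, (N.germs (S.back Y A j) (S.back Y Y j)).card + Θ.card
      ≤ S.vcount (N.germs A Y) :=
  S.card_GE_add_le (germs_edgeOK N h) (germs_free N) hΘA hΘ

/-- The first point of an orbit of germs. -/
def fstOrb (A : Subgroup G) :
    MulAction.orbitRel.Quotient A (T × T) → MulAction.orbitRel.Quotient A T :=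
  Quotient.map' Prod.fst (by
    intro θ θ' h
    obtain ⟨b, rfl⟩ := h
    exact ⟨b, rfl⟩)

lemma Sat.connected_count {Y A : Finset T} (h : S.Sat Y A) {o : Fin n → T}
    (ho : ∀ i, ∀ b ∈ S.A i, b • o i = o i) (hoA : ∀ i, o i ∉ A)
    (hval : ∀ y ∈ A, 2 ≤ ((N.germs A Y).filter fun θ => θ.1 = y).card)
    (hconn : ∀ x ∈ A, ∀ y ∈ A, Relation.EqvGen (S.Step Y) x y) :
    n * (N.germs A Y).card + ∑ j, (N.germs (S.back Y A j) (S.back Y Y j)).card +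
      2 * S.vcount A ≤
      S.vcount (N.germs A Y) + 2 * (n * A.card + ∑ j, (S.back Y A j).card) := by
  classical
  set D := N.germs A Y with hD
  set val : T → ℕ := fun y => (D.filter fun θ => θ.1 = y).card with hvaldef
  let vD : S.GV A → ℕ := Sum.elim (fun y => val y)
    (fun x => ((orbitFinset (S.A x.1) D).filter fun q => fstOrb (S.A x.1) q = x.2.1).card)
  let eD : S.GE A (S.back Y A) → ℕ := Sum.elim (fun x => val x.1)
    (fun x => ((N.germs (S.back Y A x.1) (S.back Y Y x.1)).filter fun θ => θ.1 = x.2.1).card)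
  have hfstD : ∀ θ ∈ D, θ.1 ∈ A := by
    intro θ hθ
    obtain ⟨y, hy, z, hz, hyz, rfl⟩ := (N.mem_germs).1 hθ
    exact hy
  have horbval : ∀ y ∈ A, ∀ i, val y ≤ ((orbitFinset (S.A i) D).filter fun q =>
      fstOrb (S.A i) q = Quotient.mk _ y).card := by
    intro y hy i
    refine Finset.card_le_card_of_injOn (fun θ => Quotient.mk _ θ) ?_ ?_
    · intro θ hθ
      obtain ⟨h1, rfl⟩ := Finset.mem_filter.1 hθ
      exact Finset.mem_coe.2 (Finset.mem_filter.2 ⟨mem_orbitFinset.2 ⟨θ, h1, rfl⟩, rfl⟩)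
    · intro θ hθ θ' hθ' he
      obtain ⟨h1, h1'⟩ := Finset.mem_filter.1 hθ
      obtain ⟨h2, h2'⟩ := Finset.mem_filter.1 hθ'
      obtain ⟨b, hb, hbe⟩ := orbit_eq_iff.1 he
      have hby : b • y = y := by
        have := (Prod.ext_iff.1 hbe).1
        rw [← h1']
        nth_rw 1 [h1', ← h2']
        exact this
      have : b = 1 := N.eq_one_of_fix (fun he : y = o i => hoA i (by rw [← he]; exact hy)) hby
          (ho i b hb)
      rw [← hbe, this, one_smul]
  have hvD : ∑ v, vD v = S.vcount D := by
    rw [Fintype.sum_sum_type, Fintype.sum_sigma, vcount]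
    congr 1
    · rw [Finset.card_eq_sum_card_fiberwise (f := Prod.fst) (t := A) (fun θ hθ => hfstD θ hθ)]
      exact Finset.sum_coe_sort A (fun y => val y)
    · refine Finset.sum_congr rfl fun i _ => ?_
      rw [Finset.card_eq_sum_card_fiberwise (f := fstOrb (S.A i)) (t := orbitFinset (S.A i) A)]
      · exact Finset.sum_coe_sort (orbitFinset (S.A i) A) (fun q =>
          ((orbitFinset (S.A i) D).filter fun x => fstOrb (S.A i) x = q).card)
      · intro q hq
        obtain ⟨θ, hθ, rfl⟩ := mem_orbitFinset.1 hq
        exact Finset.mem_coe.2 (mem_orbitFinset.2 ⟨θ.1, hfstD θ hθ, rfl⟩)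
  have heD : ∑ e, eD e = n * D.card + ∑ j, (N.germs (S.back Y A j) (S.back Y Y j)).card := by
    rw [Fintype.sum_sum_type, Fintype.sum_sigma]
    congr 1
    · rw [Fintype.sum_prod_type,
        Finset.card_eq_sum_card_fiberwise (f := Prod.fst) (t := A) (fun θ hθ => hfstD θ hθ)]
      simp only [eD, Sum.elim_inl, Finset.sum_const, Finset.card_univ, Fintype.card_fin,
        smul_eq_mul, ← Finset.mul_sum]
      rw [Finset.sum_coe_sort A (fun y => val y)]
    · refine Finset.sum_congr rfl fun j _ => ?_
      rw [Finset.card_eq_sum_card_fiberwise (f := Prod.fst) (t := S.back Y A j)]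
      · exact Finset.sum_coe_sort (S.back Y A j) (fun y =>
          ((N.germs (S.back Y A j) (S.back Y Y j)).filter fun θ => θ.1 = y).card)
      · intro θ hθ
        obtain ⟨y, hy, z, hz, hyz, rfl⟩ := (N.mem_germs).1 hθ
        exact hy
  have main := sum_weights_connected h.edgeOK.src h.edgeOK.tgt vD eD ?_ ?_ ?_ ?_ ?_
  · rw [hvD, heD, S.card_GV, S.card_GE] at main
    exact main
  · rintro (y | ⟨i, q, hq⟩)
    · exact hval y y.2
    · obtain ⟨y, hy, rfl⟩ := mem_orbitFinset.1 hq
      exact (hval y hy).trans (horbval y hy i)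
  · rintro (⟨y, i⟩ | ⟨j, y, hy⟩)
    · exact le_rfl
    · refine Finset.card_le_card fun θ hθ => ?_
      obtain ⟨h1, h2⟩ := Finset.mem_filter.1 hθ
      exact Finset.mem_filter.2 ⟨(germs_edgeOK N h j θ h1).1, h2⟩
  · rintro (⟨y, i⟩ | ⟨j, y, hy⟩)
    · exact horbval y y.2 i
    · refine Finset.card_le_card_of_injOn (fun θ => (S.a j)⁻¹ • θ) ?_ ?_
      · intro θ hθ
        obtain ⟨h1, h2⟩ := Finset.mem_filter.1 hθ
        refine Finset.mem_coe.2 (Finset.mem_filter.2 ⟨(germs_edgeOK N h j θ h1).2, ?_⟩)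
        simp only at h2
        exact congrArg (fun z => (S.a j)⁻¹ • z) h2
      · intro θ _ θ' _ he
        exact smul_left_cancel _ he
  · intro f hf
    have key : ∀ v, ∃ x, ∃ hx : x ∈ A, f v = f (.inl ⟨x, hx⟩) := by
      rintro (x | ⟨i, q⟩)
      · exact ⟨x.1, x.2, rfl⟩
      · exact h.orbit_const f hf i q
    intro v w
    obtain ⟨x, hx, e1⟩ := key v
    obtain ⟨y, hy, e2⟩ := key w
    rw [e1, e2]
    exact h.const f hf (hconn x hx y hy) hx hy
  · rw [hvD, heD]
    exact (Nat.le_add_right _ _).trans (h.germ_count N (Θ := ∅) (by simp) (by simp))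

lemma orbitFinset_card_union {X : Type*} [MulAction G X] [DecidableEq X] {A : Subgroup G}
    {P Q : Finset X}
    (h : ∀ x ∈ P, ∀ b ∈ A, b • x ∉ Q) :
    (orbitFinset A (P ∪ Q)).card = (orbitFinset A P).card + (orbitFinset A Q).card := by
  classical
  rw [← Finset.card_union_of_disjoint]
  · congr 1
    ext c
    simp only [Finset.mem_union, mem_orbitFinset]
    constructor
    · rintro ⟨y, hy | hy, he⟩
      · exact Or.inl ⟨y, hy, he⟩
      · exact Or.inr ⟨y, hy, he⟩
    · rintro (⟨y, hy, he⟩ | ⟨y, hy, he⟩)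
      · exact ⟨y, Or.inl hy, he⟩
      · exact ⟨y, Or.inr hy, he⟩
  · rw [Finset.disjoint_left]
    intro c hc hc'
    obtain ⟨x, hx, rfl⟩ := mem_orbitFinset.1 hc
    obtain ⟨y, hy, he⟩ := mem_orbitFinset.1 hc'
    obtain ⟨b, hb, hbe⟩ := orbit_eq_iff.1 he
    exact h x hx b hb (hbe ▸ hy)

lemma vcount_union {X : Type*} [MulAction G X] [DecidableEq X] {P Q : Finset X}
    (hPQ : Disjoint P Q) (h : ∀ i, ∀ x ∈ P, ∀ b ∈ S.A i, b • x ∉ Q) :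
    S.vcount (P ∪ Q) = S.vcount P + S.vcount Q := by
  unfold vcount
  rw [Finset.card_union_of_disjoint hPQ,
    Finset.sum_congr rfl fun i _ => orbitFinset_card_union (h i), Finset.sum_add_distrib]
  ring

/-- The edge count minus the vertex count for germs, corrected by twice that for points. -/
noncomputable def excess (S : StarSplit G n p) (N : NxtSpace G T) (Y A : Finset T) : ℤ :=
  (S.vcount (N.germs A Y) : ℤ) -
    ((n * (N.germs A Y).card + ∑ j, (N.germs (S.back Y A j) (S.back Y Y j)).card : ℕ) : ℤ) -
    2 * (S.vcount A - ((n * A.card + ∑ j, (S.back Y A j).card : ℕ) : ℤ))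

lemma germs_union (P Q Y : Finset T) : N.germs (P ∪ Q) Y = N.germs P Y ∪ N.germs Q Y := by
  ext θ
  simp only [N.mem_germs, Finset.mem_union]
  constructor
  · rintro ⟨y, hy | hy, h⟩
    · exact Or.inl ⟨y, hy, h⟩
    · exact Or.inr ⟨y, hy, h⟩
  · rintro (⟨y, hy, h⟩ | ⟨y, hy, h⟩)
    · exact ⟨y, Or.inl hy, h⟩
    · exact ⟨y, Or.inr hy, h⟩

lemma germs_disjoint {P Q : Finset T} (h : Disjoint P Q) (Y : Finset T) :
    Disjoint (N.germs P Y) (N.germs Q Y) := by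
  rw [Finset.disjoint_left] at h ⊢
  intro θ h1 h2
  obtain ⟨y, hy, z, hz, hyz, rfl⟩ := (N.mem_germs).1 h1
  obtain ⟨y', hy', z', hz', hyz', he⟩ := (N.mem_germs).1 h2
  obtain rfl : y = y' := (Prod.ext_iff.1 he).1
  exact h hy hy'

lemma excess_union {Y P Q : Finset T} (hP : S.Sat Y P) (hQ : S.Sat Y Q) (hPQ : Disjoint P Q) :
    S.excess N Y (P ∪ Q) = S.excess N Y P + S.excess N Y Q := by
  have hno : ∀ i, ∀ x ∈ P, ∀ b ∈ S.A i, b • x ∉ Q := by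
    intro i x hx b hb hxQ
    exact Finset.disjoint_left.1 hPQ
      ((hP.2 x _ ⟨hP.1 hx, hQ.1 hxQ, Or.inl ⟨i, b, hb, rfl⟩⟩).1 hx) hxQ
  have hno' : ∀ i, ∀ x ∈ N.germs P Y, ∀ b ∈ S.A i, b • x ∉ N.germs Q Y := by
    intro i θ hθ b hb hθ'
    obtain ⟨y, hy, z, hz, hyz, rfl⟩ := (N.mem_germs).1 hθ
    obtain ⟨y', hy', z', hz', hyz', he⟩ := (N.mem_germs).1 hθ'
    have : b • y = y' := (Prod.ext_iff.1 he).1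
    exact hno i y hy b hb (this ▸ hy')
  have hb : ∀ j, S.back Y (P ∪ Q) j = S.back Y P j ∪ S.back Y Q j := fun j =>
    Finset.filter_union ..
  have hbd : ∀ j, Disjoint (S.back Y P j) (S.back Y Q j) := fun j =>
    Finset.disjoint_filter_filter hPQ
  unfold excess
  rw [germs_union, vcount_union (germs_disjoint N hPQ Y) hno', vcount_union hPQ hno,
    Finset.card_union_of_disjoint hPQ, Finset.card_union_of_disjoint (germs_disjoint N hPQ Y)]
  simp only [hb, germs_union, Finset.card_union_of_disjoint (hbd _),
    Finset.card_union_of_disjoint (germs_disjoint N (hbd _) _), Finset.sum_add_distrib]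
  push_cast
  ring

lemma Sat.sdiff {Y P Q : Finset T} (hP : S.Sat Y P) (hQ : S.Sat Y Q) : S.Sat Y (P \ Q) := by
  refine ⟨Finset.sdiff_subset.trans hP.1, fun x y h => ?_⟩
  rw [Finset.mem_sdiff, Finset.mem_sdiff, hP.2 x y h, hQ.2 x y h]

open Classical in
lemma sat_filter {Y : Finset T} {Q : T → Prop} (h : ∀ x y, S.Step Y x y → (Q x ↔ Q y)) :
    S.Sat Y (Y.filter Q) := by
  refine ⟨Finset.filter_subset _ _, fun x y hxy => ?_⟩
  rw [Finset.mem_filter, Finset.mem_filter, h x y hxy]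
  have := hxy.1
  have := hxy.2.1
  tauto

lemma Sat.excess_nonneg {Y : Finset T} {o : Fin n → T} (ho : ∀ i, ∀ b ∈ S.A i, b • o i = o i)
    {A : Finset T} (h : S.Sat Y A) (hoA : ∀ i, o i ∉ A)
    (hval : ∀ y ∈ A, 2 ≤ ((N.germs Y Y).filter fun θ => θ.1 = y).card) :
    0 ≤ S.excess N Y A := by
  classical
  induction hc : A.card using Nat.strong_induction_on generalizing A with
  | _ c ih =>
    rcases A.eq_empty_or_nonempty with rfl | ⟨y, hy⟩
    · simp [excess, vcount, NxtSpace.germs, back, orbitFinset]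
    set C := Y.filter (fun x => Relation.EqvGen (S.Step Y) y x) with hC
    have hCs : S.Sat Y C := sat_filter fun a b hab =>
      ⟨fun h => h.trans _ _ _ (.rel _ _ hab), fun h => h.trans _ _ _ (.symm _ _ (.rel _ _ hab))⟩
    have hCA : C ⊆ A := fun x hx => (h.eqvGen (Finset.mem_filter.1 hx).2).1 hy
    have hyC : y ∈ C := Finset.mem_filter.2 ⟨h.1 hy, .refl _⟩
    have hdec : S.excess N Y A = S.excess N Y C + S.excess N Y (A \ C) := by
      rw [← excess_union N hCs (h.sdiff hCs) Finset.disjoint_sdiff,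
        Finset.union_sdiff_of_subset hCA]
    have h1 : 0 ≤ S.excess N Y (A \ C) := by
      refine ih _ ?_ (h.sdiff hCs) (fun i hi => hoA i (Finset.mem_sdiff.1 hi).1)
        (fun y hy => hval y (Finset.mem_sdiff.1 hy).1) rfl
      rw [← hc]
      exact Finset.card_lt_card ⟨Finset.sdiff_subset, fun hs => (Finset.mem_sdiff.1 (hs hy)).2 hyC⟩
    have h2 := hCs.connected_count N ho (fun i hi => hoA i (hCA hi)) (fun y hy => by
        refine (hval y (hCA hy)).trans (Finset.card_le_card fun θ hθ => ?_)
        obtain ⟨h1, rfl⟩ := Finset.mem_filter.1 hθ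
        obtain ⟨y', hy', z, hz, hyz, rfl⟩ := (N.mem_germs).1 h1
        exact Finset.mem_filter.2 ⟨(N.mem_germs).2 ⟨y', hy, z, hz, hyz, rfl⟩, rfl⟩)
      (fun a ha b hb => ((Finset.mem_filter.1 ha).2.symm).trans _ _ _ (Finset.mem_filter.1 hb).2)
    rw [hdec]
    unfold excess at h1 ⊢
    zify at h2
    push_cast at h1 h2 ⊢
    linarith

end StarSplit

namespace StarSplit

variable {G : Type} [Group G] {n p : ℕ} {S : StarSplit G n p} {T : Type*} [MulAction G T]
  [DecidableEq T]

lemma Step.mono {Y Y' : Finset T} (hY : Y ⊆ Y') {x y : T} (h : S.Step Y x y) : S.Step Y' x y :=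
  ⟨hY h.1, hY h.2.1, h.2.2⟩

variable (S) in
/-- Translates of a point are linked by finitely many elementary moves. -/
lemma exists_chain (r : T) (g : G) : ∃ C : Finset T, r ∈ C ∧ g • r ∈ C ∧
    ∀ x ∈ C, Relation.EqvGen (S.Step C) r x := by
  suffices h : ∀ g : G, ∃ C : Finset T, r ∈ C ∧ g⁻¹ • r ∈ C ∧
      ∀ x ∈ C, Relation.EqvGen (S.Step C) r x by
    simpa using h g⁻¹
  have ext : ∀ (x y : T), (∀ D : Finset T, x ∈ D → y ∈ D → Relation.EqvGen (S.Step D) x y) →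
      (∃ C : Finset T, r ∈ C ∧ x ∈ C ∧ ∀ z ∈ C, Relation.EqvGen (S.Step C) r z) →
      ∃ C : Finset T, r ∈ C ∧ y ∈ C ∧ ∀ z ∈ C, Relation.EqvGen (S.Step C) r z := by
    rintro x y hxy ⟨C, hr, hx, hC⟩
    have hsub : C ⊆ insert y C := Finset.subset_insert _ _
    have hm : ∀ z ∈ C, Relation.EqvGen (S.Step (insert y C)) r z := fun z hz =>
      (hC z hz).mono fun _ _ h => h.mono hsub
    refine ⟨insert y C, hsub hr, Finset.mem_insert_self _ _, fun z hz => ?_⟩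
    rcases Finset.mem_insert.1 hz with rfl | hz
    · exact (hm x hx).trans _ _ _ (hxy _ (hsub hx) (Finset.mem_insert_self _ _))
    · exact hm z hz
  intro g
  induction g using S.gen_induction with
  | one => exact ⟨{r}, by simp, by simp, by simpa using Relation.EqvGen.refl r⟩
  | hA i g b hb ih =>
    refine ext _ _ (fun D hx hy => .rel _ _ ⟨hx, hy, Or.inl ⟨i, b⁻¹, (S.A i).inv_mem hb, ?_⟩⟩) ih
    rw [mul_inv_rev, mul_smul]
  | ha j g =>
    have h : ∀ D : Finset T, g⁻¹ • r ∈ D → (g * S.a j)⁻¹ • r ∈ D →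
        Relation.EqvGen (S.Step D) (g⁻¹ • r) ((g * S.a j)⁻¹ • r) := fun D hx hy =>
      .rel _ _ ⟨hx, hy, Or.inr ⟨j, by rw [mul_inv_rev, mul_smul]⟩⟩
    exact ⟨ext _ _ (fun D hx hy => (h D hy hx).symm), ext _ _ h⟩

lemma exists_sat {Y : Finset T} {Q : T → Prop} (h : ∀ x y, S.Step Y x y → (Q x ↔ Q y)) :
    ∃ B, S.Sat Y B ∧ ∀ x, x ∈ B ↔ x ∈ Y ∧ Q x := by
  classical
  exact ⟨_, sat_filter h, fun x => by rw [Finset.mem_filter]⟩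

lemma excess_le (N : NxtSpace G T) {o : Fin n → T} (ho : ∀ i, ∀ b ∈ S.A i, b • o i = o i)
    {Y : Finset T} (hoY : ∀ i, o i ∈ Y) {r : T} (hr : r ∈ Y)
    (hYmed : ∀ x ∈ Y, ∀ y ∈ Y, ∀ z ∈ Y, ∀ m, N.IsMed m x y z → m ∈ Y) :
    S.excess N Y Y ≤ 2 * p - 2 := by
  have f1 := N.card_germs_le hr
  have f2 : ∀ i : Fin n, (orbitFinset (S.A i) (N.germs Y Y)).card + 2 ≤
      2 * (orbitFinset (S.A i) Y).card := fun i =>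
    N.card_orbit_germs_le (S.A i) (ho i) (hoY i)
  have f3 := N.le_card_germs hYmed
  have f4 : ∀ j : Fin p, 2 * (S.back Y Y j).card ≤
      (N.germs (S.back Y Y j) (S.back Y Y j)).card + 2 := by
    intro j
    refine N.le_card_germs fun x hx y hy z hz m hm => ?_
    obtain ⟨hx, hx'⟩ := Finset.mem_filter.1 hx
    obtain ⟨hy, hy'⟩ := Finset.mem_filter.1 hy
    obtain ⟨hz, hz'⟩ := Finset.mem_filter.1 hz
    refine Finset.mem_filter.2 ⟨hYmed x hx y hy z hz m hm, hYmed _ hx' _ hy' _ hz' _ ?_⟩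
    simpa only [NxtSpace.IsMed, NxtBtw, N.smul_nxt, smul_left_cancel_iff, ne_eq] using hm
  have g2 := Finset.sum_le_sum (s := Finset.univ) fun i _ => f2 i
  have g4 := Finset.sum_le_sum (s := Finset.univ) fun j _ => f4 j
  simp only [Finset.sum_add_distrib, Finset.sum_const, Finset.card_univ, Fintype.card_fin,
    ← Finset.mul_sum, smul_eq_mul] at g2 g4
  have f3' : n * (2 * Y.card) ≤ n * ((N.germs Y Y).card + 2) := Nat.mul_le_mul_left _ f3
  unfold excess vcount
  zify at f1 f3' g2 g4
  push_cast
  linarith only [f1, f3', g2, g4]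

/-- The Gaboriau-Levitt type index bound: pairwise inequivalent directions spanned by a finite
set are bounded in number by the orbits the set meets. -/
theorem card_directions_le (S : StarSplit G n p) (N : NxtSpace G T) {o : Fin n → T}
    (ho : ∀ i, ∀ b ∈ S.A i, b • o i = o i) {U R : Finset T} (hU : U.Nonempty)
    (hUR : ∀ u ∈ U, (∃ g : G, ∃ i, u = g • o i) ∨ ∃ g : G, ∃ r ∈ R, u = g • r)
    {Θ : Finset (T × T)}
    (hΘU : ∀ θ ∈ Θ, ∃ u ∈ U, ∃ u' ∈ U, u ≠ u' ∧ θ = (u, N.nxt u u'))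
    (hΘ : ∀ θ ∈ Θ, ∀ θ' ∈ Θ, ∀ g : G, g • θ = θ' → θ = θ') :
    Θ.card + 2 ≤ 2 * (n + p) + 2 * R.card := by
  classical
  obtain ⟨Q, hQ⟩ : ∃ Q : Finset T, Q = R ∪ Finset.univ.image o := ⟨_, rfl⟩
  have hoQ : ∀ i, o i ∈ Q := fun i =>
    hQ ▸ Finset.mem_union_right _ (Finset.mem_image_of_mem _ (Finset.mem_univ i))
  have hQc : Q.card ≤ R.card + n := by
    rw [hQ]
    refine (Finset.card_union_le _ _).trans (Nat.add_le_add_left ?_ _)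
    exact Finset.card_image_le.trans (by simp)
  have hchain : ∀ u ∈ U, ∃ q ∈ Q, ∃ C : Finset T, q ∈ C ∧ u ∈ C ∧
      ∀ x ∈ C, Relation.EqvGen (S.Step C) q x := by
    intro u hu
    rcases hUR u hu with ⟨g, i, rfl⟩ | ⟨g, r, hr, rfl⟩
    · exact ⟨o i, hoQ i, S.exists_chain (o i) g⟩
    · exact ⟨r, hQ ▸ Finset.mem_union_left _ hr, S.exists_chain r g⟩
  choose! q hqQ C hqC huC hC using hchain
  set Y₀ : Finset T := Q ∪ U.biUnion C with hY₀
  obtain ⟨Y, hY₀Y, hYmed, hYval⟩ := N.exists_median_closure Y₀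
  have hQY : Q ⊆ Y := Finset.subset_union_left.trans hY₀Y
  have hCY : ∀ u ∈ U, C u ⊆ Y := fun u hu =>
    ((Finset.subset_biUnion_of_mem C hu).trans Finset.subset_union_right).trans hY₀Y
  have hUY : U ⊆ Y := fun u hu => hCY u hu (huC u hu)
  obtain ⟨u₀, hu₀⟩ := hU
  have hYY : S.Sat Y Y := ⟨subset_rfl, fun x y h => ⟨fun _ => h.2.1, fun _ => h.1⟩⟩
  obtain ⟨B, hBs, hBmem⟩ : ∃ B, S.Sat Y B ∧
      ∀ x, x ∈ B ↔ x ∈ Y ∧ ∃ q ∈ Q, Relation.EqvGen (S.Step Y) q x :=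
    exists_sat fun x y hxy =>
      ⟨fun ⟨q, hq, h⟩ => ⟨q, hq, h.trans _ _ _ (.rel _ _ hxy)⟩,
        fun ⟨q, hq, h⟩ => ⟨q, hq, h.trans _ _ _ (.symm _ _ (.rel _ _ hxy))⟩⟩
  have hQB : Q ⊆ B := fun q hq => (hBmem q).2 ⟨hQY hq, q, hq, .refl _⟩
  have hY₀B : Y₀ ⊆ B := by
    refine Finset.union_subset hQB (Finset.biUnion_subset.2 fun u hu x hx => ?_)
    exact (hBmem x).2 ⟨hCY u hu hx, q u, hqQ u hu,
      (hC u hu x hx).mono fun _ _ h => h.mono (hCY u hu)⟩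
  have hUB : U ⊆ B := fun u hu => hY₀B
    (Finset.mem_union_right _ (Finset.mem_biUnion.2 ⟨u, hu, huC u hu⟩))
  have hgood : 0 ≤ S.excess N Y (Y \ B) := by
    refine (hYY.sdiff hBs).excess_nonneg N ho
      (fun i hi => (Finset.mem_sdiff.1 hi).2 (hQB (hoQ i))) fun y hy => ?_
    obtain ⟨hyY, hyB⟩ := Finset.mem_sdiff.1 hy
    obtain ⟨u, hu, v, hv, huy, hvy, hne⟩ := hYval y hyY fun h => hyB (hY₀B h)
    have hmem : ∀ w ∈ Y₀, w ≠ y →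
        (y, N.nxt y w) ∈ (N.germs Y Y).filter fun θ => θ.1 = y := fun w hw hwy =>
      Finset.mem_filter.2 ⟨(N.mem_germs).2 ⟨y, hyY, w, hY₀Y hw, hwy.symm, rfl⟩, rfl⟩
    exact Finset.one_lt_card.2 ⟨_, hmem u hu huy, _, hmem v hv hvy,
      fun h => hne (Prod.ext_iff.1 h).2⟩
  have hsplit : S.excess N Y Y = S.excess N Y B + S.excess N Y (Y \ B) := by
    rw [← excess_union N hBs (hYY.sdiff hBs) Finset.disjoint_sdiff,
      Finset.union_sdiff_of_subset hBs.1]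
  have hΘB : Θ ⊆ N.germs B Y := by
    intro θ hθ
    obtain ⟨u, hu, u', hu', hne, rfl⟩ := hΘU θ hθ
    exact (N.mem_germs).2 ⟨u, hUB hu, u', hUY hu', hne, rfl⟩
  have e1 := hBs.germ_count N hΘB hΘ
  have e2 := hBs.vcount_le hQB fun x hx => ((hBmem x).1 hx).2
  have hexY := excess_le N ho (fun i => hQY (hoQ i)) (hUY hu₀) hYmed
  have hexB : (Θ.card : ℤ) - 2 * Q.card ≤ S.excess N Y B := by
    unfold excess
    zify at e1 e2
    push_cast
    linarith only [e1, e2]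
  zify at hQc ⊢
  linarith only [hQc, hexY, hexB, hsplit, hgood]

end StarSplit

namespace SumProd

variable {α β : Type} {A : α → Type} {B : β → Type} [∀ a, Group (A a)] [∀ b, Group (B b)]

/-- The inclusion of a left factor. -/
def inlHom (A : α → Type) (B : β → Type) [∀ a, Group (A a)] [∀ b, Group (B b)] (a : α) :
    A a →* CoprodI (Sum.elim A B) := CoprodI.of (M := Sum.elim A B) (i := .inl a)

/-- The inclusion of a right factor. -/
def inrHom (A : α → Type) (B : β → Type) [∀ a, Group (A a)] [∀ b, Group (B b)] (b : β) :
    B b →* CoprodI (Sum.elim A B) := CoprodI.of (M := Sum.elim A B) (i := .inr b)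

/-- The homomorphism given by its restrictions to the factors. -/
def liftHom {W : Type} [Group W] (f : ∀ a, A a →* W) (g : ∀ b, B b →* W) :
    CoprodI (Sum.elim A B) →* W :=
  CoprodI.lift fun x => match x with
    | .inl a => f a
    | .inr b => g b

lemma liftHom_inl {W : Type} [Group W] (f : ∀ a, A a →* W) (g : ∀ b, B b →* W) (a : α) (x : A a) :
    liftHom f g (inlHom A B a x) = f a x := CoprodI.lift_of ..

lemma liftHom_inr {W : Type} [Group W] (f : ∀ a, A a →* W) (g : ∀ b, B b →* W) (b : β) (x : B b) :
    liftHom f g (inrHom A B b x) = g b x := CoprodI.lift_of ..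

lemma induction_on {Q : CoprodI (Sum.elim A B) → Prop} (x : CoprodI (Sum.elim A B))
    (one : Q 1) (inl : ∀ a x, Q (inlHom A B a x)) (inr : ∀ b x, Q (inrHom A B b x))
    (mul : ∀ x y, Q x → Q y → Q (x * y)) : Q x := by
  induction x using CoprodI.induction_on with
  | one => exact one
  | mul x y hx hy => exact mul x y hx hy
  | of i m =>
    rcases i with i | j
    · exact inl i m
    · exact inr j m

end SumProd

open SumProd

namespace StarSplit

lemma _root_.Multiplicative.eq_ofAdd_zpow (z : Multiplicative ℤ) :
    z = Multiplicative.ofAdd (1 : ℤ) ^ z.toAdd := by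
  rw [← ofAdd_zsmul]; simp

/-- A group with the universal property of a free product has potentials. -/
lemma exists_potential {G : Type} [Group G] {n p : ℕ} {B : Fin n → Type} [∀ i, Group (B i)]
    (bb : ∀ i, B i →* G) (aa : Fin p → G)
    (gen : Subgroup.closure ((⋃ i, Set.range (bb i)) ∪ Set.range aa) = ⊤)
    (univ : ∀ (W : Type) [Group W] (f : ∀ i, B i →* W) (c : Fin p → W),
      ∃ ρ : G →* W, (∀ i b, ρ (bb i b) = f i b) ∧ ∀ j, ρ (aa j) = c j)
    (W : Type) [Group W] (l : Fin n → G → W) (m : Fin p → G → W) : ∃ Λ : G → W,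
      Λ 1 = 1 ∧ (∀ i g b, Λ (g * bb i b) * l i (g * bb i b) = Λ g * l i g) ∧
      ∀ j g, Λ (g * aa j) = Λ g * m j g := by
  let ρf : ∀ i, B i →* Equiv.Perm (G × W) := fun i =>
    MonoidHom.toHomPerm (G := B i) (α := G × W)
      { toFun := fun b x => (x.1 * (bb i b)⁻¹,
          x.2 * l i x.1 * (l i (x.1 * (bb i b)⁻¹))⁻¹)
        map_one' := by
          funext x
          change _ = x
          simp
        map_mul' := fun b c => by
          funext x
          change _ = (x.1 * (bb i c)⁻¹ * (bb i b)⁻¹, _ * l i (x.1 * (bb i c)⁻¹) *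
            (l i (x.1 * (bb i c)⁻¹ * (bb i b)⁻¹))⁻¹)
          simp [mul_assoc] }
  let ρa : Fin p → Equiv.Perm (G × W) := fun j =>
    { toFun := fun x => (x.1 * (aa j)⁻¹, x.2 * (m j (x.1 * (aa j)⁻¹))⁻¹)
      invFun := fun x => (x.1 * aa j, x.2 * m j x.1)
      left_inv := fun x => by simp
      right_inv := fun x => by simp }
  obtain ⟨ρ, hρf, hρa⟩ := univ _ ρf ρa
  have fst : ∀ g x, (ρ g x).1 = x.1 * g⁻¹ := by
    intro g
    have hg : g ∈ Subgroup.closure ((⋃ i, Set.range (bb i)) ∪ Set.range aa) := gen ▸ trivial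
    induction hg using Subgroup.closure_induction with
    | one => simp
    | mul x y _ _ hx hy =>
      intro z
      rw [map_mul, Equiv.Perm.mul_apply, hx, hy, mul_inv_rev, mul_assoc]
    | inv x _ hx =>
      intro z
      have := hx (ρ x⁻¹ z)
      rw [← Equiv.Perm.mul_apply, ← map_mul, mul_inv_cancel, map_one] at this
      rw [inv_inv]
      exact (mul_inv_eq_iff_eq_mul.1 this.symm)
    | mem x hx =>
      intro z
      rcases hx with hx | ⟨j, rfl⟩
      · obtain ⟨i, b, rfl⟩ := Set.mem_iUnion.1 hx
        rw [hρf]; rfl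
      · rw [hρa]; rfl
  have hx : ∀ g, ρ g⁻¹ (1, 1) = (g, (ρ g⁻¹ (1, 1)).2) := fun g =>
    Prod.ext (by rw [fst]; simp) rfl
  refine ⟨fun g => (ρ g⁻¹ (1, 1)).2, by simp, ?_, ?_⟩
  · intro i g b
    dsimp only
    rw [mul_inv_rev, map_mul, Equiv.Perm.mul_apply, hx g, ← map_inv, hρf]
    change _ * l i g * (l i (g * (bb i b⁻¹)⁻¹))⁻¹ * l i (g * bb i b) = _
    simp
  · intro j g
    dsimp only
    rw [mul_inv_rev, map_mul, Equiv.Perm.mul_apply, hx g, map_inv, hρa]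
    rfl

/-- The splitting of a free product given by its free factors. -/
noncomputable def ofCoprod {n : ℕ} (Gf : Fin n → Type) [∀ i, Group (Gf i)] (p : ℕ) :
    StarSplit (CoprodI (Sum.elim Gf fun _ : Fin p => Multiplicative ℤ)) n p :=
  have gen : Subgroup.closure
      ((⋃ i, Set.range (inlHom Gf (fun _ : Fin p => Multiplicative ℤ) i)) ∪
        Set.range fun j => inrHom Gf (fun _ : Fin p => Multiplicative ℤ) j
          (Multiplicative.ofAdd (1 : ℤ))) = ⊤ := by
    rw [eq_top_iff]
    rintro x -
    induction x using SumProd.induction_on with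
    | one => exact Subgroup.one_mem _
    | mul x y hx hy => exact Subgroup.mul_mem _ hx hy
    | inl i m => exact Subgroup.subset_closure (Or.inl (Set.mem_iUnion.2 ⟨i, Set.mem_range_self m⟩))
    | inr j z =>
      rw [z.eq_ofAdd_zpow, map_zpow]
      refine Subgroup.zpow_mem _ (Subgroup.subset_closure ?_) _
      exact Or.inr ⟨j, rfl⟩
  { A := fun i => factorSubgroup (.inl i)
    a := fun j => inrHom Gf (fun _ : Fin p => Multiplicative ℤ) j (Multiplicative.ofAdd (1 : ℤ))
    gen := gen
    pot := fun W _ l m => by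
      obtain ⟨Λ, h1, h2, h3⟩ := exists_potential
        (inlHom Gf (fun _ : Fin p => Multiplicative ℤ)) _ gen
        (fun W _ f c => ⟨liftHom f (fun j => zpowersHom _ (c j)), fun i b => liftHom_inl ..,
          fun j => (liftHom_inr ..).trans (by simp)⟩) W l m
      exact ⟨Λ, h1, fun i g b ⟨x, hx⟩ => hx ▸ h2 i g x, h3⟩ }

end StarSplit

namespace StarSplit

variable {G : Type} [Group G] {n p : ℕ}

/-- A subtree of representatives for the orbits of a subgroup on the vertices of the Bass-Serre
tree. -/
structure Transversal (S : StarSplit G n p) (H : Subgroup G) where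
  rep : S.V → S.V
  mv : S.V → G
  lev : S.V → ℕ
  mv_mem : ∀ v, mv v ∈ H
  mv_smul : ∀ v, mv v • rep v = v
  mv_eq_one : ∀ v, rep v = v → mv v = 1
  rep_smul : ∀ h ∈ H, ∀ v, rep (h • v) = rep v
  rep_base : rep (S.base 1) = S.base 1
  exists_parent : ∀ v, rep v = v → v ≠ S.base 1 →
    ∃ w, rep w = w ∧ S.tree.Adj v w ∧ lev w < lev v

lemma exists_transversal (S : StarSplit G n p) (H : Subgroup G) : Nonempty (S.Transversal H) := by
  classical
  let mk : S.V → MulAction.orbitRel.Quotient H S.V := Quotient.mk _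
  let lev : MulAction.orbitRel.Quotient H S.V → ℕ := fun q =>
    sInf {d | ∃ v, mk v = q ∧ S.tree.dist v (S.base 1) = d}
  have hlev : ∀ q, ∃ v, mk v = q ∧ S.tree.dist v (S.base 1) = lev q := fun q => by
    obtain ⟨v, rfl⟩ := Quotient.exists_rep q
    exact Nat.sInf_mem (s := {d | ∃ w, mk w = mk v ∧ S.tree.dist w (S.base 1) = d})
      ⟨_, v, rfl, rfl⟩
  have lev_le : ∀ v, lev (mk v) ≤ S.tree.dist v (S.base 1) := fun v => Nat.sInf_le ⟨v, rfl, rfl⟩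
  have hF : ∀ q (ih : ∀ q', lev q' < lev q → {v // mk v = q'}), ∃ x : {v // mk v = q},
      (lev q = 0 → x.1 = S.base 1) ∧
      (lev q ≠ 0 → ∃ q' h, S.tree.Adj x.1 (ih q' h).1) := by
    intro q ih
    obtain ⟨v, hv, hd⟩ := hlev q
    by_cases h0 : lev q = 0
    · rw [h0] at hd
      exact ⟨⟨v, hv⟩, fun _ => S.tree_isTree.connected.dist_eq_zero_iff.1 hd, fun h => (h h0).elim⟩
    · have hne : v ≠ S.base 1 := by
        rintro rfl
        rw [SimpleGraph.dist_self] at hd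
        exact h0 hd.symm
      have hn := S.tree_isTree.dist_nxt hne
      have hlt : lev (mk (S.tree.nxt v (S.base 1))) < lev q := by
        have := lev_le (S.tree.nxt v (S.base 1))
        omega
      obtain ⟨b, hb, hbe⟩ := orbit_eq_iff.1 (ih _ hlt).2
      refine ⟨⟨b • v, ?_⟩, fun h => (h0 h).elim, fun _ => ⟨_, hlt, ?_⟩⟩
      · rw [← hv]
        exact orbit_eq_iff.2 ⟨b, hb, rfl⟩
      · change S.tree.Adj (b • v) (ih _ hlt).1
        rw [← hbe]
        exact S.adj_smul b (S.tree_isTree.adj_nxt hne)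
  choose F hF0 hF1 using hF
  have wf : WellFounded fun q q' => lev q < lev q' := (measure lev).wf
  let rep : ∀ q, {v // mk v = q} := wf.fix F
  have hrep : ∀ q, rep q = F q (fun q' _ => rep q') := fun q => wf.fix_eq F q
  have hmv : ∀ v, ∃ h ∈ H, h • (rep (mk v)).1 = v ∧ ((rep (mk v)).1 = v → h = 1) := by
    intro v
    by_cases hv : (rep (mk v)).1 = v
    · exact ⟨1, H.one_mem, by rw [one_smul, hv], fun _ => rfl⟩
    · obtain ⟨b, hb, hbe⟩ := orbit_eq_iff.1 (rep (mk v)).2.symm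
      exact ⟨b, hb, hbe, fun h => (hv h).elim⟩
  choose mv mv_mem mv_smul mv_one using hmv
  have h0 : lev (mk (S.base 1)) = 0 := by
    have := lev_le (S.base 1)
    rw [SimpleGraph.dist_self] at this
    omega
  exact ⟨{
    rep := fun v => (rep (mk v)).1
    mv := mv
    lev := fun v => lev (mk v)
    mv_mem := mv_mem
    mv_smul := mv_smul
    mv_eq_one := mv_one
    rep_smul := fun h hh v => by
      have : mk (h • v) = mk v := orbit_eq_iff.2 ⟨h, hh, rfl⟩
      rw [this]
    rep_base := by
      rw [hrep]
      exact hF0 _ _ h0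
    exists_parent := fun v hv hne => by
      have hl : lev (mk v) ≠ 0 := fun h => hne (by
        rw [← hv, hrep]
        exact hF0 _ _ h)
      obtain ⟨q', h, hadj⟩ := hF1 (mk v) (fun q' _ => rep q') hl
      rw [← hrep] at hadj
      have hq' : mk (rep q').1 = q' := (rep q').2
      refine ⟨(rep q').1, by rw [hq'], hv ▸ hadj, by rwa [hq']⟩ }⟩

namespace Transversal

variable {S : StarSplit G n p} {H : Subgroup G} (R : S.Transversal H)

lemma rep_rep (v : S.V) : R.rep (R.rep v) = R.rep v := by
  conv_rhs => rw [← R.mv_smul v]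
  rw [R.rep_smul _ (R.mv_mem v)]

lemma rep_induction {Q : S.V → Prop} (one : Q (S.base 1))
    (edge : ∀ g t, R.rep (S.base g) = S.base g → R.rep (S.tgt g t) = S.tgt g t →
      (Q (S.base g) ↔ Q (S.tgt g t))) (v : S.V) (hv : R.rep v = v) : Q v := by
  induction hl : R.lev v using Nat.strong_induction_on generalizing v with
  | _ l ih =>
    by_cases h : v = S.base 1
    · rw [h]; exact one
    · obtain ⟨w, hw, ⟨g, t, ⟨rfl, rfl⟩ | ⟨rfl, rfl⟩⟩, hlt⟩ := R.exists_parent v hv h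
      · exact (edge g t hv hw).2 (ih _ (hl ▸ hlt) _ hw rfl)
      · exact (edge g t hw hv).1 (ih _ (hl ▸ hlt) _ hw rfl)

/-- The translating element of a base vertex. -/
def coc (g : G) : G := R.mv (S.base g)

/-- The representative of an element. -/
def red (g : G) : G := (R.coc g)⁻¹ * g

lemma rep_base_eq (g : G) : R.rep (S.base g) = S.base (R.red g) := by
  have := R.mv_smul (S.base g)
  rw [← eq_inv_smul_iff, S.smul_base] at this
  exact this

lemma coc_mem (g : G) : R.coc g ∈ H := R.mv_mem _

lemma coc_mul_red (g : G) : R.coc g * R.red g = g := by simp [red]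

lemma red_mul {h : G} (hh : h ∈ H) (g : G) : R.red (h * g) = R.red g := by
  have := R.rep_smul h hh (S.base g)
  rw [S.smul_base, rep_base_eq, rep_base_eq] at this
  exact Sum.inl_injective this

lemma coc_mul {h : G} (hh : h ∈ H) (g : G) : R.coc (h * g) = h * R.coc g := by
  have h1 := R.coc_mul_red (h * g)
  rw [R.red_mul hh] at h1
  have h2 := R.coc_mul_red g
  rw [← mul_left_inj (R.red g), h1, mul_assoc, h2]

lemma red_one : R.red 1 = 1 := by
  have := R.rep_base
  rw [rep_base_eq] at this
  exact Sum.inl_injective this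

lemma coc_of_mem {h : G} (hh : h ∈ H) : R.coc h = h := by
  have := R.coc_mul hh 1
  have h1 := R.coc_mul_red 1
  rw [R.red_one, mul_one] at h1
  rwa [mul_one, h1, mul_one] at this

lemma coc_eq_one_iff {g : G} : R.coc g = 1 ↔ R.red g = g := by
  have := R.coc_mul_red g
  constructor
  · intro h; rwa [h, one_mul] at this
  · intro h; rw [h] at this; simpa using this

lemma red_red (g : G) : R.red (R.red g) = R.red g := by
  have := R.rep_rep (S.base g)
  rw [rep_base_eq, rep_base_eq] at this
  exact Sum.inl_injective this

/-- The stabiliser of a vertex in the subgroup. -/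
def _root_.StarSplit.stab (S : StarSplit G n p) (H : Subgroup G) (v : S.V) : Subgroup G :=
  MulAction.stabilizer G v ⊓ H

/-- Representatives of the vertices with nontrivial stabiliser. -/
abbrev SingIdx : Type := {v : S.V // R.rep v = v ∧ S.stab H v ≠ ⊥}

/-- Edges leaving the subtree of representatives. -/
abbrev ExitIdx : Type :=
  {x : G × (Fin n ⊕ Fin p) // R.red x.1 = x.1 ∧ R.rep (S.tgt x.1 x.2) ≠ S.tgt x.1 x.2}

/-- The element of the subgroup attached to an exit edge. -/
def exitElt (x : R.ExitIdx) : G := R.mv (S.tgt x.1.1 x.1.2)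

/-- The abstract free product. -/
abbrev Prod : Type :=
  CoprodI (Sum.elim (fun v : R.SingIdx => ↥(S.stab H v.1)) fun _ : R.ExitIdx => Multiplicative ℤ)

end Transversal

end StarSplit

namespace StarSplit

lemma mem_stab {G : Type} [Group G] {n p : ℕ} {S : StarSplit G n p} {H : Subgroup G} {v : S.V}
    {x : G} : x ∈ S.stab H v ↔ x • v = v ∧ x ∈ H := Iff.rfl

namespace Transversal

variable {G : Type} [Group G] {n p : ℕ} {S : StarSplit G n p} {H : Subgroup G} (R : S.Transversal H)

open Classical in
/-- An element of a vertex stabiliser as an element of the abstract free product. -/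
noncomputable def sing (v : S.V) (x : G) : R.Prod :=
  if h : R.rep v = v ∧ x ∈ S.stab H v ∧ x ≠ 1 then
    SumProd.inlHom (fun v : R.SingIdx => ↥(S.stab H v.1)) (fun _ : R.ExitIdx => Multiplicative ℤ)
      ⟨v, h.1, fun hb => h.2.2 (Subgroup.mem_bot.1 (hb ▸ h.2.1))⟩ ⟨x, h.2.1⟩
  else 1

lemma sing_one (v : S.V) : R.sing v 1 = 1 := dif_neg fun h => h.2.2 rfl

lemma sing_eq (v : R.SingIdx) (x : S.stab H v.1) : R.sing v.1 x =
    SumProd.inlHom (fun v : R.SingIdx => ↥(S.stab H v.1)) (fun _ : R.ExitIdx => Multiplicative ℤ)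
      v x := by
  by_cases hx : (x : G) = 1
  · have : x = 1 := Subtype.ext hx
    rw [hx, sing_one, this, map_one]
  · exact dif_pos ⟨v.2.1, x.2, hx⟩

lemma sing_mul {v : S.V} (hv : R.rep v = v) {x y : G} (hx : x ∈ S.stab H v) (hy : y ∈ S.stab H v) :
    R.sing v (x * y) = R.sing v x * R.sing v y := by
  by_cases hb : S.stab H v = ⊥
  · rw [hb, Subgroup.mem_bot] at hx hy
    simp [hx, hy, sing_one]
  · have h := fun z => R.sing_eq ⟨v, hv, hb⟩ z
    have h1 := h ⟨x, hx⟩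
    have h2 := h ⟨y, hy⟩
    have h3 := h (⟨x, hx⟩ * ⟨y, hy⟩)
    rw [map_mul, ← h1, ← h2] at h3
    exact h3

lemma sing_inv {v : S.V} (hv : R.rep v = v) {x : G} (hx : x ∈ S.stab H v) :
    R.sing v x⁻¹ = (R.sing v x)⁻¹ := by
  rw [eq_inv_iff_mul_eq_one, ← R.sing_mul hv (Subgroup.inv_mem _ hx) hx, inv_mul_cancel, sing_one]

open Classical in
/-- The label of an edge in the abstract free product. -/
noncomputable def exit (g : G) (t : Fin n ⊕ Fin p) : R.Prod :=
  if h : R.red (R.red g) = R.red g ∧ R.rep (S.tgt (R.red g) t) ≠ S.tgt (R.red g) t then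
    SumProd.inrHom (fun v : R.SingIdx => ↥(S.stab H v.1)) (fun _ : R.ExitIdx => Multiplicative ℤ)
      ⟨(R.red g, t), h⟩ (Multiplicative.ofAdd 1)
  else 1

lemma exit_mul {h : G} (hh : h ∈ H) (g : G) (t : Fin n ⊕ Fin p) :
    R.exit (h * g) t = R.exit g t := by
  unfold exit
  rw [R.red_mul hh]

/-- Evaluation of the abstract free product. -/
noncomputable def toG : R.Prod →* G :=
  SumProd.liftHom (fun v => (S.stab H v.1).subtype) (fun x => zpowersHom G (R.exitElt x))

lemma toG_sing {v : S.V} (hv : R.rep v = v) {x : G} (hx : x ∈ S.stab H v) :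
    R.toG (R.sing v x) = x := by
  by_cases h : x = 1
  · rw [h, sing_one, map_one]
  · rw [sing, dif_pos ⟨hv, hx, h⟩]
    exact SumProd.liftHom_inl ..

lemma toG_exit (g : G) (t : Fin n ⊕ Fin p) : R.toG (R.exit g t) = R.mv (S.tgt (R.red g) t) := by
  unfold exit
  split_ifs with h
  · refine (SumProd.liftHom_inr ..).trans ?_
    simp [exitElt]
  · rw [map_one]
    exact (R.mv_eq_one _ (by simpa [R.red_red] using h)).symm

/-- The twisting element of an edge towards a star vertex. -/
def twist (i : Fin n) (g : G) : G :=
  (R.mv (S.star i (R.red g)))⁻¹ * (R.coc g)⁻¹ * R.mv (S.star i g)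

lemma star_eq (i : Fin n) (g : G) : S.star i g = R.coc g • S.star i (R.red g) := by
  rw [S.smul_star, R.coc_mul_red]

lemma rep_star_red (i : Fin n) (g : G) : R.rep (S.star i (R.red g)) = R.rep (S.star i g) := by
  rw [R.star_eq i g, R.rep_smul _ (R.coc_mem g)]

lemma twist_mem (i : Fin n) (g : G) : R.twist i g ∈ S.stab H (R.rep (S.star i g)) := by
  refine mem_stab.2 ⟨?_, H.mul_mem (H.mul_mem (H.inv_mem (R.mv_mem _)) (H.inv_mem (R.coc_mem g)))
    (R.mv_mem _)⟩
  rw [twist, mul_smul, mul_smul, R.mv_smul, inv_smul_eq_iff, inv_smul_eq_iff, ← rep_star_red,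
    R.mv_smul, R.star_eq]

/-- The label of a star edge. -/
noncomputable def lab (i : Fin n) (g : G) : R.Prod :=
  R.exit g (.inl i) * R.sing (R.rep (S.star i g)) (R.twist i g)

lemma toG_lab (i : Fin n) (g : G) : R.toG (R.lab i g) = (R.coc g)⁻¹ * R.mv (S.star i g) := by
  rw [lab, map_mul, toG_exit, R.toG_sing (R.rep_rep _) (R.twist_mem i g), twist]
  simp [tgt, mul_assoc]

lemma twist_mul {h : G} (hh : h ∈ H) (i : Fin n) (g : G) : R.twist i (h * g) =
    R.twist i g * ((R.mv (S.star i g))⁻¹ * h⁻¹ * R.mv (h • S.star i g)) := by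
  simp only [twist, R.red_mul hh, R.coc_mul hh, S.smul_star]
  group

lemma turn_mem {h : G} (hh : h ∈ H) (v : S.V) :
    (R.mv v)⁻¹ * h⁻¹ * R.mv (h • v) ∈ S.stab H (R.rep v) := by
  refine mem_stab.2 ⟨?_, H.mul_mem (H.mul_mem (H.inv_mem (R.mv_mem _)) (H.inv_mem hh))
    (R.mv_mem _)⟩
  rw [mul_smul, mul_smul, inv_smul_eq_iff, inv_smul_eq_iff, R.mv_smul]
  nth_rw 1 [← R.rep_smul h hh]
  rw [R.mv_smul]

lemma lab_mul {h : G} (hh : h ∈ H) (i : Fin n) (g : G) : R.lab i (h * g) =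
    R.lab i g * R.sing (R.rep (S.star i g))
      ((R.mv (S.star i g))⁻¹ * h⁻¹ * R.mv (h • S.star i g)) := by
  have : R.rep (S.star i (h * g)) = R.rep (S.star i g) := by
    rw [← S.smul_star, R.rep_smul _ hh]
  rw [lab, lab, R.exit_mul hh, this, R.twist_mul hh, R.sing_mul (R.rep_rep _) (R.twist_mem i g)
    (R.turn_mem hh _)]
  simp only [mul_assoc]

/-- The potential of the labels. -/
noncomputable def fold : G → R.Prod :=
  (S.pot R.Prod R.lab (fun j g => R.exit g (.inr j))).choose

lemma fold_one : R.fold 1 = 1 :=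
  (S.pot R.Prod R.lab (fun j g => R.exit g (.inr j))).choose_spec.1

lemma fold_star {i : Fin n} (g : G) {b : G} (hb : b ∈ S.A i) :
    R.fold (g * b) * R.lab i (g * b) = R.fold g * R.lab i g :=
  (S.pot R.Prod R.lab (fun j g => R.exit g (.inr j))).choose_spec.2.1 i g b hb

lemma fold_a (j : Fin p) (g : G) : R.fold (g * S.a j) = R.fold g * R.exit g (.inr j) :=
  (S.pot R.Prod R.lab (fun j g => R.exit g (.inr j))).choose_spec.2.2 j g

lemma toG_fold (g : G) : R.toG (R.fold g) = R.coc g := by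
  induction g using S.gen_induction with
  | one => rw [fold_one, map_one, R.coc_of_mem H.one_mem]
  | hA i g b hb ih =>
    have h := congrArg R.toG (R.fold_star (i := i) g hb)
    have hs : S.star i (g * b) = S.star i g := S.star_eq_iff.2 (by simpa using hb)
    rw [map_mul, map_mul, toG_lab, toG_lab, ih, hs, mul_inv_cancel_left, ← mul_assoc,
      mul_eq_right, mul_inv_eq_one] at h
    exact h
  | ha j g =>
    rw [fold_a, map_mul, toG_exit]
    have : R.coc (g * S.a j) = R.coc g * R.mv (S.tgt (R.red g) (.inr j)) := by
      nth_rw 1 [← R.coc_mul_red g]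
      rw [mul_assoc, R.coc_mul (R.coc_mem g)]
      rfl
    rw [this, mul_left_inj]

lemma fold_mul {h : G} (hh : h ∈ H) (g : G) : R.fold (h * g) = R.fold h * R.fold g := by
  induction g using S.gen_induction with
  | one => rw [fold_one, mul_one, mul_one]
  | hA i g b hb ih =>
    have h1 := R.fold_star (i := i) g hb
    have h2 := R.fold_star (i := i) (h * g) hb
    have hs : S.star i (g * b) = S.star i g := S.star_eq_iff.2 (by simpa using hb)
    rw [mul_assoc, R.lab_mul hh, R.lab_mul hh, hs, ← mul_assoc, ← mul_assoc (R.fold (h * g)),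
      mul_left_inj, ih,
      mul_assoc (R.fold h), ← h1, ← mul_assoc (R.fold h), mul_left_inj] at h2
    exact h2
  | ha j g =>
    rw [← mul_assoc, fold_a, fold_a, R.exit_mul hh, ← mul_assoc, mul_left_inj]

/-- The potential on the vertices. -/
noncomputable def foldV : S.V → R.Prod
  | .inl g => R.fold g
  | .inr s => R.fold s.2.out * R.lab s.1 s.2.out

lemma foldV_base (g : G) : R.foldV (S.base g) = R.fold g := rfl

lemma foldV_star (i : Fin n) (g : G) : R.foldV (S.star i g) = R.fold g * R.lab i g := by
  have h : (g : G ⧸ S.A i).out = g * (g⁻¹ * (g : G ⧸ S.A i).out) := by simp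
  have hb : g⁻¹ * (g : G ⧸ S.A i).out ∈ S.A i :=
    QuotientGroup.eq.1 (by simp)
  change R.fold (g : G ⧸ S.A i).out * R.lab i (g : G ⧸ S.A i).out = _
  rw [h]
  exact R.fold_star g hb

lemma foldV_smul {h : G} (hh : h ∈ H) (v : S.V) : R.foldV (h • v) =
    R.fold h * R.foldV v * R.sing (R.rep v) ((R.mv v)⁻¹ * h⁻¹ * R.mv (h • v)) := by
  rcases v with g | ⟨i, c⟩
  · have h1 := (mem_stab.1 (R.turn_mem hh (S.base g))).1
    rw [R.rep_base_eq] at h1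
    have h2 := S.eq_one_of_smul_base h1
    change R.fold (h * g) = R.fold h * R.fold g * R.sing (R.rep (S.base g))
      ((R.mv (S.base g))⁻¹ * h⁻¹ * R.mv (h • S.base g))
    rw [h2, sing_one, mul_one, R.fold_mul hh]
  · induction c using Quotient.inductionOn' with
    | h g =>
      change R.foldV (S.star i (h * g)) = R.fold h * R.foldV (S.star i g) *
        R.sing (R.rep (S.star i g)) ((R.mv (S.star i g))⁻¹ * h⁻¹ * R.mv (h • S.star i g))
      rw [foldV_star, foldV_star, R.fold_mul hh, R.lab_mul hh]
      simp only [mul_assoc]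

lemma foldV_tgt {g : G} (hg : R.red g = g) (t : Fin n ⊕ Fin p) :
    R.foldV (S.tgt g t) = R.fold g * R.exit g t := by
  rcases t with i | j
  · change R.foldV (S.star i g) = _
    rw [foldV_star, lab, twist, R.coc_eq_one_iff.2 hg, hg]
    simp [sing_one]
  · exact R.fold_a j g

lemma exit_eq_one {g : G} (hg : R.red g = g) {t : Fin n ⊕ Fin p}
    (ht : R.rep (S.tgt g t) = S.tgt g t) : R.exit g t = 1 :=
  dif_neg (by rw [hg]; exact fun h => h.2 ht)

lemma exit_eq (x : R.ExitIdx) : R.exit x.1.1 x.1.2 = SumProd.inrHom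
    (fun v : R.SingIdx => ↥(S.stab H v.1)) (fun _ : R.ExitIdx => Multiplicative ℤ) x
      (Multiplicative.ofAdd 1) := by
  obtain ⟨⟨g, t⟩, hg, ht⟩ := x
  have h : R.red (R.red g) = R.red g ∧ R.rep (S.tgt (R.red g) t) ≠ S.tgt (R.red g) t := by
    have hg' : R.red g = g := hg
    rw [hg']; exact ⟨hg, ht⟩
  refine (dif_pos h).trans ?_
  congr 2
  exact Subtype.ext (Prod.ext hg rfl)

lemma red_eq_iff {g : G} : R.red g = g ↔ R.rep (S.base g) = S.base g := by
  rw [rep_base_eq]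
  exact ⟨fun h => by rw [h], fun h => Sum.inl_injective h⟩

lemma foldV_eq_one {v : S.V} (hv : R.rep v = v) : R.foldV v = 1 := by
  refine R.rep_induction (Q := fun v => R.foldV v = 1) R.fold_one (fun g t hg ht => ?_) v hv
  · have hg' := R.red_eq_iff.2 hg
    rw [R.foldV_tgt hg', R.exit_eq_one hg' ht, mul_one]
    rfl

lemma fold_stab (v : R.SingIdx) {b : G} (hb : b ∈ S.stab H v.1) : R.fold b = R.sing v.1 b := by
  obtain ⟨h1, h2⟩ := mem_stab.1 hb
  have := R.foldV_smul h2 v.1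
  rw [h1, R.foldV_eq_one v.2.1, R.mv_eq_one _ v.2.1, v.2.1, mul_one, inv_one, one_mul, mul_one,
    R.sing_inv v.2.1 hb, eq_mul_inv_iff_mul_eq, one_mul] at this
  exact this.symm

lemma fold_exitElt (x : R.ExitIdx) : R.fold (R.exitElt x) = R.exit x.1.1 x.1.2 := by
  have h1 := R.foldV_tgt x.2.1 x.1.2
  rw [← R.foldV_base, R.foldV_eq_one (R.red_eq_iff.1 x.2.1), one_mul] at h1
  have h2 := R.foldV_smul (R.mv_mem (S.tgt x.1.1 x.1.2)) (R.rep (S.tgt x.1.1 x.1.2))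
  rw [R.mv_smul, R.mv_eq_one _ (R.rep_rep _), R.foldV_eq_one (R.rep_rep _), inv_one, one_mul,
    inv_mul_cancel, sing_one, mul_one, mul_one, h1] at h2
  exact h2.symm

lemma toG_mem (w : R.Prod) : R.toG w ∈ H := by
  induction w using SumProd.induction_on with
  | one => rw [map_one]; exact H.one_mem
  | mul x y hx hy => rw [map_mul]; exact H.mul_mem hx hy
  | inl v x =>
    rw [toG, SumProd.liftHom_inl]
    exact (mem_stab.1 x.2).2
  | inr x z =>
    rw [toG, SumProd.liftHom_inr]
    exact H.zpow_mem (R.mv_mem _) _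

lemma fold_toG (w : R.Prod) : R.fold (R.toG w) = w := by
  induction w using SumProd.induction_on with
  | one => rw [map_one, fold_one]
  | mul x y hx hy => rw [map_mul, R.fold_mul (R.toG_mem x), hx, hy]
  | inl v x =>
    rw [toG, SumProd.liftHom_inl, Subgroup.subtype_apply, R.fold_stab v x.2, sing_eq]
  | inr x z =>
    let Φ : H →* R.Prod := MonoidHom.mk' (fun h => R.fold h) fun a b => R.fold_mul a.2 b
    have hx : Φ ⟨R.exitElt x, R.mv_mem _⟩ = SumProd.inrHom
        (fun v : R.SingIdx => ↥(S.stab H v.1)) (fun _ : R.ExitIdx => Multiplicative ℤ) x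
          (Multiplicative.ofAdd 1) := (R.fold_exitElt x).trans (R.exit_eq x)
    have := map_zpow Φ ⟨R.exitElt x, R.mv_mem _⟩ z.toAdd
    rw [hx, ← map_zpow, ← z.eq_ofAdd_zpow] at this
    rw [toG, SumProd.liftHom_inr]
    exact this

/-- The Kurosh decomposition. -/
noncomputable def equiv : H ≃* R.Prod where
  toFun h := R.fold h
  invFun w := ⟨R.toG w, R.toG_mem w⟩
  left_inv h := Subtype.ext ((R.toG_fold h).trans (R.coc_of_mem h.2))
  right_inv w := R.fold_toG w
  map_mul' a b := R.fold_mul a.2 b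

lemma mem_induction {Q : G → Prop} (one : Q 1) (mul : ∀ x ∈ H, ∀ y ∈ H, Q x → Q y → Q (x * y))
    (inv : ∀ x ∈ H, Q x → Q x⁻¹)
    (stab : ∀ v : R.SingIdx, ∀ x ∈ S.stab H v.1, Q x) (exit : ∀ x, Q (R.exitElt x)) {h : G}
    (hh : h ∈ H) : Q h := by
  suffices hw : ∀ w : R.Prod, Q (R.toG w) by
    have := hw (R.fold h)
    rwa [R.toG_fold, R.coc_of_mem hh] at this
  intro w
  induction w using SumProd.induction_on with
  | one => rw [map_one]; exact one
  | mul x y hx hy => rw [map_mul]; exact mul _ (R.toG_mem x) _ (R.toG_mem y) hx hy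
  | inl v x =>
    rw [toG, SumProd.liftHom_inl]
    exact stab v x x.2
  | inr x z =>
    rw [toG, SumProd.liftHom_inr]
    change Q (R.exitElt x ^ z.toAdd)
    have hx := R.mv_mem (S.tgt x.1.1 x.1.2)
    induction z.toAdd using Int.induction_on with
    | zero => simpa using one
    | succ k ih =>
      rw [zpow_add_one]
      exact mul _ (H.zpow_mem hx _) _ hx ih (exit x)
    | pred k ih =>
      rw [zpow_sub_one]
      exact mul _ (H.zpow_mem hx _) _ (H.inv_mem hx) ih (inv _ hx (exit x))

open Classical in
/-- Each exit edge is detected by an equivariant function. -/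
lemma exists_dual (k : Type) [Ring k] (x : R.ExitIdx) : ∃ u : S.V → k,
    (∀ h ∈ H, ∀ v w, u (h • v) - u (h • w) = u v - u w) ∧ u (S.base 1) = 0 ∧
    (∀ v, R.rep v = v → u v = 0) ∧
    ∀ y : R.ExitIdx, u (R.exitElt y • S.base 1) = if y = x then 1 else 0 := by
  obtain ⟨u, u0, hu⟩ := S.exists_vpot
    (fun g t => if (R.red g, t) = x.1 then (1 : k) else 0)
  have haff : ∀ h ∈ H, ∀ v, u (h • v) - u (h • S.base 1) = u v := by
    intro h hh v
    have := S.vpot_unique (h := fun v => u (h • v) - u (h • S.base 1)) (h' := u)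
      (by simp [u0]) (fun g t => by
        simp only [sub_sub_sub_cancel_right]
        rw [hu, S.smul_tgt, S.smul_base, hu, R.red_mul hh])
    exact congrFun this v
  have hT : ∀ v, R.rep v = v → u v = 0 := by
    intro v hv
    refine R.rep_induction (Q := fun v => u v = 0) u0 (fun g t hg ht => ?_) v hv
    · have := hu g t
      rw [if_neg] at this
      · rw [sub_eq_zero] at this; rw [this]
      · intro h
        rw [R.red_eq_iff.2 hg] at h
        exact x.2.2 (by rw [← h]; exact ht)
  refine ⟨u, fun h hh v w => ?_, u0, hT, fun y => ?_⟩
  · rw [← haff h hh v, ← haff h hh w]; abel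
  · have h1 := haff _ (R.mv_mem (S.tgt y.1.1 y.1.2)) (R.rep (S.tgt y.1.1 y.1.2))
    rw [R.mv_smul, hT _ (R.rep_rep _), sub_eq_zero] at h1
    have h2 := hu y.1.1 y.1.2
    rw [hT _ (R.red_eq_iff.1 y.2.1), sub_zero, y.2.1] at h2
    rw [exitElt, ← h1, h2]
    simp only [Subtype.ext_iff, Prod.mk.eta]

end Transversal

end StarSplit

namespace StarSplit

lemma tgt_injective {G : Type} [Group G] {n p : ℕ} {S : StarSplit G n p} {g : G}
    {t t' : Fin n ⊕ Fin p} (h : S.tgt g t = S.tgt g t') : t = t' := by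
  have h1 := S.hs_smul_spec ℤ t g g t
  have h2 := S.hs_smul_spec ℤ t g g t'
  rw [← h, h1] at h2
  by_contra hne
  simp [Ne.symm hne] at h2

namespace Transversal

variable {G : Type} [Group G] {n p : ℕ} {S : StarSplit G n p} {H : Subgroup G} (R : S.Transversal H)

open Classical in
lemma exists_closed (B : Finset S.V) (hB : ∀ v ∈ B, R.rep v = v) : ∃ F : Finset S.V,
    B ⊆ F ∧ S.base 1 ∈ F ∧ (∀ v ∈ F, R.rep v = v) ∧
    ∀ v ∈ F, v ≠ S.base 1 → ∃ w ∈ F, S.tree.Adj v w ∧ R.lev w < R.lev v := by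
  have key : ∀ l v, R.lev v = l → R.rep v = v → ∃ F : Finset S.V,
      v ∈ F ∧ S.base 1 ∈ F ∧ (∀ v ∈ F, R.rep v = v) ∧
      ∀ v ∈ F, v ≠ S.base 1 → ∃ w ∈ F, S.tree.Adj v w ∧ R.lev w < R.lev v := by
    intro l
    induction l using Nat.strong_induction_on with
    | _ l ih =>
      intro v hl hv
      by_cases h1 : v = S.base 1
      · refine ⟨{S.base 1}, by simp [h1], by simp, by simp [R.rep_base], by simp⟩
      · obtain ⟨w, hw, hvw, hlt⟩ := R.exists_parent v hv h1
        obtain ⟨F, hF, hF1, hFr, hFc⟩ := ih _ (hl ▸ hlt) w rfl hw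
        refine ⟨insert v F, by simp, by simp [hF1], ?_, ?_⟩
        · intro x hx
          rcases Finset.mem_insert.1 hx with rfl | hx
          exacts [hv, hFr x hx]
        · intro x hx hx1
          rcases Finset.mem_insert.1 hx with rfl | hx
          · exact ⟨w, by simp [hF], hvw, hlt⟩
          · obtain ⟨y, hy, h⟩ := hFc x hx hx1
            exact ⟨y, by simp [hy], h⟩
  induction B using Finset.induction_on with
  | empty => exact ⟨{S.base 1}, by simp, by simp, by simp [R.rep_base], by simp⟩
  | insert v B _ ih =>
    obtain ⟨F, h1, h2, h3, h4⟩ := ih fun x hx => hB x (by simp [hx])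
    obtain ⟨F', h1', h2', h3', h4'⟩ := key _ v rfl (hB v (by simp))
    refine ⟨F ∪ F', ?_, by simp [h2], ?_, ?_⟩
    · intro x hx
      rcases Finset.mem_insert.1 hx with rfl | hx
      · simp [h1']
      · simp [h1 hx]
    · intro x hx
      rcases Finset.mem_union.1 hx with hx | hx
      exacts [h3 x hx, h3' x hx]
    · intro x hx hx1
      rcases Finset.mem_union.1 hx with hx | hx
      · obtain ⟨y, hy, h⟩ := h4 x hx hx1
        exact ⟨y, by simp [hy], h⟩
      · obtain ⟨y, hy, h⟩ := h4' x hx hx1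
        exact ⟨y, by simp [hy], h⟩

open Classical in
lemma exists_edges (I : Finset R.SingIdx) (X : Finset R.ExitIdx) :
    ∃ (F : Finset S.V) (E : Finset (G × (Fin n ⊕ Fin p))), S.base 1 ∈ F ∧
      (∀ v ∈ F, R.rep v = v) ∧ (∀ v ∈ I, v.1 ∈ F) ∧
      (∀ e ∈ E, S.base e.1 ∈ F ∧ R.rep (S.tgt e.1 e.2) ∈ F) ∧
      F.card + X.card ≤ E.card + 1 := by
  obtain ⟨F, hBF, hF1, hFr, hFc⟩ := R.exists_closed
    (I.image (fun v => v.1) ∪ (X.image (fun x => S.base x.1.1) ∪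
      X.image fun x => R.rep (S.tgt x.1.1 x.1.2))) (by
    intro v hv
    simp only [Finset.mem_union, Finset.mem_image] at hv
    rcases hv with ⟨v, _, rfl⟩ | ⟨x, _, rfl⟩ | ⟨x, _, rfl⟩
    exacts [v.2.1, R.red_eq_iff.1 x.2.1, R.rep_rep _])
  have he : ∀ v : F.erase (S.base 1), ∃ e : G × (Fin n ⊕ Fin p),
      S.base e.1 ∈ F ∧ S.tgt e.1 e.2 ∈ F ∧
        ((v.1 = S.base e.1 ∧ R.lev (S.tgt e.1 e.2) < R.lev (S.base e.1)) ∨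
        (v.1 = S.tgt e.1 e.2 ∧ R.lev (S.base e.1) < R.lev (S.tgt e.1 e.2))) := by
    rintro ⟨v, hv⟩
    obtain ⟨hv1, hvF⟩ := Finset.mem_erase.1 hv
    obtain ⟨w, hw, ⟨g, t, ⟨rfl, rfl⟩ | ⟨rfl, rfl⟩⟩, hlt⟩ := hFc v hvF hv1
    · exact ⟨(g, t), hvF, hw, Or.inl ⟨rfl, hlt⟩⟩
    · exact ⟨(g, t), hw, hvF, Or.inr ⟨rfl, hlt⟩⟩
  choose e he using he
  refine ⟨F, Finset.univ.image e ∪ X.image (fun x => x.1), hF1, hFr, ?_, ?_, ?_⟩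
  · intro v hv
    exact hBF (by simp only [Finset.mem_union, Finset.mem_image]; exact Or.inl ⟨v, hv, rfl⟩)
  · intro x hx
    simp only [Finset.mem_union, Finset.mem_image] at hx
    rcases hx with ⟨v, -, rfl⟩ | ⟨x, hx, rfl⟩
    · obtain ⟨h1, h2, -⟩ := he v
      exact ⟨h1, by rwa [hFr _ h2]⟩
    · constructor
      · exact hBF (by simp only [Finset.mem_union, Finset.mem_image]
                      exact Or.inr (Or.inl ⟨x, hx, rfl⟩))
      · exact hBF (by simp only [Finset.mem_union, Finset.mem_image]
                      exact Or.inr (Or.inr ⟨x, hx, rfl⟩))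
  · have hinj : Function.Injective e := by
      intro v w hvw
      obtain ⟨-, -, h1⟩ := he v
      obtain ⟨-, -, h2⟩ := he w
      rw [hvw] at h1
      rcases h1 with ⟨h1, h1'⟩ | ⟨h1, h1'⟩ <;> rcases h2 with ⟨h2, h2'⟩ | ⟨h2, h2'⟩
      · exact Subtype.ext (h1.trans h2.symm)
      · omega
      · omega
      · exact Subtype.ext (h1.trans h2.symm)
    have hd : Disjoint (Finset.univ.image e) (X.image fun x => x.1) := by
      rw [Finset.disjoint_left]
      intro x hx hx'
      simp only [Finset.mem_image] at hx hx'
      obtain ⟨v, -, rfl⟩ := hx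
      obtain ⟨x, -, hx⟩ := hx'
      obtain ⟨-, h2, -⟩ := he v
      exact x.2.2 (by rw [hx]; exact hFr _ h2)
    rw [Finset.card_union_of_disjoint hd, Finset.card_image_of_injective _ hinj,
      Finset.card_image_of_injective _ Subtype.val_injective, Finset.card_univ,
      Fintype.card_coe, Finset.card_erase_of_mem hF1]
    omega

lemma eq_of_smul_base {h g g' : G} (hh : h ∈ H) (hg : R.rep (S.base g) = S.base g)
    (hg' : R.rep (S.base g') = S.base g') (he : h • S.base g = S.base g') : h = 1 ∧ g = g' := by
  have h1 := R.rep_smul h hh (S.base g)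
  rw [he, hg, hg'] at h1
  exact ⟨S.eq_one_of_smul_base (he.trans h1), (Sum.inl_injective h1).symm⟩

lemma tgt_ne_base {h g g' : G} {t t' : Fin n ⊕ Fin p} (h1 : h • S.base g = S.tgt g' t')
    (h2 : h • S.tgt g t = S.base g') : False := by
  rcases t' with i | j'
  · rw [S.smul_base] at h1
    exact Sum.inl_ne_inr h1
  · rcases t with i | j
    · rw [S.smul_tgt] at h2
      exact Sum.inl_ne_inr h2.symm
    · have h1' : h * g = g' * S.a j' := Sum.inl_injective h1
      have h2' : h * (g * S.a j) = g' := Sum.inl_injective h2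
      rw [← mul_assoc, h1', mul_assoc] at h2'
      exact S.a_mul_a_ne_one _ _ (by simpa using h2')

open Classical in
/-- A finite subtree of representatives with the given exits, as a set of pairwise inequivalent
darts. -/
lemma exists_window (I : Finset R.SingIdx) (X : Finset R.ExitIdx) :
    ∃ (F : Finset S.V) (D : Finset (S.V × S.V)), S.base 1 ∈ F ∧
      (∀ v ∈ F, R.rep v = v) ∧ (∀ v ∈ I, v.1 ∈ F) ∧
      (∀ d ∈ D, S.tree.Adj d.1 d.2 ∧ R.rep d.1 ∈ F ∧ R.rep d.2 ∈ F) ∧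
      2 * F.card + 2 * X.card ≤ D.card + 2 ∧
      ∀ d ∈ D, ∀ d' ∈ D, ∀ h ∈ H, h • d = d' → d = d' := by
  obtain ⟨F, E, h1, hFr, hI, hE, hcard⟩ := R.exists_edges I X
  have hbr : ∀ e ∈ E, R.rep (S.base e.1) = S.base e.1 := fun e he => hFr _ (hE e he).1
  refine ⟨F, E.image (fun e => (S.base e.1, S.tgt e.1 e.2)) ∪
    E.image (fun e => (S.tgt e.1 e.2, S.base e.1)), h1, hFr, hI, ?_, ?_, ?_⟩
  · intro d hd
    simp only [Finset.mem_union, Finset.mem_image] at hd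
    rcases hd with ⟨e, he, rfl⟩ | ⟨e, he, rfl⟩
    · exact ⟨S.adj_tgt _ _, by rw [hbr e he]; exact (hE e he).1, (hE e he).2⟩
    · exact ⟨(S.adj_tgt _ _).symm, (hE e he).2, by rw [hbr e he]; exact (hE e he).1⟩
  · rw [Finset.card_union_of_disjoint, Finset.card_image_of_injOn, Finset.card_image_of_injOn]
    · omega
    · rintro ⟨g, t⟩ - ⟨g', t'⟩ - h
      simp only [Prod.mk.injEq] at h
      obtain rfl : g = g' := Sum.inl_injective h.2
      rw [S.tgt_injective h.1]
    · rintro ⟨g, t⟩ - ⟨g', t'⟩ - h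
      simp only [Prod.mk.injEq] at h
      obtain rfl : g = g' := Sum.inl_injective h.1
      rw [S.tgt_injective h.2]
    · rw [Finset.disjoint_left]
      intro d hd hd'
      simp only [Finset.mem_image] at hd hd'
      obtain ⟨e, he, rfl⟩ := hd
      obtain ⟨e', he', h⟩ := hd'
      simp only [Prod.mk.injEq] at h
      refine tgt_ne_base (S := S) (h := 1) (g := e.1) (g' := e'.1) (t := e.2) (t' := e'.2) ?_ ?_
      · rw [one_smul, h.1]
      · rw [one_smul, h.2]
  · intro d hd d' hd' h hh hdd
    simp only [Finset.mem_union, Finset.mem_image] at hd hd'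
    rcases hd with ⟨e, he, rfl⟩ | ⟨e, he, rfl⟩ <;>
      rcases hd' with ⟨e', he', rfl⟩ | ⟨e', he', rfl⟩ <;>
      simp only [Prod.smul_mk, Prod.mk.injEq] at hdd ⊢
    · obtain ⟨rfl, h3⟩ := R.eq_of_smul_base hh (hbr e he) (hbr e' he') hdd.1
      simpa using hdd
    · exact (tgt_ne_base hdd.1 hdd.2).elim
    · exact (tgt_ne_base hdd.2 hdd.1).elim
    · obtain ⟨rfl, h3⟩ := R.eq_of_smul_base hh (hbr e he) (hbr e' he') hdd.2
      simpa using hdd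

end Transversal

end StarSplit

namespace StarSplit

variable {G : Type} [Group G] {n p : ℕ}

/-- An extension of an endomorphism to the vertices of the Bass-Serre tree. -/
structure Ext (S : StarSplit G n p) (φ : Monoid.End G) where
  f : S.V → S.V
  f_smul : ∀ g v, f (g • v) = φ g • f v
  f_base : f (S.base 1) = S.base 1

/-- The iterate of an extension. -/
def Ext.pow {S : StarSplit G n p} {φ : Monoid.End G} (E : S.Ext φ) (k : ℕ) : S.Ext (φ ^ k) where
  f := E.f^[k]
  f_smul := by
    induction k with
    | zero => simp
    | succ k ih =>
      intro g v
      rw [Function.iterate_succ_apply', ih, E.f_smul, Function.iterate_succ_apply', pow_succ']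
      rfl
  f_base := Function.iterate_fixed E.f_base k

lemma pow_injective {φ : Monoid.End G} (hφ : Function.Injective φ) (k : ℕ) :
    Function.Injective (φ ^ k : Monoid.End G) := by
  rw [Monoid.End.coe_pow]
  exact hφ.iterate k

/-- Sequences of vertices modulo a nonprincipal ultrafilter, with the group acting in the `e`-th
coordinate through the `e!`-th iterate of the endomorphism. -/
def Lim (S : StarSplit G n p) (_ : Monoid.End G) : Type :=
  Filter.Germ (Filter.hyperfilter ℕ : Filter ℕ) S.V

namespace Lim

variable {S : StarSplit G n p} {φ : Monoid.End G}

/-- The class of a sequence. -/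
noncomputable def mk (φ : Monoid.End G) (a : ℕ → S.V) : Lim S φ := (a : Filter.Germ _ S.V)

lemma mk_eq {a b : ℕ → S.V} : mk φ a = mk φ b ↔ ∀ᶠ e in Filter.hyperfilter ℕ, a e = b e :=
  Filter.Germ.coe_eq

lemma exists_mk (x : Lim S φ) : ∃ a, x = mk φ a := by
  obtain ⟨a, rfl⟩ := Quotient.exists_rep x
  exact ⟨a, rfl⟩

noncomputable instance : MulAction G (Lim S φ) :=
  letI : MulAction (Filter.Germ (Filter.hyperfilter ℕ : Filter ℕ) G) (Lim S φ) :=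
    inferInstanceAs (MulAction (Filter.Germ (Filter.hyperfilter ℕ : Filter ℕ) G)
      (Filter.Germ (Filter.hyperfilter ℕ : Filter ℕ) S.V))
  MulAction.compHom (Lim S φ) ((Filter.Germ.coeMulHom (Filter.hyperfilter ℕ : Filter ℕ)).comp
    (MonoidHom.pi fun e : ℕ => ((φ ^ e.factorial : Monoid.End G) : G →* G)))

lemma smul_mk (g : G) (a : ℕ → S.V) :
    g • mk φ a = mk φ fun e => (φ ^ e.factorial : Monoid.End G) g • a e := rfl

lemma smul_mk_eq {g : G} {a b : ℕ → S.V} : g • mk φ a = mk φ b ↔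
    ∀ᶠ e : ℕ in Filter.hyperfilter ℕ, (φ ^ e.factorial : Monoid.End G) g • a e = b e := mk_eq

/-- The first-step function on the limit space. -/
noncomputable def nxt : Lim S φ → Lim S φ → Lim S φ := Filter.Germ.map₂ S.tree.nxt

lemma nxt_mk (a b : ℕ → S.V) : nxt (mk φ a) (mk φ b) = mk φ fun e => S.tree.nxt (a e) (b e) := rfl

lemma nxtBtw_mk {a b c : ℕ → S.V} : NxtBtw nxt (mk φ a) (mk φ b) (mk φ c) ↔
    ∀ᶠ e in Filter.hyperfilter ℕ, NxtBtw S.tree.nxt (a e) (b e) (c e) := by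
  simp only [NxtBtw, ne_eq, nxt_mk, mk_eq, Ultrafilter.eventually_or, Ultrafilter.eventually_not]

/-- The limit space is tree-like. -/
noncomputable def space (S : StarSplit G n p) (hφ : Function.Injective φ) :
    NxtSpace G (Lim S φ) where
  nxt := nxt
  smul_nxt g x y := by
    obtain ⟨a, rfl⟩ := exists_mk x
    obtain ⟨b, rfl⟩ := exists_mk y
    simp only [smul_mk, nxt_mk, S.nxt_smul]
  turn x y z h1 h2 := by
    obtain ⟨a, rfl⟩ := exists_mk x
    obtain ⟨b, rfl⟩ := exists_mk y
    obtain ⟨c, rfl⟩ := exists_mk z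
    simp only [nxt_mk, ne_eq, mk_eq, ← Ultrafilter.eventually_not] at h1 h2 ⊢
    filter_upwards [h1, h2] with e h1 h2
    exact S.tree_isTree.nxt_eq_of_nxt_ne h1 h2
  median x y z := by
    obtain ⟨a, rfl⟩ := exists_mk x
    obtain ⟨b, rfl⟩ := exists_mk y
    obtain ⟨c, rfl⟩ := exists_mk z
    choose m h1 h2 h3 using fun e => S.tree_isTree.exists_median (a e) (b e) (c e)
    exact ⟨mk φ m, nxtBtw_mk.2 (.of_forall h1), nxtBtw_mk.2 (.of_forall h2),
      nxtBtw_mk.2 (.of_forall h3)⟩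
  free g y z h1 h2 h3 := by
    obtain ⟨b, rfl⟩ := exists_mk y
    obtain ⟨c, rfl⟩ := exists_mk z
    simp only [nxt_mk, ne_eq, mk_eq, ← Ultrafilter.eventually_not, smul_mk] at h1 h2 h3
    obtain ⟨e, h1, h2, h3⟩ := (h1.and (h2.and h3)).exists
    exact pow_injective hφ _ ((S.eq_one_of_nxt h1 h2 h3).trans (map_one _).symm)

end Lim

lemma pow_apply_of_dvd {φ : Monoid.End G} {d k : ℕ} {g : G}
    (h : (φ ^ d : Monoid.End G) g = g) (hd : d ∣ k) : (φ ^ k : Monoid.End G) g = g := by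
  obtain ⟨c, rfl⟩ := hd
  rw [pow_mul, Monoid.End.coe_pow]
  exact Function.iterate_fixed h c

/-- The elements with finite orbit under an endomorphism. -/
def periodicSubgroup (φ : Monoid.End G) : Subgroup G where
  carrier := {g | ∃ d > 0, (φ ^ d : Monoid.End G) g = g}
  one_mem' := ⟨1, one_pos, map_one _⟩
  mul_mem' := by
    rintro a b ⟨d, hd, ha⟩ ⟨d', hd', hb⟩
    refine ⟨d * d', mul_pos hd hd', ?_⟩
    rw [map_mul, pow_apply_of_dvd ha (dvd_mul_right _ _), pow_apply_of_dvd hb (dvd_mul_left _ _)]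
  inv_mem' := by
    rintro a ⟨d, hd, ha⟩
    exact ⟨d, hd, by rw [map_inv, ha]⟩

lemma eventually_ge_hyperfilter (d : ℕ) : ∀ᶠ e in Filter.hyperfilter ℕ, d ≤ e := by
  have h : ∀ᶠ e in (Filter.cofinite : Filter ℕ), d ≤ e := by
    rw [Nat.cofinite_eq_atTop]
    exact Filter.eventually_ge_atTop d
  exact Filter.hyperfilter_le_cofinite h

lemma eventually_pow_apply {φ : Monoid.End G} {g : G} (hg : g ∈ periodicSubgroup φ) :
    ∀ᶠ e : ℕ in Filter.hyperfilter ℕ, (φ ^ e.factorial : Monoid.End G) g = g := by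
  obtain ⟨d, hd, h⟩ := hg
  filter_upwards [eventually_ge_hyperfilter d] with e he
  exact pow_apply_of_dvd h (Nat.dvd_factorial hd he)

lemma mem_periodic_of_pow_eq {φ : Monoid.End G} (hφ : Function.Injective φ) {g : G} {a b : ℕ}
    (hab : a < b) (h : (φ ^ a : Monoid.End G) g = (φ ^ b : Monoid.End G) g) :
    g ∈ periodicSubgroup φ := by
  obtain ⟨c, rfl⟩ := Nat.exists_eq_add_of_lt hab
  refine ⟨c + 1, by omega, pow_injective hφ a ?_⟩
  rw [h, add_assoc, pow_add φ a]
  rfl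

lemma Ext.fixed_of_smul {S : StarSplit G n p} {φ : Monoid.End G} (E : S.Ext φ) {h : G}
    (h1 : h ≠ 1) (hh : φ h = h) {v : S.V} (hv : h • v = v) : E.f v = v := by
  by_contra hne
  have := E.f_smul h v
  rw [hv, hh] at this
  exact h1 (S.eq_one_of_fix hne this.symm hv)

lemma exists_smul_star {S : StarSplit G n p} {h : G} (h1 : h ≠ 1)
    {v : S.V} (hv : h • v = v) :
    ∃ (g : G) (i : Fin n), v = g • S.star i 1 := by
  rcases v with g | ⟨i, c⟩
  · exact (h1 (S.eq_one_of_smul_base hv)).elim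
  · induction c using Quotient.inductionOn' with
    | h g =>
      refine ⟨g, i, ?_⟩
      rw [S.smul_star, mul_one]

/-- The periodic subgroup has Kurosh rank at most `n + p`. -/
theorem card_periodic_le {S : StarSplit G n p} {φ : Monoid.End G} (hφ : Function.Injective φ)
    (E : S.Ext φ) (R : S.Transversal (periodicSubgroup φ)) (I : Finset R.SingIdx)
    (X : Finset R.ExitIdx) : I.card + X.card ≤ n + p := by
  classical
  obtain ⟨F, D, hF1, hFr, hI, hD, hcard, hineq⟩ := R.exists_window I X
  let c : S.V → Lim S φ := fun v => Lim.mk φ fun _ => v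
  have hc : ∀ {v w}, c v = c w ↔ v = w := fun {v w} => by
    refine Lim.mk_eq.trans ?_
    simp
  have hsm : ∀ h ∈ periodicSubgroup φ, ∀ v, h • c v = c (h • v) := by
    intro h hh v
    refine Lim.smul_mk_eq.2 ?_
    filter_upwards [eventually_pow_apply hh] with e he
    rw [he]
  have key := S.card_directions_le (Lim.space S hφ)
    (o := fun i => Lim.mk φ fun e => (E.pow e.factorial).f (S.star i 1)) (fun i b hb => by
      rw [Lim.smul_mk]
      congr 1
      funext e
      rw [← (E.pow e.factorial).f_smul, S.smul_star, S.star_eq_iff.2]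
      simpa using hb)
    (U := (insert (S.base 1) (D.image Prod.fst ∪ D.image Prod.snd)).image c)
    (R := (F.filter fun v => S.stab (periodicSubgroup φ) v = ⊥).image c)
    (Θ := D.image fun d => (c d.1, c d.2))
    ⟨_, Finset.mem_image_of_mem _ (Finset.mem_insert_self _ _)⟩
    (by
      intro u hu
      obtain ⟨v, hv, rfl⟩ := Finset.mem_image.1 hu
      have hvF : R.rep v ∈ F := by
        simp only [Finset.mem_insert, Finset.mem_union, Finset.mem_image] at hv
        rcases hv with rfl | ⟨d, hd, rfl⟩ | ⟨d, hd, rfl⟩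
        · rwa [R.rep_base]
        · exact (hD d hd).2.1
        · exact (hD d hd).2.2
      have hcv : c v = R.mv v • c (R.rep v) := by rw [hsm _ (R.mv_mem v), R.mv_smul]
      by_cases hs : S.stab (periodicSubgroup φ) (R.rep v) = ⊥
      · exact Or.inr ⟨_, _, Finset.mem_image_of_mem _ (Finset.mem_filter.2 ⟨hvF, hs⟩), hcv⟩
      · left
        obtain ⟨h, hh, h1⟩ := (Subgroup.bot_or_exists_ne_one _).resolve_left hs
        obtain ⟨hh1, hh2⟩ := mem_stab.1 hh
        obtain ⟨g, i, hg⟩ := exists_smul_star h1 hh1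
        refine ⟨R.mv v * g, i, ?_⟩
        rw [mul_smul, hcv]
        congr 1
        refine (Lim.smul_mk_eq.2 ?_).symm
        filter_upwards [eventually_pow_apply hh2] with e he
        rw [← (E.pow e.factorial).f_smul, ← hg, (E.pow e.factorial).fixed_of_smul h1 he hh1])
    (by
      intro θ hθ
      obtain ⟨d, hd, rfl⟩ := Finset.mem_image.1 hθ
      have hadj := (hD d hd).1
      refine ⟨c d.1, Finset.mem_image_of_mem _ ?_, c d.2, Finset.mem_image_of_mem _ ?_,
        fun h => hadj.ne (hc.1 h), ?_⟩
      · exact Finset.mem_insert_of_mem (Finset.mem_union_left _ (Finset.mem_image_of_mem _ hd))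
      · exact Finset.mem_insert_of_mem (Finset.mem_union_right _ (Finset.mem_image_of_mem _ hd))
      · refine Prod.ext rfl ?_
        change c d.2 = Lim.mk φ fun _ => S.tree.nxt d.1 d.2
        rw [S.tree_isTree.nxt_of_adj hadj])
    (by
      intro θ hθ θ' hθ' g hg
      obtain ⟨d, hd, rfl⟩ := Finset.mem_image.1 hθ
      obtain ⟨d', hd', rfl⟩ := Finset.mem_image.1 hθ'
      simp only [Prod.smul_mk, Prod.mk.injEq] at hg
      have h1 := Lim.smul_mk_eq.1 hg.1
      have h2 := Lim.smul_mk_eq.1 hg.2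
      have h12 := h1.and h2
      obtain ⟨a, ⟨ha1, ha2⟩, ha⟩ := (h12.and (eventually_ge_hyperfilter 1)).exists
      obtain ⟨b, ⟨hb1, hb2⟩, hb⟩ := (h12.and (eventually_ge_hyperfilter (a + 1))).exists
      have hab : (φ ^ a.factorial : Monoid.End G) g = (φ ^ b.factorial : Monoid.End G) g := by
        rw [← inv_mul_eq_one]
        refine S.eq_one_of_adj (hD d hd).1 ?_ ?_
        · rw [mul_smul, hb1, ← ha1, inv_smul_smul]
        · rw [mul_smul, hb2, ← ha2, inv_smul_smul]
      have hg' := mem_periodic_of_pow_eq hφ (Nat.factorial_lt (by omega) |>.2 (by omega)) hab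
      obtain ⟨e, h12, he⟩ := (h12.and (eventually_pow_apply hg')).exists
      rw [he] at h12
      rw [hineq d hd d' hd' g hg' (Prod.ext h12.1 h12.2)])
  have hΘ : (D.image fun d => (c d.1, c d.2)).card = D.card := by
    refine Finset.card_image_of_injective _ fun d d' h => ?_
    simp only [Prod.mk.injEq, hc] at h
    exact Prod.ext h.1 h.2
  have hR : ((F.filter fun v => S.stab (periodicSubgroup φ) v = ⊥).image c).card + I.card ≤
      F.card := by
    rw [← Finset.card_filter_add_card_filter_not (s := F)
      (fun v => S.stab (periodicSubgroup φ) v = ⊥)]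
    refine add_le_add Finset.card_image_le ?_
    rw [← Finset.card_image_of_injective I Subtype.val_injective]
    refine Finset.card_le_card fun v hv => ?_
    obtain ⟨v, hvI, rfl⟩ := Finset.mem_image.1 hv
    exact Finset.mem_filter.2 ⟨hI v hvI, v.2.2⟩
  omega

end StarSplit

namespace FactorwiseEnd

variable {ι : Type} {M : ι → Type} [∀ i, Group (M i)] {β : ∀ i, M i →* M i}

/-- The letterwise action of a family of injective endomorphisms on reduced words. -/
def mapWord (hβ : ∀ i, Function.Injective (β i)) (w : CoprodI.Word M) : CoprodI.Word M where
  toList := w.toList.map fun l => ⟨l.1, β l.1 l.2⟩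
  ne_one := by
    intro l hl
    obtain ⟨l', hl', rfl⟩ := List.mem_map.1 hl
    exact fun h => w.ne_one _ hl' (hβ _ (h.trans (map_one _).symm))
  chain_ne := (List.isChain_map _).2 w.chain_ne

lemma fstIdx_mapWord (hβ : ∀ i, Function.Injective (β i)) (w : CoprodI.Word M) :
    (mapWord hβ w).fstIdx = w.fstIdx := by
  simp only [CoprodI.Word.fstIdx, mapWord, List.head?_map, Option.map_map]
  rfl

variable {α : CoprodI M →* CoprodI M}

lemma apply_prod (hβ : ∀ i, Function.Injective (β i))
    (hα : ∀ i (m : M i), α (CoprodI.of m) = CoprodI.of (β i m)) (w : CoprodI.Word M) :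
    α w.prod = (mapWord hβ w).prod := by
  simp only [CoprodI.Word.prod, map_list_prod, mapWord, List.map_map]
  congr 1
  exact List.map_congr_left fun l _ => hα _ _

lemma mem_closure_of_fixed (hβ : ∀ i, Function.Injective (β i))
    (hα : ∀ i (m : M i), α (CoprodI.of m) = CoprodI.of (β i m)) {w : CoprodI M} (hw : α w = w) :
    w ∈ Subgroup.closure {x | ∃ i m, β i m = m ∧ x = CoprodI.of (M := M) (i := i) m} := by
  classical
  obtain ⟨w, rfl⟩ := CoprodI.Word.equiv.symm.surjective w
  change α w.prod = w.prod at hw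
  change w.prod ∈ _
  rw [apply_prod hβ hα] at hw
  have h := congrArg CoprodI.Word.toList (CoprodI.Word.equiv.symm.injective hw)
  have h' : w.toList.map (fun l => (⟨l.1, β l.1 l.2⟩ : Σ i, M i)) = w.toList.map id := by
    rw [List.map_id]; exact h
  rw [List.map_inj_left] at h'
  refine Subgroup.list_prod_mem _ fun x hx => ?_
  obtain ⟨⟨i, m⟩, hl, rfl⟩ := List.mem_map.1 hx
  refine Subgroup.subset_closure ⟨i, m, ?_, rfl⟩
  simpa using h' _ hl

lemma exists_fixed_mul (hβ : ∀ i, Function.Injective (β i))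
    (hα : ∀ i (m : M i), α (CoprodI.of m) = CoprodI.of (β i m)) {p : CoprodI M}
    {i : ι} {b : M i} (hp : α p = p * CoprodI.of b) :
    ∃ c : M i, α (p * CoprodI.of c) = p * CoprodI.of c := by
  classical
  obtain ⟨w, hw⟩ := CoprodI.Word.equiv.symm.surjective p⁻¹
  change w.prod = p⁻¹ at hw
  obtain ⟨⟨m, t, ht⟩, rfl⟩ := (CoprodI.Word.equivPair i).symm.surjective w
  rw [CoprodI.Word.equivPair_symm, CoprodI.Word.prod_rcons] at hw
  simp only at hw
  have hp' : p = t.prod⁻¹ * CoprodI.of m⁻¹ := by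
    rw [← inv_inj, ← hw]; simp
  have h1 : α t.prod = CoprodI.of (β i m⁻¹ * b⁻¹ * m) * t.prod := by
    rw [hp', map_mul, map_inv, hα] at hp
    have : (α t.prod)⁻¹ =
        (t.prod⁻¹ * CoprodI.of m⁻¹ * CoprodI.of b) * (CoprodI.of (β i m⁻¹))⁻¹ := by
      rw [← hp]; group
    rw [← inv_inj, this]
    simp [mul_assoc]
  rw [apply_prod hβ hα] at h1
  have h2 : (CoprodI.Word.rcons (M := M) ⟨1, mapWord hβ t, by rwa [fstIdx_mapWord]⟩).prod =
      (CoprodI.Word.rcons ⟨β i m⁻¹ * b⁻¹ * m, t, ht⟩).prod := by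
    rw [CoprodI.Word.prod_rcons, CoprodI.Word.prod_rcons]
    simpa using h1
  have h3 := CoprodI.Word.rcons_inj (CoprodI.Word.equiv.symm.injective h2)
  have h4 : mapWord hβ t = t := congrArg CoprodI.Word.Pair.tail h3
  refine ⟨m, ?_⟩
  have h5 : p * CoprodI.of m = t.prod⁻¹ := by rw [hp']; simp
  rw [h5, map_inv, apply_prod hβ hα, h4]

end FactorwiseEnd

namespace SumProd

variable {α β : Type} {A : α → Type} {B : β → Type} [∀ a, Group (A a)] [∀ b, Group (B b)]

/-- A family of endomorphisms of the left factors, extended by the identity. -/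
def extendId (σ : ∀ a, A a →* A a) : ∀ x : α ⊕ β, Sum.elim A B x →* Sum.elim A B x
  | .inl a => σ a
  | .inr b => MonoidHom.id (B b)

lemma extendId_injective {σ : ∀ a, A a →* A a} (hσ : ∀ a, Function.Injective (σ a)) (x : α ⊕ β) :
    Function.Injective (extendId (B := B) σ x) := by
  rcases x with a | b
  · exact hσ a
  · exact fun _ _ h => h

variable {σ : ∀ a, A a →* A a} {θ : CoprodI (Sum.elim A B) →* CoprodI (Sum.elim A B)}

lemma apply_of (h1 : ∀ a x, θ (inlHom A B a x) = inlHom A B a (σ a x))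
    (h2 : ∀ b y, θ (inrHom A B b y) = inrHom A B b y) (i : α ⊕ β) (m : Sum.elim A B i) :
    θ (CoprodI.of m) = CoprodI.of (extendId σ i m) := by
  rcases i with a | b
  · exact h1 a m
  · exact h2 b m

lemma induction_on_fixed (hσ : ∀ a, Function.Injective (σ a))
    (h1 : ∀ a x, θ (inlHom A B a x) = inlHom A B a (σ a x))
    (h2 : ∀ b y, θ (inrHom A B b y) = inrHom A B b y) {K : Subgroup (CoprodI (Sum.elim A B))}
    (inl : ∀ a x, σ a x = x → inlHom A B a x ∈ K) (inr : ∀ b y, inrHom A B b y ∈ K)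
    {w : CoprodI (Sum.elim A B)} (hw : θ w = w) : w ∈ K := by
  have := FactorwiseEnd.mem_closure_of_fixed (extendId_injective hσ) (apply_of h1 h2) hw
  refine (Subgroup.closure_le K).2 ?_ this
  rintro _ ⟨a | b, m, hm, rfl⟩
  · exact inl a m hm
  · exact inr b m

lemma exists_fixed_mul (hσ : ∀ a, Function.Injective (σ a))
    (h1 : ∀ a x, θ (inlHom A B a x) = inlHom A B a (σ a x))
    (h2 : ∀ b y, θ (inrHom A B b y) = inrHom A B b y) {w : CoprodI (Sum.elim A B)} {a : α}
    {x : A a} (hw : θ w = w * inlHom A B a x) :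
    ∃ y : A a, θ (w * inlHom A B a y) = w * inlHom A B a y :=
  FactorwiseEnd.exists_fixed_mul (extendId_injective hσ) (apply_of h1 h2) (i := .inl a) (b := x) hw

end SumProd

namespace StarSplit

variable {G : Type} [Group G] {n p : ℕ}

/-- The vertices are controlled by at most `N` values of equivariant functions. -/
def SpanLE (S : StarSplit G n p) (H : Subgroup G) (N : ℕ) : Prop :=
  ∃ B : Finset S.V, B.card ≤ N ∧ ∀ (q : ℕ) [Fact q.Prime] (u : S.V → ZMod q),
    (∀ h ∈ H, ∀ v w, u (h • v) - u (h • w) = u v - u w) → (∀ b ∈ B, u b = u (S.base 1)) →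
    ∀ w, (S.stab H w ≠ ⊥ ∨ ∃ h ∈ H, w = h • S.base 1) → u w = u (S.base 1)

/-- Every Kurosh decomposition of the subgroup has at most `N` factors. -/
def KuroshLE (S : StarSplit G n p) (H : Subgroup G) (N : ℕ) : Prop :=
  ∀ (R : S.Transversal H) (I : Finset R.SingIdx) (X : Finset R.ExitIdx), I.card + X.card ≤ N

lemma SpanLE.of_generators {S : StarSplit G n p} {H : Subgroup G} {N : ℕ} (I : Finset S.V)
    (X : Finset G) (hN : I.card + X.card ≤ N)
    (hgen : ∀ K : Subgroup G, (∀ x ∈ X, x ∈ K) → (∀ h ∈ H, ∀ v : S.V, h • v = v → h ∈ K) → H ≤ K)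
    (hX : ∀ x ∈ X, x ∈ H)
    (hI : ∀ w, S.stab H w ≠ ⊥ → ∃ h ∈ H, ∃ v ∈ I, w = h • v) : S.SpanLE H N := by
  classical
  refine ⟨I ∪ X.image (· • S.base 1), (Finset.card_union_le _ _).trans
    ((Nat.add_le_add_left Finset.card_image_le _).trans hN), ?_⟩
  intro q _ u hu hB w hw
  let K : Subgroup G :=
    { carrier := {h | h ∈ H ∧ u (h • S.base 1) = u (S.base 1)}
      one_mem' := ⟨H.one_mem, by rw [one_smul]⟩
      mul_mem' := fun {a b} ha hb => ⟨H.mul_mem ha.1 hb.1, by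
        have := hu a ha.1 (b • S.base 1) (S.base 1)
        rw [hb.2, sub_self, sub_eq_zero, ha.2, ← mul_smul] at this
        exact this⟩
      inv_mem' := fun {a} ha => ⟨H.inv_mem ha.1, by
        have := hu a ha.1 (a⁻¹ • S.base 1) (S.base 1)
        rw [smul_inv_smul, ha.2, sub_self] at this
        exact sub_eq_zero.1 this.symm⟩ }
  have hK : H ≤ K := by
    refine hgen K (fun x hx => ⟨hX x hx, hB _ (Finset.mem_union_right _
      (Finset.mem_image_of_mem _ hx))⟩) fun h hh v hv => ⟨hh, ?_⟩
    have := hu h hh (S.base 1) v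
    rw [hv] at this
    exact sub_left_injective this
  rcases hw with hw | ⟨h, hh, rfl⟩
  · obtain ⟨h, hh, v, hv, rfl⟩ := hI w hw
    have := hu h hh v (S.base 1)
    rw [hB v (Finset.mem_union_left _ hv), sub_self, (hK hh).2, sub_eq_zero] at this
    exact this
  · exact (hK hh).2

lemma finite_of_card_le {α : Type} {N : ℕ} (h : ∀ s : Finset α, s.card ≤ N) : Finite α := by
  by_contra hf
  rw [not_finite_iff_infinite] at hf
  obtain ⟨s, hs⟩ := Infinite.exists_subset_card_eq α (N + 1)
  have := h s
  omega

lemma KuroshLE.finite {S : StarSplit G n p} {H : Subgroup G} {N : ℕ} (h : S.KuroshLE H N)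
    (R : S.Transversal H) : Finite R.SingIdx ∧ Finite R.ExitIdx :=
  ⟨finite_of_card_le (N := N) fun I => by simpa using h R I ∅,
    finite_of_card_le (N := N) fun X => by simpa using h R ∅ X⟩

lemma stab_conj {S : StarSplit G n p} {H : Subgroup G} {h : G} (hh : h ∈ H) {v : S.V}
    (hv : S.stab H (h • v) ≠ ⊥) : S.stab H v ≠ ⊥ := by
  obtain ⟨x, hx, h1⟩ := (Subgroup.bot_or_exists_ne_one _).resolve_left hv
  obtain ⟨hx1, hx2⟩ := mem_stab.1 hx
  refine fun hb => h1 ?_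
  have : h⁻¹ * x * h ∈ S.stab H v := mem_stab.2
    ⟨by rw [mul_smul, mul_smul, hx1, inv_smul_smul], H.mul_mem (H.mul_mem (H.inv_mem hh) hx2) hh⟩
  rw [hb, Subgroup.mem_bot, mul_assoc, inv_mul_eq_one, right_eq_mul] at this
  exact this

lemma KuroshLE.spanLE {S : StarSplit G n p} {H : Subgroup G} {N : ℕ} (h : S.KuroshLE H N) :
    S.SpanLE H N := by
  classical
  obtain ⟨R⟩ := S.exists_transversal H
  obtain ⟨_, _⟩ := h.finite R
  have := Fintype.ofFinite R.SingIdx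
  have := Fintype.ofFinite R.ExitIdx
  refine SpanLE.of_generators (Finset.univ.image fun v : R.SingIdx => v.1)
    (Finset.univ.image R.exitElt)
    ((Nat.add_le_add Finset.card_image_le Finset.card_image_le).trans (h R _ _))
    (fun K hX hK x hx => ?_) ?_ fun w hw => ?_
  · refine R.mem_induction (Q := (· ∈ K)) K.one_mem (fun _ _ _ _ => K.mul_mem)
      (fun _ _ => K.inv_mem) (fun v x hx => ?_) (fun x => ?_) hx
    · obtain ⟨h1, h2⟩ := mem_stab.1 hx
      exact hK x h2 v.1 h1
    · exact hX _ (Finset.mem_image_of_mem _ (Finset.mem_univ x))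
  · intro x hx
    obtain ⟨y, -, rfl⟩ := Finset.mem_image.1 hx
    exact R.mv_mem _
  · refine ⟨R.mv w, R.mv_mem w, R.rep w, ?_, (R.mv_smul w).symm⟩
    rw [← R.mv_smul w] at hw
    exact Finset.mem_image.2 ⟨⟨R.rep w, R.rep_rep w, stab_conj (R.mv_mem w) hw⟩,
      Finset.mem_univ _, rfl⟩

end StarSplit

namespace StarSplit

variable {G : Type} [Group G] {n p : ℕ}

lemma exists_common {α : Type} [Finite α] {Q : α → ℕ → Prop}
    (h : ∀ a, ∃ d > 0, ∀ k, d ∣ k → Q a k) : ∃ d > 0, ∀ a, Q a d := by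
  classical
  have := Fintype.ofFinite α
  choose d hd hQ using h
  exact ⟨∏ a, d a, Finset.prod_pos fun a _ => hd a, fun a =>
    hQ a _ (Finset.dvd_prod_of_mem d (Finset.mem_univ a))⟩

lemma pow_mem_periodic {φ : Monoid.End G} (k : ℕ) {g : G} (hg : g ∈ periodicSubgroup φ) :
    (φ ^ k : Monoid.End G) g ∈ periodicSubgroup φ := by
  obtain ⟨d, hd, h⟩ := hg
  refine ⟨d, hd, ?_⟩
  change (φ ^ d * φ ^ k : Monoid.End G) g = _
  rw [← pow_add, add_comm, pow_add]
  exact congrArg _ h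

/-- Some iterate of an extendable monomorphism has a fixed subgroup of small rank. -/
lemma exists_spanLE_pow {S : StarSplit G n p} {φ : Monoid.End G} (hφ : Function.Injective φ)
    (E : S.Ext φ) : ∃ k ≥ 2, S.SpanLE (fixedSubgroup (φ ^ k : Monoid.End G)) (n + p) := by
  classical
  have hK : S.KuroshLE (periodicSubgroup φ) (n + p) := fun R => card_periodic_le hφ E R
  obtain ⟨R⟩ := S.exists_transversal (periodicSubgroup φ)
  obtain ⟨_, _⟩ := hK.finite R
  have := Fintype.ofFinite R.SingIdx
  have := Fintype.ofFinite R.ExitIdx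
  obtain ⟨k, hk, hs⟩ := exists_common (α := R.SingIdx ⊕ (R.ExitIdx ⊕ Unit))
    (Q := Sum.elim (fun v k => (E.pow k).f v.1 = v.1) (Sum.elim
      (fun x k => (φ ^ k : Monoid.End G) (R.exitElt x) = R.exitElt x) fun _ k => k = 0 ∨ 2 ≤ k))
    (by
      rintro (v | x | _)
      · obtain ⟨h, hh, h1⟩ := (Subgroup.bot_or_exists_ne_one _).resolve_left v.2.2
        obtain ⟨hh1, d, hd, hh2⟩ := mem_stab.1 hh
        exact ⟨d, hd, fun k hk => (E.pow k).fixed_of_smul h1 (pow_apply_of_dvd hh2 hk) hh1⟩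
      · obtain ⟨d, hd, hx⟩ : R.exitElt x ∈ periodicSubgroup φ := R.mv_mem _
        exact ⟨d, hd, fun k hk => pow_apply_of_dvd hx hk⟩
      · exact ⟨2, two_pos, fun k hk => by
          rcases Nat.eq_zero_or_pos k with h | h
          · exact Or.inl h
          · exact Or.inr (Nat.le_of_dvd h hk)⟩)
  have hv : ∀ v : R.SingIdx, (E.pow k).f v.1 = v.1 := fun v => hs (.inl v)
  have hx : ∀ x : R.ExitIdx, (φ ^ k : Monoid.End G) (R.exitElt x) = R.exitElt x :=
    fun x => hs (.inr (.inl x))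
  have hk2 : k = 0 ∨ 2 ≤ k := hs (.inr (.inr ()))
  refine ⟨k, by omega, ?_⟩
  obtain ⟨ψ, hψ⟩ : ∃ ψ : Monoid.End G, ψ = φ ^ k := ⟨_, rfl⟩
  have hinj : Function.Injective ψ := hψ ▸ pow_injective hφ k
  obtain ⟨E', hE'⟩ : ∃ E' : S.Ext ψ, ∀ v, E'.f v = (E.pow k).f v := by
    subst hψ
    exact ⟨_, fun _ => rfl⟩
  have hψP : ∀ g ∈ periodicSubgroup φ, ψ g ∈ periodicSubgroup φ := fun g hg =>
    hψ ▸ pow_mem_periodic k hg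
  have hPψ : ∀ g, ψ g = g → g ∈ periodicSubgroup φ := fun g hg => ⟨k, hk, hψ ▸ hg⟩
  simp only [← hE'] at hv
  simp only [← hψ] at hx ⊢
  let σ : ∀ v : R.SingIdx, S.stab (periodicSubgroup φ) v.1 →* S.stab (periodicSubgroup φ) v.1 :=
    fun v => (ψ.comp (S.stab (periodicSubgroup φ) v.1).subtype).codRestrict _ fun b =>
      mem_stab.2 ⟨by
        have := E'.f_smul b v.1
        rw [(mem_stab.1 b.2).1, hv] at this
        exact this.symm, hψP _ (mem_stab.1 b.2).2⟩
  have hσ : ∀ v, Function.Injective (σ v) := fun v a b h =>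
    Subtype.ext (hinj (congrArg Subtype.val h))
  let θ : R.Prod →* R.Prod := SumProd.liftHom
    (fun v => (SumProd.inlHom (fun v : R.SingIdx => ↥(S.stab (periodicSubgroup φ) v.1))
      (fun _ : R.ExitIdx => Multiplicative ℤ) v).comp (σ v)) (fun x => SumProd.inrHom (fun v : R.SingIdx =>
      ↥(S.stab (periodicSubgroup φ) v.1)) (fun _ : R.ExitIdx => Multiplicative ℤ) x)
  have hθ1 : ∀ v b, θ (SumProd.inlHom _ _ v b) = SumProd.inlHom _ _ v (σ v b) := fun v b =>
    SumProd.liftHom_inl ..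
  have hθ2 : ∀ x z, θ (SumProd.inrHom _ _ x z) = SumProd.inrHom _ _ x z := fun x z =>
    SumProd.liftHom_inr ..
  have htoG : ∀ w, R.toG (θ w) = ψ (R.toG w) := by
    intro w
    induction w using SumProd.induction_on with
    | one => simp
    | mul x y hx hy => rw [map_mul, map_mul, map_mul, map_mul, hx, hy]
    | inl v b =>
      rw [hθ1, Transversal.toG, SumProd.liftHom_inl, SumProd.liftHom_inl]
      rfl
    | inr x z =>
      rw [hθ2, Transversal.toG, SumProd.liftHom_inr]
      change R.exitElt x ^ z.toAdd = ψ (R.exitElt x ^ z.toAdd)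
      rw [map_zpow, hx]
  have hθ : ∀ w, θ w = w ↔ ψ (R.toG w) = R.toG w := fun w => by
    rw [← htoG]
    refine ⟨fun h => by rw [h], fun h => ?_⟩
    rw [← R.fold_toG (θ w), h, R.fold_toG]
  refine SpanLE.of_generators (Finset.univ.image fun v : R.SingIdx => v.1)
    (Finset.univ.image R.exitElt)
    ((Nat.add_le_add Finset.card_image_le Finset.card_image_le).trans (hK R _ _))
    (fun K hXK hK' h hh => ?_) ?_ fun w hw => ?_
  · have hmem : R.fold h ∈ K.comap R.toG := by
      refine SumProd.induction_on_fixed hσ hθ1 hθ2 (fun v b hb => ?_) (fun x z => ?_) ?_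
      · rw [Subgroup.mem_comap, Transversal.toG, SumProd.liftHom_inl]
        exact hK' _ (congrArg Subtype.val hb) v.1 (mem_stab.1 b.2).1
      · rw [Subgroup.mem_comap, Transversal.toG, SumProd.liftHom_inr]
        exact K.zpow_mem (hXK _ (Finset.mem_image_of_mem _ (Finset.mem_univ x))) _
      · rw [hθ, R.toG_fold, R.coc_of_mem (hPψ h hh)]
        exact hh
    rwa [Subgroup.mem_comap, R.toG_fold, R.coc_of_mem (hPψ h hh)] at hmem
  · intro x hx'
    obtain ⟨y, -, rfl⟩ := Finset.mem_image.1 hx'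
    exact hx y
  · obtain ⟨h, hh, h1⟩ := (Subgroup.bot_or_exists_ne_one _).resolve_left hw
    obtain ⟨hh1, hh2⟩ := mem_stab.1 hh
    have hfw : E'.f w = w := E'.fixed_of_smul h1 hh2 hh1
    have hwb : S.stab (periodicSubgroup φ) w ≠ ⊥ := fun hb => h1 (by
      have : h ∈ S.stab (periodicSubgroup φ) w := mem_stab.2 ⟨hh1, hPψ h hh2⟩
      rwa [hb, Subgroup.mem_bot] at this)
    rw [← R.mv_smul w] at hwb
    let v : R.SingIdx := ⟨R.rep w, R.rep_rep w, stab_conj (R.mv_mem w) hwb⟩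
    have hb : (R.mv w)⁻¹ * ψ (R.mv w) ∈ S.stab (periodicSubgroup φ) v.1 := by
      refine mem_stab.2 ⟨?_, Subgroup.mul_mem _ (Subgroup.inv_mem _ (R.mv_mem w))
        (hψP _ (R.mv_mem w))⟩
      rw [mul_smul, inv_smul_eq_iff]
      nth_rw 1 [← hv v]
      rw [← E'.f_smul, R.mv_smul, hfw]
    obtain ⟨c, hc⟩ := SumProd.exists_fixed_mul hσ hθ1 hθ2 (w := R.fold (R.mv w)) (a := v)
      (x := ⟨_, hb⟩) (by
        rw [← R.fold_toG (θ _), htoG, R.toG_fold, R.coc_of_mem (R.mv_mem w),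
          ← R.fold_toG (_ * _)]
        congr 1
        rw [map_mul, R.toG_fold, R.coc_of_mem (R.mv_mem w), Transversal.toG, SumProd.liftHom_inl]
        simp)
    rw [hθ, map_mul, R.toG_fold, R.coc_of_mem (R.mv_mem w), Transversal.toG,
      SumProd.liftHom_inl] at hc
    refine ⟨_, hc, v.1, Finset.mem_image_of_mem _ (Finset.mem_univ v), ?_⟩
    rw [mul_smul]
    change w = R.mv w • (c : G) • v.1
    rw [(mem_stab.1 c.2).1]
    exact (R.mv_smul w).symm

end StarSplit

/-- A sum invariant under a map of prime order `q` is determined modulo `q` by the fixed points. -/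
lemma sum_eq_sum_fixed {α : Type} {q : ℕ} [Fact q.Prime] (T : Finset α) (σ : α → α)
    [DecidablePred fun a => σ a = a]
    (hσ : ∀ a ∈ T, σ a ∈ T) (hq : ∀ a ∈ T, σ^[q] a = a) (t : α → ZMod q)
    (ht : ∀ a ∈ T, t (σ a) = t a) : ∑ a ∈ T, t a = ∑ a ∈ T with σ a = a, t a := by
  classical
  have key : ∀ c : ZMod q, ((T.filter fun a => t a = c).card : ZMod q) =
      (((T.filter fun a => σ a = a).filter fun a => t a = c).card : ZMod q) := by
    intro c
    have hmem : ∀ a : T.filter fun a => t a = c, σ a ∈ T.filter fun a => t a = c := fun a => by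
      obtain ⟨h1, h2⟩ := Finset.mem_filter.1 a.2
      exact Finset.mem_filter.2 ⟨hσ _ h1, (ht _ h1).trans h2⟩
    let f : Function.End (T.filter fun a => t a = c) := fun a => ⟨σ a, hmem a⟩
    have hit : ∀ (m : ℕ) a, ((f ^ m : Function.End _) a : α) = σ^[m] a := by
      intro m
      induction m with
      | zero => intro a; rfl
      | succ m ih =>
        intro a
        rw [pow_succ, Function.iterate_succ_apply]
        exact ih (f a)
    have hf : f ^ q ^ 1 = 1 := by
      funext a
      refine Subtype.ext ?_
      rw [pow_one, hit]
      exact hq _ (Finset.mem_filter.1 a.2).1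
    have h := Equiv.Perm.card_fixedPoints_modEq hf
    rw [← ZMod.natCast_eq_natCast_iff, Fintype.card_coe] at h
    rw [h, ← Fintype.card_coe]
    congr 1
    refine Fintype.card_congr ⟨fun a => ⟨a.1.1, ?_⟩, fun a => ⟨⟨a.1, ?_⟩, ?_⟩, fun _ => rfl,
      fun _ => rfl⟩
    · obtain ⟨h1, h2⟩ := Finset.mem_filter.1 a.1.2
      exact Finset.mem_filter.2 ⟨Finset.mem_filter.2 ⟨h1, congrArg Subtype.val a.2⟩, h2⟩
    · obtain ⟨h1, h2⟩ := Finset.mem_filter.1 a.2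
      exact Finset.mem_filter.2 ⟨(Finset.mem_filter.1 h1).1, h2⟩
    · obtain ⟨h1, h2⟩ := Finset.mem_filter.1 a.2
      exact Subtype.ext (Finset.mem_filter.1 h1).2
  have hsum : ∀ U : Finset α, ∑ a ∈ U, t a =
      ∑ c : ZMod q, ((U.filter fun a => t a = c).card : ZMod q) * c := by
    intro U
    rw [← Finset.sum_fiberwise U t t]
    refine Finset.sum_congr rfl fun c _ => ?_
    rw [Finset.sum_congr rfl fun a ha => (Finset.mem_filter.1 ha).2, Finset.sum_const, nsmul_eq_mul]
  rw [hsum, hsum]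
  exact Finset.sum_congr rfl fun c _ => by rw [key]

/-- More linear forms than the dimension allows satisfy a linear relation. -/
lemma exists_relation {F L ι β : Type} [Field F] [AddCommGroup L] [Module F L] [Fintype ι]
    [Fintype β] (hcard : Fintype.card β < Fintype.card ι) (e : ι → L →ₗ[F] F) (b : β → L →ₗ[F] F)
    (h : ∀ u, (∀ i, b i u = 0) → ∀ i, e i u = 0) :
    ∃ c : ι → F, c ≠ 0 ∧ ∀ u, ∑ i, c i * e i u = 0 := by
  have hmem : ∀ i, e i ∈ Submodule.span F (Set.range b) := fun i => by
    refine mem_span_of_iInf_ker_le_ker fun u hu => ?_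
    simp only [Submodule.mem_iInf, LinearMap.mem_ker] at hu ⊢
    exact h u hu i
  have hdep : ¬ LinearIndependent F e := fun hli => by
    have := Module.Finite.span_of_finite F (Set.finite_range b)
    have := Submodule.finrank_mono (Submodule.span_le.2 (Set.range_subset_iff.2 hmem))
    rw [finrank_span_eq_card hli] at this
    have := finrank_range_le_card (R := F) b
    rw [Set.finrank] at this
    omega
  obtain ⟨c, hc, i, hi⟩ := Fintype.not_linearIndependent_iff.1 hdep
  refine ⟨c, fun h0 => hi (congrFun h0 i), fun u => ?_⟩
  simpa using LinearMap.congr_fun hc u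

namespace StarSplit

variable {G : Type} [Group G] {n p : ℕ} (S : StarSplit G n p)

lemma finite_hs_ne (k : Type) [Ring k] (t : Fin n ⊕ Fin p) (v w : S.V) :
    {x : G | S.hs k t (x⁻¹ • v) ≠ S.hs k t (x⁻¹ • w)}.Finite := by
  classical
  have key : ∀ v, {x : G | S.hs k t (x⁻¹ • v) ≠ S.hs k t (x⁻¹ • S.base 1)}.Finite := by
    intro v
    induction v using S.V_induction with
    | one => simp
    | hQ g t' =>
      have hx : ∀ x ≠ g, S.hs k t (x⁻¹ • S.tgt g t') = S.hs k t (x⁻¹ • S.base g) := fun x hx => by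
        have := S.hs_smul_spec k t x g t'
        rw [if_neg fun h => hx h.1.symm] at this
        exact sub_eq_zero.1 this
      constructor <;> intro hf <;> refine (hf.insert g).subset fun x hxm => ?_ <;>
        by_cases hxg : x = g
      · exact Or.inl hxg
      · exact Or.inr (by rw [Set.mem_ofPred_eq, hx x hxg]; exact hxm)
      · exact Or.inl hxg
      · exact Or.inr (by rw [Set.mem_ofPred_eq, ← hx x hxg]; exact hxm)
  refine ((key v).union (key w)).subset fun x hx => ?_
  by_contra hn
  simp only [Set.mem_union, Set.mem_ofPred_eq, not_or, not_not] at hn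
  exact hx (hn.1.trans hn.2.symm)

variable {S}

/-- Sum of the translates of a function over a subgroup. -/
noncomputable def orbitSum {k : Type} [Ring k] (H : Subgroup G) (D : S.V → k) (w : S.V) : k :=
  ∑ᶠ g ∈ (H : Set G), (D (g⁻¹ • w) - D (g⁻¹ • S.base 1))

lemma orbitSum_sub {k : Type} [Ring k] {H : Subgroup G} {D : S.V → k}
    (hD : ∀ v w, {g : G | D (g⁻¹ • v) ≠ D (g⁻¹ • w)}.Finite) (v w : S.V) :
    orbitSum H D v - orbitSum H D w = ∑ᶠ g ∈ (H : Set G), (D (g⁻¹ • v) - D (g⁻¹ • w)) := by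
  have hfin : ∀ v w, ((H : Set G) ∩ Function.support fun g => D (g⁻¹ • v) - D (g⁻¹ • w)).Finite :=
    fun v w => (hD v w).subset fun g hg => sub_ne_zero.1 hg.2
  rw [sub_eq_iff_eq_add, orbitSum, orbitSum, ← finsum_mem_add_distrib' (hfin _ _) (hfin _ _)]
  simp

lemma orbitSum_affine {k : Type} [Ring k] {H : Subgroup G} {D : S.V → k}
    (hD : ∀ v w, {g : G | D (g⁻¹ • v) ≠ D (g⁻¹ • w)}.Finite) {h : G} (hh : h ∈ H) (v w : S.V) :
    orbitSum H D (h • v) - orbitSum H D (h • w) = orbitSum H D v - orbitSum H D w := by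
  rw [orbitSum_sub hD, orbitSum_sub hD]
  refine finsum_mem_eq_of_bijOn (fun g => h⁻¹ * g) ⟨fun g hg => H.mul_mem (H.inv_mem hh) hg,
    (mul_right_injective _).injOn, fun g hg => ⟨h * g, H.mul_mem hh hg, by simp⟩⟩ fun g _ => ?_
  simp [mul_smul]

/-- The product of a half-space function over an orbit of the extension. -/
noncomputable def Ext.cyc {φ : Monoid.End G} (E : S.Ext φ) (q : ℕ) (x : G) (t : Fin n ⊕ Fin p)
    (w : S.V) : ZMod q :=
  ∏ j ∈ Finset.range q, S.hs (ZMod q) t (x⁻¹ • E.f^[j] w)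

lemma Ext.finite_cyc_ne {φ : Monoid.End G} (hφ : Function.Injective φ) (E : S.Ext φ) (q : ℕ)
    (x : G) (t : Fin n ⊕ Fin p) (v w : S.V) :
    {g : G | E.cyc q x t (g⁻¹ • v) ≠ E.cyc q x t (g⁻¹ • w)}.Finite := by
  refine (Set.Finite.biUnion (Finset.range q).finite_toSet fun j _ =>
    (S.finite_hs_ne (ZMod q) t (E.f^[j] v) (E.f^[j] w)).preimage
    (f := fun g => (φ ^ j : Monoid.End G) g * x) ?_).subset fun g hg => ?_
  · exact (((mul_left_injective x).comp (pow_injective hφ j))).injOn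
  · by_contra hn
    simp only [Set.mem_iUnion, Set.mem_preimage, Set.mem_ofPred_eq, not_exists, not_not] at hn
    refine hg (Finset.prod_congr rfl fun j hj => ?_)
    have := hn j hj
    have hf : ∀ y, x⁻¹ • E.f^[j] (g⁻¹ • y) = ((φ ^ j : Monoid.End G) g * x)⁻¹ • E.f^[j] y := by
      intro y
      have := (E.pow j).f_smul g⁻¹ y
      rw [mul_inv_rev, mul_smul, ← map_inv]
      exact congrArg _ this
    rw [hf, hf]
    exact this

lemma Ext.cyc_apply {φ : Monoid.End G} (E : S.Ext φ) {q : ℕ} (hq : 0 < q) (x : G)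
    (t : Fin n ⊕ Fin p) {w : S.V} (hw : E.f^[q] w = w) : E.cyc q x t (E.f w) = E.cyc q x t w := by
  obtain ⟨m, rfl⟩ := Nat.exists_eq_succ_of_ne_zero hq.ne'
  rw [Ext.cyc, Ext.cyc, Finset.prod_range_succ, Finset.prod_range_succ']
  simp only [← Function.iterate_succ_apply]
  rw [hw, Function.iterate_zero, id]

lemma Ext.cyc_of_fixed {φ : Monoid.End G} (E : S.Ext φ) {q : ℕ} [Fact q.Prime] (x : G)
    (t : Fin n ⊕ Fin p) {w : S.V} (hw : E.f w = w) :
    E.cyc q x t w = S.hs (ZMod q) t (x⁻¹ • w) := by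
  simp only [Ext.cyc, Function.iterate_fixed hw, Finset.prod_const, Finset.card_range,
    ZMod.pow_card]

/-- Modulo `q`, orbit sums over the fixed subgroup of the `q`-th power restrict to those over the
fixed subgroup. -/
lemma Ext.orbitSum_cyc {φ : Monoid.End G} (hφ : Function.Injective φ) (E : S.Ext φ) {q : ℕ}
    [Fact q.Prime] (x : G) (t : Fin n ⊕ Fin p) {w : S.V} (hw : E.f w = w) :
    orbitSum (fixedSubgroup (φ ^ q : Monoid.End G)) (E.cyc q x t) w =
      orbitSum (fixedSubgroup φ) (fun v => S.hs (ZMod q) t (x⁻¹ • v)) w := by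
  classical
  have hfin := (E.finite_cyc_ne hφ q x t w (S.base 1))
  have hq : 0 < q := (Fact.out : q.Prime).pos
  let T := (hfin.inter_of_right (fixedSubgroup (φ ^ q : Monoid.End G) : Set G)).toFinset
  have hT : ∀ g, g ∈ T ↔ (φ ^ q : Monoid.End G) g = g ∧
      E.cyc q x t (g⁻¹ • w) ≠ E.cyc q x t (g⁻¹ • S.base 1) := fun g =>
    Set.Finite.mem_toFinset _
  have hcyc : ∀ g v, (φ ^ q : Monoid.End G) g = g → E.f v = v →
      E.cyc q x t ((φ g)⁻¹ • v) = E.cyc q x t (g⁻¹ • v) := by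
    intro g v hg hv
    have h1 : (φ g)⁻¹ • v = E.f (g⁻¹ • v) := by rw [E.f_smul, hv, map_inv]
    rw [h1]
    refine E.cyc_apply hq x t ?_
    refine ((E.pow q).f_smul g⁻¹ v).trans ?_
    rw [map_inv, hg]
    exact congrArg _ (Function.iterate_fixed hv q)
  have hfix : ∀ g v, φ g = g → E.f v = v →
      E.cyc q x t (g⁻¹ • v) = S.hs (ZMod q) t (x⁻¹ • g⁻¹ • v) := by
    intro g v hg hv
    refine E.cyc_of_fixed x t ?_
    rw [E.f_smul, hv, map_inv, hg]
  have hφq : ∀ g, (φ ^ q : Monoid.End G) g = g → (φ ^ q : Monoid.End G) (φ g) = φ g := by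
    intro g hg
    change (φ ^ q * φ : Monoid.End G) g = _
    rw [← pow_succ, pow_succ']
    exact congrArg φ hg
  have hle : ∀ g, φ g = g → (φ ^ q : Monoid.End G) g = g := fun g hg => by
    rw [Monoid.End.coe_pow]
    exact Function.iterate_fixed hg q
  have hs1 := sum_eq_sum_fixed (q := q) T φ
    (fun g hg => by
      rw [hT] at hg ⊢
      exact ⟨hφq g hg.1, by rw [hcyc g _ hg.1 hw, hcyc g _ hg.1 E.f_base]; exact hg.2⟩)
    (fun g hg => by
      have := ((hT g).1 hg).1
      rwa [Monoid.End.coe_pow] at this)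
    (fun g => E.cyc q x t (g⁻¹ • w) - E.cyc q x t (g⁻¹ • S.base 1))
    (fun g hg => by
      have := ((hT g).1 hg).1
      rw [hcyc g _ this hw, hcyc g _ this E.f_base])
  rw [orbitSum, finsum_mem_eq_sum_of_inter_support_eq (t := T), hs1, orbitSum,
    ← finsum_mem_eq_sum_of_inter_support_eq (s := (fixedSubgroup φ : Set G))]
  · refine finsum_mem_congr rfl fun g hg => ?_
    rw [hfix g _ hg hw, hfix g _ hg E.f_base]
  · ext g
    simp only [Set.mem_inter_iff, SetLike.mem_coe, Function.mem_support,
      Finset.coe_filter, hT, Set.mem_ofPred_eq, sub_ne_zero]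
    exact ⟨fun h => ⟨⟨⟨hle g h.1, h.2⟩, h.1⟩, h.2⟩, fun h => ⟨h.1.2, h.2⟩⟩
  · ext g
    simp only [Set.mem_inter_iff, SetLike.mem_coe, Function.mem_support,
      hT, sub_ne_zero]
    tauto

end StarSplit

namespace StarSplit

variable {G : Type} [Group G] {n p : ℕ}

/-- A function on the vertices is determined by its differences along the edges. -/
lemma sub_eq_sum (S : StarSplit G n p) {k : Type} [Ring k] (U : S.V → k) (w : S.V) :
    U w - U (S.base 1) = ∑ t, ∑ᶠ x, (U (S.tgt x t) - U (S.base x)) *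
      (S.hs k t (x⁻¹ • w) - S.hs k t (x⁻¹ • S.base 1)) := by
  classical
  have hfin : ∀ t w, Function.HasFiniteSupport fun x => (U (S.tgt x t) - U (S.base x)) *
      (S.hs k t (x⁻¹ • w) - S.hs k t (x⁻¹ • S.base 1)) := fun t w =>
    (S.finite_hs_ne k t w (S.base 1)).subset fun x hx => by
      by_contra hn
      simp only [Set.mem_ofPred_eq, not_not] at hn
      exact hx (by simp [hn])
  refine congrFun (S.vpot_unique (h := fun w => U w - U (S.base 1)) (h' := fun w =>
    ∑ t, ∑ᶠ x, (U (S.tgt x t) - U (S.base x)) *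
      (S.hs k t (x⁻¹ • w) - S.hs k t (x⁻¹ • S.base 1))) (by simp) fun g t' => ?_) w
  simp only [sub_sub_sub_cancel_right]
  rw [← Finset.sum_sub_distrib, Finset.sum_eq_single t']
  · rw [← finsum_sub_distrib (hfin _ _) (hfin _ _), finsum_eq_single _ g]
    · rw [← mul_sub, sub_sub_sub_cancel_right, S.hs_smul_spec]
      simp
    · intro x hx
      rw [← mul_sub, sub_sub_sub_cancel_right, S.hs_smul_spec,
        if_neg fun h => hx h.1.symm, mul_zero]
  · intro t _ ht
    rw [← finsum_sub_distrib (hfin _ _) (hfin _ _)]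
    refine finsum_eq_zero_of_forall_eq_zero fun x => ?_
    rw [← mul_sub, sub_sub_sub_cancel_right, S.hs_smul_spec, if_neg fun h => ht h.2.symm, mul_zero]
  · simp

variable {S : StarSplit G n p} {H : Subgroup G}

lemma Transversal.sum_red_eq_orbitSum [DecidableEq G] (R : S.Transversal H) {k : Type} [Ring k]
    (t : Fin n ⊕ Fin p) (w : S.V) {T : Finset G}
    (hT : ∀ x, S.hs k t (x⁻¹ • w) ≠ S.hs k t (x⁻¹ • S.base 1) → x ∈ T)
    {r : G} (hr : R.red r = r) :
    ∑ x ∈ T with R.red x = r, (S.hs k t (x⁻¹ • w) - S.hs k t (x⁻¹ • S.base 1)) =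
      orbitSum H (fun v => S.hs k t (r⁻¹ • v)) w := by
  rw [← finsum_mem_eq_sum_of_inter_support_eq (s := {x | R.red x = r}), orbitSum]
  · symm
    refine finsum_mem_eq_of_bijOn (· * r) ⟨fun g hg => (R.red_mul hg r).trans hr,
      (mul_left_injective r).injOn, fun x hx => ⟨R.coc x, R.coc_mem x, ?_⟩⟩ fun g _ => ?_
    · change R.coc x * r = x
      rw [← show R.red x = r from hx, R.coc_mul_red]
    · simp [mul_smul]
  · ext x
    simp only [Set.mem_inter_iff, Set.mem_ofPred_eq, Function.mem_support, sub_ne_zero,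
      Finset.coe_filter]
    exact ⟨fun h => ⟨⟨hT x h.2, h.1⟩, h.2⟩, fun h => ⟨h.1.2, h.2⟩⟩

/-- A relation between orbit sums of half-space functions holds for all equivariant functions. -/
lemma Transversal.sum_mul_sub_eq_zero (R : S.Transversal H) {k ι : Type} [CommRing k] [Fintype ι]
    (c : ι → k) (w : ι → S.V)
    (hc : ∀ (x : G) t, ∑ i, c i * orbitSum H (fun v => S.hs k t (x⁻¹ • v)) (w i) = 0) {U : S.V → k}
    (hU : ∀ h ∈ H, ∀ v w, U (h • v) - U (h • w) = U v - U w) :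
    ∑ i, c i * (U (w i) - U (S.base 1)) = 0 := by
  classical
  have hfin : (⋃ i, ⋃ t, {x : G | S.hs k t (x⁻¹ • w i) ≠
      S.hs k t (x⁻¹ • S.base 1)}).Finite :=
    Set.finite_iUnion fun i => Set.finite_iUnion fun t => S.finite_hs_ne k t (w i) (S.base 1)
  let T : Finset G := hfin.toFinset
  have hT : ∀ i t x, S.hs k t (x⁻¹ • w i) ≠ S.hs k t (x⁻¹ • S.base 1) → x ∈ T := fun i t x h =>
    (Set.Finite.mem_toFinset _).2 (Set.mem_iUnion.2 ⟨i, Set.mem_iUnion.2 ⟨t, h⟩⟩)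
  have h1 : ∀ i, U (w i) - U (S.base 1) = ∑ t, ∑ x ∈ T, (U (S.tgt x t) - U (S.base x)) *
      (S.hs k t (x⁻¹ • w i) - S.hs k t (x⁻¹ • S.base 1)) := fun i => by
    rw [S.sub_eq_sum U]
    refine Finset.sum_congr rfl fun t _ => finsum_eq_sum_of_support_subset _ fun x hx => ?_
    refine hT i t x fun h => hx ?_
    change _ * (_ - _) = 0
    rw [h, sub_self, mul_zero]
  simp only [h1, Finset.mul_sum]
  rw [Finset.sum_comm]
  refine Finset.sum_eq_zero fun t _ => ?_
  rw [Finset.sum_comm, ← Finset.sum_fiberwise_of_maps_to (t := T.image R.red)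
    fun x hx => Finset.mem_image_of_mem _ hx]
  refine Finset.sum_eq_zero fun r hr => ?_
  obtain ⟨r, -, rfl⟩ := Finset.mem_image.1 hr
  have h2 := hc (R.red r) t
  have hedge : ∀ x, U (S.tgt x t) - U (S.base x) = U (S.tgt (R.red x) t) - U (S.base (R.red x)) :=
    fun x => by
      have := hU _ (R.coc_mem x) (S.tgt (R.red x) t) (S.base (R.red x))
      rwa [S.smul_tgt, S.smul_base, R.coc_mul_red] at this
  rw [Finset.sum_congr rfl fun x hx => by rw [hedge x, (Finset.mem_filter.1 hx).2], Finset.sum_comm]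
  simp only [← R.sum_red_eq_orbitSum t _ (hT _ t) (R.red_red r)] at h2
  rw [← mul_zero (U (S.tgt (R.red r) t) - U (S.base (R.red r))), ← h2, Finset.mul_sum]
  refine Finset.sum_congr rfl fun i _ => ?_
  rw [Finset.mul_sum, Finset.mul_sum]
  exact Finset.sum_congr rfl fun x _ => by ring

/-- The vertices attached to the factors of the Kurosh decomposition. -/
def Transversal.vert (R : S.Transversal H) : R.SingIdx ⊕ R.ExitIdx → S.V
  | .inl v => v.1
  | .inr x => R.exitElt x • S.base 1

lemma stab_base (g : G) : S.stab H (S.base g) = ⊥ :=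
  (Subgroup.eq_bot_iff_forall _).2 fun _ hx => S.eq_one_of_smul_base (mem_stab.1 hx).1

/-- The vertices attached to the Kurosh factors are independent with respect to equivariant
functions. -/
lemma Transversal.eq_zero_of_relation (R : S.Transversal H) {k ι : Type} [CommRing k] [Fintype ι]
    (c : ι → k) {w : ι → R.SingIdx ⊕ R.ExitIdx} (hw : Function.Injective w)
    (hc : ∀ U : S.V → k, (∀ h ∈ H, ∀ v w, U (h • v) - U (h • w) = U v - U w) →
      ∑ i, c i * (U (R.vert (w i)) - U (S.base 1)) = 0) : c = 0 := by
  classical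
  funext i
  obtain ⟨U, hU, hUi⟩ : ∃ U : S.V → k, (∀ h ∈ H, ∀ v w, U (h • v) - U (h • w) = U v - U w) ∧
      ∀ j, U (R.vert j) - U (S.base 1) = if j = w i then 1 else 0 := by
    rcases w i with v | x
    · refine ⟨fun y => if R.rep y = v.1 then 1 else 0, fun h hh y z => by
        simp only [R.rep_smul h hh], fun j => ?_⟩
      have h0 : ∀ h ∈ H, R.rep (h • S.base 1) ≠ v.1 := fun h hh hv => v.2.2 (by
        rw [← hv, R.rep_smul h hh, R.rep_base, stab_base])
      have h1 := h0 1 H.one_mem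
      rw [one_smul] at h1
      rcases j with v' | x
      · simp [vert, h1, v'.2.1, Subtype.ext_iff]
      · change (if R.rep (R.exitElt x • S.base 1) = v.1 then (1 : k) else 0) -
          (if R.rep (S.base 1) = v.1 then 1 else 0) = _
        rw [if_neg (h0 (R.exitElt x) (R.mv_mem _)), if_neg h1]
        simp
    · obtain ⟨U, h1, h2, h3, h4⟩ := R.exists_dual k x
      refine ⟨U, h1, fun j => ?_⟩
      rcases j with v | y
      · simp [vert, h2, h3 v.1 v.2.1]
      · change U (R.exitElt y • S.base 1) - U (S.base 1) = _
        rw [h4, h2]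
        simp
  have := hc U hU
  simpa [hUi, hw.eq_iff] using this

/-- Passing from the fixed subgroup of a prime power to that of an endomorphism. -/
lemma SpanLE.kuroshLE {φ : Monoid.End G} (hφ : Function.Injective φ) (E : S.Ext φ) {q N : ℕ}
    [Fact q.Prime] (h : S.SpanLE (fixedSubgroup (φ ^ q : Monoid.End G)) N) :
    S.KuroshLE (fixedSubgroup φ) N := by
  classical
  intro R I X
  by_contra hN
  obtain ⟨B, hB, hspan⟩ := h
  let L : Submodule (ZMod q) (S.V → ZMod q) :=
    { carrier := {u | ∀ h ∈ fixedSubgroup (φ ^ q : Monoid.End G), ∀ v w,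
        u (h • v) - u (h • w) = u v - u w}
      add_mem' := fun {a b} ha hb h hh v w => by
        simp only [Pi.add_apply, add_sub_add_comm, ha h hh v w, hb h hh v w]
      zero_mem' := fun h hh v w => by simp
      smul_mem' := fun r a ha h hh v w => by
        simp only [Pi.smul_apply, ← smul_sub, ha h hh v w] }
  let ev : S.V → L →ₗ[ZMod q] ZMod q := fun v =>
    ((LinearMap.proj v : (S.V → ZMod q) →ₗ[ZMod q] ZMod q) - LinearMap.proj (S.base 1)) ∘ₗ
      L.subtype
  have hev : ∀ v (u : L), ev v u = u.1 v - u.1 (S.base 1) := fun _ _ => rfl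
  let w : I ⊕ X → R.SingIdx ⊕ R.ExitIdx := Sum.map Subtype.val Subtype.val
  have hle : ∀ g, φ g = g → (φ ^ q : Monoid.End G) g = g := fun g hg => by
    rw [Monoid.End.coe_pow]
    exact Function.iterate_fixed hg q
  obtain ⟨c, hc0, hc⟩ := exists_relation (β := B) (by
      rw [Fintype.card_sum, Fintype.card_coe, Fintype.card_coe, Fintype.card_coe]
      omega) (fun i => ev (R.vert (w i))) (fun b => ev b.1) (fun u hu i => by
    rw [hev, sub_eq_zero]
    refine hspan q u.1 u.2 (fun b hb => sub_eq_zero.1 (hu ⟨b, hb⟩)) _ ?_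
    rcases w i with v | x
    · left
      refine fun hb => v.2.2 ((Subgroup.eq_bot_iff_forall _).2 fun y hy => ?_)
      have : y ∈ S.stab (fixedSubgroup (φ ^ q : Monoid.End G)) v.1 :=
        mem_stab.2 ⟨(mem_stab.1 hy).1, hle y (mem_stab.1 hy).2⟩
      change S.stab _ v.1 = ⊥ at hb
      rwa [hb, Subgroup.mem_bot] at this
    · exact Or.inr ⟨_, hle _ (R.mv_mem _), rfl⟩)
  refine hc0 (R.eq_zero_of_relation c (w := w) (Sum.map_injective.2
    ⟨Subtype.val_injective, Subtype.val_injective⟩) fun U hU => ?_)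
  refine R.sum_mul_sub_eq_zero c (fun i => R.vert (w i)) (fun x t => ?_) hU
  have := hc ⟨orbitSum (fixedSubgroup (φ ^ q : Monoid.End G)) (E.cyc q x t),
    fun h hh => orbitSum_affine (E.finite_cyc_ne hφ q x t) hh⟩
  rw [← this]
  refine Finset.sum_congr rfl fun i _ => ?_
  have hw : E.f (R.vert (w i)) = R.vert (w i) := by
    rcases w i with v | y
    · obtain ⟨h, hh, h1⟩ := (Subgroup.bot_or_exists_ne_one _).resolve_left v.2.2
      exact E.fixed_of_smul h1 (mem_stab.1 hh).2 (mem_stab.1 hh).1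
    · change E.f (R.exitElt y • S.base 1) = R.exitElt y • S.base 1
      rw [E.f_smul, E.f_base, show φ (R.exitElt y) = R.exitElt y from R.mv_mem _]
  rw [hev, ← E.orbitSum_cyc hφ x t hw]
  simp [orbitSum]

lemma SpanLE.kuroshLE_of_pow {N : ℕ} {k : ℕ} (hk : 2 ≤ k) : ∀ {φ : Monoid.End G}
    (_ : Function.Injective φ) (_ : S.Ext φ)
    (_ : S.SpanLE (fixedSubgroup (φ ^ k : Monoid.End G)) N), S.KuroshLE (fixedSubgroup φ) N := by
  induction k using Nat.strong_induction_on with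
  | _ k ih =>
    intro φ hφ E h
    obtain ⟨q, hq, m, rfl⟩ := Nat.exists_prime_and_dvd (n := k) (by omega)
    have := Fact.mk hq
    by_cases hm : m = 1
    · rw [hm, mul_one] at h
      exact h.kuroshLE hφ E
    · have hm0 : m ≠ 0 := by rintro rfl; omega
      rw [mul_comm, pow_mul] at h
      exact ih m (by nlinarith [hq.two_le, Nat.pos_of_ne_zero hm0]) (by omega) hφ E
        (h.kuroshLE (pow_injective hφ m) (E.pow m)).spanLE

/-- The fixed subgroup of an extendable monomorphism has Kurosh rank at most `n + p`. -/
theorem kuroshLE_fixedSubgroup {φ : Monoid.End G} (hφ : Function.Injective φ) (E : S.Ext φ) :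
    S.KuroshLE (fixedSubgroup φ) (n + p) := by
  obtain ⟨k, hk, h⟩ := exists_spanLE_pow hφ E
  exact SpanLE.kuroshLE_of_pow hk hφ E h

end StarSplit

namespace SumProd

/-- Reindexing the factors of a free product. -/
lemma exists_reindex {α α' β β' : Type} {A : α → Type} {A' : α' → Type} {C : Type}
    [∀ a, Group (A a)] [∀ a, Group (A' a)] [Group C] (ε : α' ≃ α) (δ : β' ≃ β)
    (θ : ∀ a, A' a ≃* A (ε a)) :
    ∃ e : CoprodI (Sum.elim A fun _ : β => C) ≃* CoprodI (Sum.elim A' fun _ : β' => C),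
      ∀ a x, e.symm (inlHom A' (fun _ : β' => C) a x) =
        inlHom A (fun _ : β => C) (ε a) (θ a x) := by
  have h : ∀ a, ∃ f : A a →* CoprodI (Sum.elim A' fun _ : β' => C),
      (∀ a' (h : ε a' = a) x, f (h ▸ θ a' x) = inlHom A' (fun _ : β' => C) a' x) ∧
      ∀ x, ∃ (a' : α') (h : ε a' = a) (y : A' a'), h ▸ θ a' y = x := fun a => by
    obtain ⟨a', rfl⟩ := ε.surjective a
    refine ⟨(inlHom A' (fun _ : β' => C) a').comp (θ a').symm.toMonoidHom, fun b h x => ?_,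
      fun x => ⟨a', rfl, (θ a').symm x, (θ a').apply_symm_apply x⟩⟩
    obtain rfl := ε.injective h
    simp
  choose f hf hs using h
  have hf' : ∀ a x, f (ε a) (θ a x) = inlHom A' (fun _ : β' => C) a x := fun a x => hf _ a rfl x
  let F : CoprodI (Sum.elim A' fun _ : β' => C) →* CoprodI (Sum.elim A fun _ : β => C) :=
    liftHom (fun a => (inlHom A (fun _ : β => C) (ε a)).comp (θ a).toMonoidHom)
      fun b => inrHom A (fun _ : β => C) (δ b)
  let E : CoprodI (Sum.elim A fun _ : β => C) →* CoprodI (Sum.elim A' fun _ : β' => C) :=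
    liftHom f fun b => inrHom A' (fun _ : β' => C) (δ.symm b)
  have hF : ∀ a x, F (inlHom A' (fun _ : β' => C) a x) = inlHom A (fun _ : β => C) (ε a) (θ a x) :=
    fun _ _ => liftHom_inl ..
  have hF' : ∀ b x, F (inrHom A' (fun _ : β' => C) b x) = inrHom A (fun _ : β => C) (δ b) x :=
    fun _ _ => liftHom_inr ..
  have hE : ∀ a x, E (inlHom A (fun _ : β => C) a x) = f a x := fun _ _ => liftHom_inl ..
  have hE' : ∀ b x, E (inrHom A (fun _ : β => C) b x) = inrHom A' (fun _ : β' => C) (δ.symm b) x :=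
    fun _ _ => liftHom_inr ..
  refine ⟨⟨⟨E, F, fun x => ?_, fun x => ?_⟩, map_mul E⟩, hF⟩
  · induction x using SumProd.induction_on with
    | one => rw [map_one, map_one]
    | mul x y hx hy => rw [map_mul, map_mul, hx, hy]
    | inl a x =>
      obtain ⟨a', rfl, y, rfl⟩ := hs a x
      rw [hE, hf', hF]
    | inr b x => rw [hE', hF', δ.apply_symm_apply]
  · induction x using SumProd.induction_on with
    | one => rw [map_one, map_one]
    | mul x y hx hy => rw [map_mul, map_mul, hx, hy]
    | inl a x => rw [hF, hE, hf']
    | inr b x => rw [hF', hE', δ.symm_apply_apply]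

end SumProd

namespace StarSplit

lemma stabilizer_smul_star {G : Type} [Group G] {n p : ℕ} (S : StarSplit G n p) (g : G)
    (i : Fin n) : MulAction.stabilizer G (g • S.star i 1) = conjSubgroup g (S.A i) := by
  ext x
  rw [MulAction.mem_stabilizer_iff, S.smul_star, S.smul_star, mul_one, eq_comm, S.star_eq_iff,
    conjSubgroup, Subgroup.mem_map]
  constructor
  · exact fun h => ⟨_, h, by simp [mul_assoc]⟩
  · rintro ⟨y, hy, rfl⟩
    simpa [mul_assoc] using hy

variable {n p : ℕ} {Gf : Fin n → Type} [∀ i, Group (Gf i)]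

/-- An endomorphism mapping the factors into conjugates of factors acts on the vertices. -/
noncomputable def extOfConj {G : Type} [Group G] (S : StarSplit G n p) (φ : Monoid.End G)
    (σ : Fin n → Fin n) (w : Fin n → G)
    (h : ∀ i, (S.A i).map φ ≤ conjSubgroup (w i) (S.A (σ i))) : S.Ext φ where
  f := Sum.elim (fun g => S.base (φ g)) fun s => Quotient.liftOn' s.2
    (fun g => S.star (σ s.1) (φ g * w s.1)) fun g g' hg => by
      obtain ⟨y, hy, hyx⟩ := Subgroup.mem_map.1 (h s.1 (Subgroup.mem_map_of_mem φ
        (QuotientGroup.leftRel_apply.1 hg)))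
      rw [S.star_eq_iff]
      convert hy using 1
      have h1 : w s.1 * y * (w s.1)⁻¹ = (φ g)⁻¹ * φ g' :=
        hyx.trans ((map_mul φ _ _).trans (by rw [map_inv]))
      calc (φ g * w s.1)⁻¹ * (φ g' * w s.1)
          = (w s.1)⁻¹ * ((φ g)⁻¹ * φ g') * w s.1 := by group
        _ = y := by
          rw [← h1]
          group
  f_smul g v := by
    rcases v with g' | ⟨i, c⟩
    · exact congrArg S.base (map_mul φ g g')
    · induction c using Quotient.inductionOn' with
      | h g' =>
        change S.star (σ i) (φ (g * g') * w i) = S.star (σ i) (φ g * (φ g' * w i))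
        rw [map_mul, mul_assoc]
  f_base := congrArg S.base (map_one φ)

lemma nonempty_ext (hG : ∀ i, ¬ Nonempty (Gf i ≃* Multiplicative ℤ))
    (φ : Monoid.End (CoprodI (Sum.elim Gf fun _ : Fin p => Multiplicative ℤ)))
    (hsym : IsSymmetric φ) : Nonempty ((ofCoprod Gf p).Ext φ) := by
  have h : ∀ i : Fin n, ∃ (j : Fin n) (w : CoprodI (Sum.elim Gf fun _ : Fin p => Multiplicative ℤ)),
      ((ofCoprod Gf p).A i).map φ ≤ conjSubgroup w ((ofCoprod Gf p).A j) := fun i => by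
    obtain ⟨j | j, w, hj, hw⟩ := hsym (.inl i) (hG i)
    · exact ⟨j, w, hw⟩
    · exact (hj ⟨MulEquiv.refl (Multiplicative ℤ)⟩).elim
  choose σ w h using h
  exact ⟨extOfConj _ φ σ w h⟩

lemma KuroshLE.hasKuroshRankLE
    {H : Subgroup (CoprodI (Sum.elim Gf fun _ : Fin p => Multiplicative ℤ))} {N : ℕ}
    (h : (ofCoprod Gf p).KuroshLE H N) : HasKuroshRankLE H N := by
  obtain ⟨R⟩ := exists_transversal (ofCoprod Gf p) H
  obtain ⟨_, _⟩ := h.finite R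
  have := Fintype.ofFinite R.SingIdx
  have := Fintype.ofFinite R.ExitIdx
  let ε := (Fintype.equivFin R.SingIdx).symm
  have hv : ∀ v : R.SingIdx, ∃ (g : CoprodI (Sum.elim Gf fun _ : Fin p => Multiplicative ℤ))
      (i : Fin n), v.1 = g • (ofCoprod Gf p).star i 1 := fun v => by
    obtain ⟨x, hx, h1⟩ := (Subgroup.bot_or_exists_ne_one _).resolve_left v.2.2
    exact exists_smul_star h1 (mem_stab.1 hx).1
  choose g i hv using hv
  have hst : ∀ v : R.SingIdx, conjSubgroup (g v) (factorSubgroup (.inl (i v))) ⊓ H =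
      (ofCoprod Gf p).stab H v.1 := fun v => by
    rw [stab, hv v, stabilizer_smul_star]
    rfl
  obtain ⟨e, he⟩ := SumProd.exists_reindex
    (A := fun v : R.SingIdx => ↥((ofCoprod Gf p).stab H v.1))
    (A' := fun a => ↥(conjSubgroup (g (ε a)) (factorSubgroup (.inl (i (ε a)))) ⊓ H))
    (C := Multiplicative ℤ) ε
    (Fintype.equivFin R.ExitIdx).symm fun a => MulEquiv.subgroupCongr (hst (ε a))
  refine ⟨_, _, fun a => .inl (i (ε a)), fun a => g (ε a), R.equiv.trans e,
    h R Finset.univ Finset.univ, fun a => ?_, fun a x => ?_⟩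
  · rw [hst, Subgroup.nontrivial_iff_ne_bot]
    exact (ε a).2.2
  · exact (congrArg R.toG (he a x)).trans (SumProd.liftHom_inl ..)

end StarSplit

/-- Theorem 1 of the paper. Let `G = G_1 * … * G_n * F`, where each
`G_i` is not infinite cyclic and `F` is a free group of finite rank `p`.  If `φ : G → G`
is a symmetric monomorphism, then `Fix(φ)` has Kurosh rank at most `n + p` with respect
to this splitting of `G`. -/
theorem kurosh_rank_fixedSubgroup_of_symmetric_monomorphism {n p : ℕ}
    (Gf : Fin n → Type) [∀ i, Group (Gf i)]
    (hG : ∀ i, ¬ Nonempty (Gf i ≃* Multiplicative ℤ))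
    (φ : CoprodI (Sum.elim Gf fun _ : Fin p => Multiplicative ℤ) →*
        CoprodI (Sum.elim Gf fun _ : Fin p => Multiplicative ℤ))
    (hinj : Function.Injective φ)
    (hsym : IsSymmetric φ) :
    HasKuroshRankLE (fixedSubgroup φ) (n + p) := by
  obtain ⟨E⟩ := StarSplit.nonempty_ext hG φ hsym
  exact (StarSplit.kuroshLE_fixedSubgroup hinj E).hasKuroshRankLE
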